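/- arXiv:2401.08883 — 3 statements merged into one kernel-verified Lean document; each statement's English description precedes it below -/
import Mathlib

section
/- Let D² denote the closed unit disk in ℝ². If α, β : [0,1] → D² are staggered Cantor paths with α(0) = β(0) and α(1) = β(1), then there exists a path γ : [0,1] → D² such that α ≃ᵣ γ and β ≃ᵣ γ. -/
open Set Filter Topology

noncomputable section

/-- An ℝ-tree: a nonempty geodesic, uniquely arcwise connected, locally arcwise connected
metric space. -/
structure IsRTree (T : Type) [MetricSpace T] : Prop where
  nonempty : Nonempty T
  geodesic : ∀ x y : T, ∃ γ : ℝ → T, γ 0 = x ∧ γ (dist x y) = y ∧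
    ∀ s ∈ Set.Icc (0:ℝ) (dist x y), ∀ t ∈ Set.Icc (0:ℝ) (dist x y),
      dist (γ s) (γ t) = |s - t|
  uniquelyArcwise : ∀ p q : unitInterval → T, Continuous p → Continuous q →
    Function.Injective p → Function.Injective q → p 0 = q 0 → p 1 = q 1 →
    Set.range p = Set.range q
  locallyArcwise : LocPathConnectedSpace T

/-- `β` is a geodesic ℝ-tree reduction of `α`, i.e. `α ≥ᵣ β`. -/
def GeodesicReduction {X : Type*} [TopologicalSpace X] (α β : unitInterval → X) : Prop :=
  ∃ (T : Type) (_ : MetricSpace T), IsRTree T ∧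
    ∃ (f : T → X) (p r : unitInterval → T),
      Continuous f ∧ Continuous p ∧ Continuous r ∧ Function.Injective r ∧
      r 0 = p 0 ∧ r 1 = p 1 ∧ f ∘ p = α ∧ f ∘ r = β

/-- The concatenation of `α` with the reverse of `β`: `α` on `[0,1/2]`, reverse of `β`
on `[1/2,1]`. -/
def ConcatReverse {X : Type*} (α β : unitInterval → X) : unitInterval → X :=
  fun t => if (t : ℝ) ≤ 1 / 2
    then α (Set.projIcc (0:ℝ) 1 zero_le_one (2 * (t : ℝ)))
    else β (Set.projIcc (0:ℝ) 1 zero_le_one (2 - 2 * (t : ℝ)))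

/-- The standard concatenation `α·β`: `α` on `[0,1/2]`, `β` on `[1/2,1]`. -/
def PathConcat {X : Type*} (α β : unitInterval → X) : unitInterval → X :=
  fun t => if (t : ℝ) ≤ 1 / 2
    then α (Set.projIcc (0:ℝ) 1 zero_le_one (2 * (t : ℝ)))
    else β (Set.projIcc (0:ℝ) 1 zero_le_one (2 * (t : ℝ) - 1))

/-- `α ≃ᵣ β`: the loop `α·(reverse β)` factors through an ℝ-tree. -/
def RTreeHomotopic {X : Type*} [TopologicalSpace X] (α β : unitInterval → X) : Prop :=
  α 0 = β 0 ∧ α 1 = β 1 ∧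
  ∃ (T : Type) (_ : MetricSpace T), IsRTree T ∧
    ∃ (f : T → X) (ℓ : unitInterval → T),
      Continuous f ∧ Continuous ℓ ∧ ℓ 0 = ℓ 1 ∧ f ∘ ℓ = ConcatReverse α β

/-- `α ≡ β`: equality up to an increasing self-homeomorphism of `[0,1]`. -/
def PathEquiv {X : Type*} (α β : unitInterval → X) : Prop :=
  ∃ h : unitInterval ≃ₜ unitInterval, StrictMono (⇑h) ∧ α = β ∘ ⇑h

/-- Fréchet equivalence of paths. -/
def FrechetEquiv {X : Type*} (α β : unitInterval → X) : Prop :=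
  ∃ f g : unitInterval → unitInterval,
    Continuous f ∧ Continuous g ∧ Monotone f ∧ Monotone g ∧
    Function.Surjective f ∧ Function.Surjective g ∧ α ∘ f = β ∘ g

/-- `p` lifts all paths uniquely rel. starting point. -/
def LiftsPathsUniquely {E X : Type*} [TopologicalSpace E] [TopologicalSpace X]
    (p : E → X) : Prop :=
  ∀ α : unitInterval → X, Continuous α → ∀ e : E, p e = α 0 →
    ∃! αl : unitInterval → E, Continuous αl ∧ αl 0 = e ∧ p ∘ αl = α

/-- An open `U ⊆ (0,1)` is a Cantor complement if `[0,1] \ U` is homeomorphic to the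
Cantor set. -/
def IsCantorComplement (U : Set ℝ) : Prop :=
  IsOpen U ∧ U ⊆ Set.Ioo 0 1 ∧ Nonempty (↥(Set.Icc (0:ℝ) 1 \ U) ≃ₜ (ℕ → Bool))

/-- `𝒪(α)`: the set of points of `[0,1]` (as reals) at which `α` is locally constant. -/
def Oset {X : Type*} [TopologicalSpace X] (α : unitInterval → X) : Set ℝ :=
  {x | ∃ hx : x ∈ unitInterval,
    ∃ U ∈ nhds (⟨x, hx⟩ : unitInterval), ∀ s ∈ U, α s = α ⟨x, hx⟩}

/-- A Cantor path: a non-constant path whose locally-constant set is a Cantor complement. -/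
def IsCantorPath {X : Type*} [TopologicalSpace X] (α : unitInterval → X) : Prop :=
  Continuous α ∧ (∃ s t, α s ≠ α t) ∧ IsCantorComplement (Oset α)

/-- Two Cantor paths are staggered if their locally-constant sets cover `(0,1)`. -/
def StaggeredPaths {X : Type*} [TopologicalSpace X] (α β : unitInterval → X) : Prop :=
  Oset α ∪ Oset β = Set.Ioo 0 1

/-- The restriction of `β` to `[a,b]`, linearly reparameterized on `[0,1]`. -/
def restrictIcc {X : Type*} (β : unitInterval → X) (a b : ℝ) : unitInterval → X :=
  fun t => β (Set.projIcc (0:ℝ) 1 zero_le_one (a + (b - a) * (t : ℝ)))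

/-- A Cantor-inverse-pair loop (CIP-loop). -/
def IsCIPLoop {X : Type*} [TopologicalSpace X] (ℓ : unitInterval → X) : Prop :=
  ∃ (α : unitInterval → X) (h : unitInterval ≃ₜ unitInterval), StrictMono (⇑h) ∧
    ℓ ∘ ⇑h = ConcatReverse α α ∧
    (IsCantorPath α ∨
      ∃ (α₁ : unitInterval → X) (x : X) (h' : unitInterval ≃ₜ unitInterval),
        StrictMono (⇑h') ∧ IsCantorPath α₁ ∧ α ∘ ⇑h' = PathConcat α₁ (fun _ => x))

/-- `β` is a `𝒰`-extension of `α` for `𝒰` a set of connected components of `𝒪(α)`. -/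
def UExtension {X : Type*} [TopologicalSpace X] (α β : unitInterval → X)
    (𝒰 : Set (Set ℝ)) : Prop :=
  (∀ J ∈ 𝒰, ∃ x ∈ Oset α, J = connectedComponentIn (Oset α) x) ∧
  (∀ t : unitInterval, (t : ℝ) ∉ ⋃₀ 𝒰 → β t = α t) ∧
  (∀ J ∈ 𝒰, IsCIPLoop (restrictIcc β (sInf J) (sSup J)))

/-- `α ⪯* β`: `β` is a `𝒰`-extension of `α` for some `𝒰 ⊆ lc(α)`. -/
def PrecExt {X : Type*} [TopologicalSpace X] (α β : unitInterval → X) : Prop :=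
  ∃ 𝒰 : Set (Set ℝ), UExtension α β 𝒰

/-- The sup-metric `ρ` on paths into a metric space. -/
def pathDist {X : Type*} [PseudoMetricSpace X] (α β : unitInterval → X) : ℝ :=
  ⨆ t : unitInterval, dist (α t) (β t)

/-- The image of a set `U ⊆ [0,1] ⊆ ℝ` under a self-homeomorphism of `[0,1]`. -/
def imageOnIcc (f : unitInterval ≃ₜ unitInterval) (U : Set ℝ) : Set ℝ :=
  Subtype.val '' (⇑f '' (Subtype.val ⁻¹' U))

/-- The Euclidean half-space of dimension `n` (all of `ℝ⁰` when `n = 0`). -/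
def halfSpace (n : ℕ) : Set (EuclideanSpace ℝ (Fin n)) :=
  {y | ∀ i : Fin n, (i : ℕ) = 0 → 0 ≤ y i}

/-- A topological manifold with (possibly empty) boundary: second countable, Hausdorff,
locally homeomorphic to open subsets of Euclidean half-spaces. -/
def IsTopManifold (M : Type*) [TopologicalSpace M] : Prop :=
  SecondCountableTopology M ∧ T2Space M ∧
  ∀ x : M, ∃ (n : ℕ) (U : Set M) (V : Set (halfSpace n)),
    U ∈ nhds x ∧ IsOpen V ∧ Nonempty (↥U ≃ₜ ↥V)

/-- The closed unit disk in the Euclidean plane. -/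
abbrev Disk2 : Type := ↥(Metric.closedBall (0 : EuclideanSpace ℝ (Fin 2)) 1)

end

section Hyperbolic

/-- The four-point condition characterizing `0`-hyperbolic spaces. -/
def FourPoint (T : Type*) [PseudoMetricSpace T] : Prop :=
  ∀ w x y z : T, dist w z + dist x y ≤ max (dist w x + dist z y) (dist w y + dist z x)

/-- Every distance between two points can be split in any prescribed way. -/
def HasBetween (T : Type*) [PseudoMetricSpace T] : Prop :=
  ∀ x y : T, ∀ a ∈ Icc (0 : ℝ) (dist x y), ∃ z, dist x z = a ∧ dist z y = dist x y - a

variable {T : Type} [MetricSpace T]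

theorem FourPoint.mem_image_of_between (hT : FourPoint T) {x y z : T}
    (hz : dist x z + dist z y = dist x y) {S : Set T} (hS : IsPreconnected S)
    (hx : x ∈ S) (hy : y ∈ S) : z ∈ S := by
  by_contra hzS
  have hne : ∀ w ∈ S, 0 < dist w z := fun w hw =>
    dist_pos.2 (fun h => hzS (h ▸ hw))
  let A : Set T := {w | dist x w < dist x z + dist z w}
  have hA : IsOpen A := isOpen_lt (by fun_prop) (by fun_prop)
  let B : Set T := ⋃ w ∈ {w | dist x w = dist x z + dist z w}, Metric.ball w (dist w z)
  have hB : IsOpen B := isOpen_biUnion fun _ _ => Metric.isOpen_ball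
  have hBeq : ∀ v ∈ B, dist x v = dist x z + dist z v := by
    intro v hv
    simp only [B, mem_iUnion, mem_ofPred_eq, Metric.mem_ball] at hv
    obtain ⟨w, hw, hvw⟩ := hv
    have h4 := hT x v z w
    have h5 := dist_triangle x z v
    have h6 := dist_comm v w
    have h7 := dist_comm z w
    have h8 := dist_comm z v
    have h9 := dist_nonneg (x := v) (y := z)
    rcases le_max_iff.1 h4 with h | h <;> linarith
  have hxA : x ∈ A := by
    have := hne x hx
    simp only [A, mem_ofPred_eq, dist_self, dist_comm z x]
    linarith
  have hyB : y ∈ B := by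
    simp only [B, mem_iUnion]
    exact ⟨y, hz.symm, Metric.mem_ball_self (hne y hy)⟩
  obtain ⟨v, -, hvA, hvB⟩ := hS A B hA hB
    (fun w hw => by
      by_cases h : dist x w = dist x z + dist z w
      · right
        simp only [B, mem_iUnion]
        exact ⟨w, h, Metric.mem_ball_self (hne w hw)⟩
      · left
        exact lt_of_le_of_ne (dist_triangle _ _ _) h)
    ⟨x, hx, hxA⟩ ⟨y, hy, hyB⟩
  exact absurd (hBeq v hvB) (ne_of_lt hvA)

theorem FourPoint.range_eq_between (hT : FourPoint T) (hb : HasBetween T)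
    {p : unitInterval → T} (hp : Continuous p) (hi : Function.Injective p) :
    range p = {z | dist (p 0) z + dist z (p 1) = dist (p 0) (p 1)} := by
  apply Subset.antisymm
  · rintro _ ⟨c, rfl⟩
    set x := p 0
    set y := p 1
    set w := p c with hw
    have t1 := dist_triangle x w y
    have t2 := dist_triangle w x y
    have t3 := dist_triangle x y w
    have e1 := dist_comm w x
    have e2 := dist_comm w y
    obtain ⟨z, hz1, hz2⟩ := hb x y ((dist x y + dist x w - dist w y) / 2)
      ⟨by linarith, by linarith⟩
    have h4 := hT w x y z
    have e3 := dist_comm z x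
    have e4 := dist_comm z w
    have t4 := dist_triangle x z w
    have t5 := dist_triangle w z y
    have hwz : dist w z = (dist x w + dist w y - dist x y) / 2 := by
      rcases le_max_iff.1 h4 with h | h <;> linarith
    have hxw : dist x z + dist z w = dist x w := by linarith
    have hwy : dist w z + dist z y = dist w y := by linarith
    obtain ⟨a, ha, haz⟩ := hT.mem_image_of_between hxw
      (isPreconnected_Icc.image p hp.continuousOn : IsPreconnected (p '' Icc 0 c))
      ⟨0, ⟨le_rfl, c.2.1⟩, rfl⟩ ⟨c, ⟨c.2.1, le_rfl⟩, rfl⟩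
    obtain ⟨b, hb', hbz⟩ := hT.mem_image_of_between hwy
      (isPreconnected_Icc.image p hp.continuousOn : IsPreconnected (p '' Icc c 1))
      ⟨c, ⟨le_rfl, c.2.2⟩, rfl⟩ ⟨1, ⟨c.2.2, le_rfl⟩, rfl⟩
    have hab : a = b := hi (haz.trans hbz.symm)
    have hac : a = c := le_antisymm ha.2 (hab ▸ hb'.1)
    have : w = z := by rw [hw, ← hac, haz]
    simp only [mem_ofPred_eq, this]
    linarith
  · intro z hz
    exact hT.mem_image_of_between hz (isPreconnected_range hp) ⟨0, rfl⟩ ⟨1, rfl⟩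

theorem FourPoint.dist_eq_of_between (hT : FourPoint T) {x y z z' : T} {a a' : ℝ}
    (h1 : dist x z = a) (h2 : dist z y = dist x y - a)
    (h1' : dist x z' = a') (h2' : dist z' y = dist x y - a') : dist z z' = |a - a'| := by
  have h4 := hT z x y z'
  have e1 := dist_comm z x
  have e2 := dist_comm z' x
  have e3 := dist_comm z' z
  have t1 := dist_triangle x z z'
  have t2 := dist_triangle x z' z
  apply le_antisymm
  · rcases le_max_iff.1 h4 with h | h
    · exact le_trans (by linarith) (le_abs_self _)
    · exact le_trans (by linarith) (neg_le_abs _)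
  · exact abs_le.2 ⟨by linarith, by linarith⟩

theorem FourPoint.exists_geodesic (hT : FourPoint T) (hb : HasBetween T) (x y : T) :
    ∃ γ : ℝ → T, γ 0 = x ∧ γ (dist x y) = y ∧
    ∀ s ∈ Icc (0:ℝ) (dist x y), ∀ t ∈ Icc (0:ℝ) (dist x y), dist (γ s) (γ t) = |s - t| := by
  have : ∀ a : ℝ, ∃ z, a ∈ Icc (0 : ℝ) (dist x y) →
      dist x z = a ∧ dist z y = dist x y - a := by
    intro a
    by_cases ha : a ∈ Icc (0 : ℝ) (dist x y)
    · obtain ⟨z, hz⟩ := hb x y a ha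
      exact ⟨z, fun _ => hz⟩
    · exact ⟨x, fun h => absurd h ha⟩
  choose γ hγ using this
  refine ⟨γ, ?_, ?_, fun s hs t ht => ?_⟩
  · exact (dist_eq_zero.1 (hγ 0 ⟨le_rfl, dist_nonneg⟩).1).symm
  · exact dist_eq_zero.1 (by rw [(hγ _ ⟨dist_nonneg, le_rfl⟩).2, sub_self])
  · exact hT.dist_eq_of_between (hγ s hs).1 (hγ s hs).2 (hγ t ht).1 (hγ t ht).2

theorem FourPoint.locallyPathConnectedSpace (hT : FourPoint T) (hb : HasBetween T) :
    LocallyPathConnectedSpace T := by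
  refine LocallyPathConnectedSpace.of_bases (fun x => Metric.nhds_basis_ball) ?_
  intro x r hr
  refine ⟨x, Metric.mem_ball_self hr, fun {y} hy => ?_⟩
  obtain ⟨γ, h0, h1, hd⟩ := hT.exists_geodesic hb x y
  have hc : ContinuousOn γ (Icc 0 (dist x y)) := by
    refine (LipschitzOnWith.of_dist_le_mul (K := 1) fun s hs t ht => ?_).continuousOn
    rw [hd s hs t ht, Real.dist_eq]
    simp
  have hmem : γ '' Icc 0 (dist x y) ⊆ Metric.ball x r := by
    rintro _ ⟨s, hs, rfl⟩
    have := hd s hs 0 ⟨le_rfl, dist_nonneg⟩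
    rw [h0, sub_zero, abs_of_nonneg hs.1] at this
    rw [Metric.mem_ball, this]
    rw [Metric.mem_ball, dist_comm] at hy
    exact hs.2.trans_lt hy
  have hconv : IsPathConnected (Icc (0:ℝ) (dist x y)) :=
    (convex_Icc _ _).isPathConnected ⟨0, le_rfl, dist_nonneg⟩
  have hpath := (hconv.image' hc).joinedIn x ⟨0, ⟨le_rfl, dist_nonneg⟩, h0⟩
    y ⟨dist x y, ⟨dist_nonneg, le_rfl⟩, h1⟩
  exact hpath.mono hmem

theorem FourPoint.isRTree [Nonempty T] (hT : FourPoint T) (hb : HasBetween T) : IsRTree T where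
  nonempty := inferInstance
  geodesic := hT.exists_geodesic hb
  uniquelyArcwise p q hp hq hpi hqi h0 h1 := by
    rw [hT.range_eq_between hb hp hpi, hT.range_eq_between hb hq hqi, h0, h1]
  locallyArcwise := hT.locallyPathConnectedSpace hb

end Hyperbolic

noncomputable section Contour

/-- The least value of `W` between `s` and `t`. -/
def valley (W : C(ℝ, ℝ)) (s t : ℝ) : ℝ := sInf (W '' uIcc s t)

theorem valley_comm (W : C(ℝ, ℝ)) (s t : ℝ) : valley W s t = valley W t s := by
  rw [valley, uIcc_comm, valley]

theorem exists_valley_eq (W : C(ℝ, ℝ)) (s t : ℝ) : ∃ r ∈ uIcc s t, W r = valley W s t := by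
  obtain ⟨r, hr, h⟩ := isCompact_uIcc.exists_sInf_image_eq (⟨s, left_mem_uIcc⟩ : (uIcc s t).Nonempty)
    W.continuous.continuousOn
  exact ⟨r, hr, h.symm⟩

theorem valley_le (W : C(ℝ, ℝ)) {s t r : ℝ} (hr : r ∈ uIcc s t) : valley W s t ≤ W r :=
  csInf_le (isCompact_uIcc.image W.continuous).bddBelow (mem_image_of_mem W hr)

theorem valley_eq_of_forall_le (W : C(ℝ, ℝ)) {s t r : ℝ} (hr : r ∈ uIcc s t)
    (h : ∀ r' ∈ uIcc s t, W r ≤ W r') : valley W s t = W r := by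
  obtain ⟨r', hr', he⟩ := exists_valley_eq W s t
  exact le_antisymm (valley_le W hr) (he ▸ h r' hr')

theorem valley_self (W : C(ℝ, ℝ)) (s : ℝ) : valley W s s = W s := by simp [valley]

theorem min_valley_le (W : C(ℝ, ℝ)) (r s t : ℝ) :
    min (valley W r s) (valley W s t) ≤ valley W r t := by
  obtain ⟨u, hu, he⟩ := exists_valley_eq W r t
  rw [← he]
  rcases uIcc_subset_uIcc_union_uIcc (b := s) hu with h | h
  · exact (min_le_left _ _).trans (valley_le W h)
  · exact (min_le_right _ _).trans (valley_le W h)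

/-- The parameter space `[0,1]` with the pseudometric of the real tree coded by `W`. -/
def ContourSpace (_W : C(ℝ, ℝ)) : Type := unitInterval

/-- The real distance underlying a point of the contour space. -/
def ContourSpace.val {W : C(ℝ, ℝ)} (s : ContourSpace W) : ℝ := Subtype.val s

instance (W : C(ℝ, ℝ)) : PseudoMetricSpace (ContourSpace W) where
  dist s t := W s.val + W t.val - 2 * valley W s.val t.val
  dist_self s := by rw [valley_self]; ring
  dist_comm s t := by rw [valley_comm]; ring
  dist_triangle r s t := by
    have h := min_valley_le W r.val s.val t.val
    have h1 := valley_le W (right_mem_uIcc : s.val ∈ uIcc r.val s.val)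
    have h2 := valley_le W (left_mem_uIcc : s.val ∈ uIcc s.val t.val)
    rcases min_le_iff.1 h with h | h <;> linarith

theorem ContourSpace.dist_def {W : C(ℝ, ℝ)} (s t : ContourSpace W) :
    dist s t = W s.val + W t.val - 2 * valley W s.val t.val := rfl

instance (W : C(ℝ, ℝ)) : Nonempty (ContourSpace W) := ⟨(0 : unitInterval)⟩

theorem ContourSpace.fourPoint (W : C(ℝ, ℝ)) : FourPoint (ContourSpace W) := by
  intro w x y z
  simp only [dist_def]
  generalize w.val = w
  generalize x.val = x
  generalize y.val = y
  generalize z.val = z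
  have key : min (valley W w x + valley W z y) (valley W w y + valley W z x) ≤
      valley W w z + valley W x y := by
    have a1 := min_valley_le W w x z
    have a2 := min_valley_le W w y z
    have a3 := min_valley_le W x w y
    have a4 := min_valley_le W x z y
    have a5 := min_valley_le W w z x
    have a6 := min_valley_le W w x y
    have a7 := min_valley_le W z y x
    have a8 := min_valley_le W z x y
    have a9 := min_valley_le W w z y
    have a10 := min_valley_le W w y x
    have a11 := min_valley_le W z w x
    have a12 := min_valley_le W z w y
    rw [valley_comm W x z] at *
    rw [valley_comm W y z] at *
    rw [valley_comm W x w] at *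
    rw [valley_comm W z w] at *
    rw [valley_comm W y x] at *
    grind
  rcases min_le_iff.1 key with h | h
  · exact le_max_of_le_left (by linarith)
  · exact le_max_of_le_right (by linarith)

theorem exists_first_level (W : C(ℝ, ℝ)) {s r h : ℝ} (h1 : W r ≤ h) (h2 : h ≤ W s) :
    ∃ u ∈ uIcc s r, W u = h ∧ ∀ v ∈ uIcc s u, h ≤ W v := by
  have hcl : IsCompact {u ∈ uIcc s r | W u = h} :=
    isCompact_uIcc.inter_right (isClosed_singleton.preimage W.continuous)
  have ivt : ∀ r', W r' ≤ h → ∃ u ∈ uIcc s r', W u = h := fun r' hr' =>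
    intermediate_value_uIcc (W.continuous.continuousOn (s := uIcc s r'))
      (by rw [uIcc_of_ge (hr'.trans h2)]; exact ⟨hr', h2⟩)
  obtain ⟨u0, hu0, hu0'⟩ := ivt r h1
  obtain ⟨u, ⟨hu, huh⟩, hmin⟩ := hcl.exists_isMinOn ⟨u0, hu0, hu0'⟩
    (f := fun u => |u - s|) (by fun_prop)
  refine ⟨u, hu, huh, fun v hv => ?_⟩
  by_contra! hlt
  obtain ⟨x, hx, hxh⟩ := ivt v hlt.le
  have hxu : |u - s| ≤ |x - s| :=
    hmin ⟨uIcc_subset_uIcc left_mem_uIcc hu (uIcc_subset_uIcc left_mem_uIcc hv hx), hxh⟩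
  have hxv : x = v := by
    rcases le_total s u with hs | hs
    · rw [uIcc_of_le hs] at hv
      rw [uIcc_of_le hv.1] at hx
      rw [abs_of_nonneg (by linarith), abs_of_nonneg (by linarith [hx.1])] at hxu
      linarith [hx.2, hv.2]
    · rw [uIcc_of_ge hs] at hv
      rw [uIcc_of_ge hv.2] at hx
      rw [abs_of_nonpos (by linarith), abs_of_nonpos (by linarith [hx.2])] at hxu
      linarith [hx.1, hv.1]
  rw [← hxv, hxh] at hlt
  exact lt_irrefl _ hlt

theorem ContourSpace.exists_between_of_le {W : C(ℝ, ℝ)} (s t : ContourSpace W) {a : ℝ}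
    (h0 : 0 ≤ a) (ha : a ≤ W s.val - valley W s.val t.val) :
    ∃ u, dist s u = a ∧ dist u t = dist s t - a := by
  obtain ⟨r, hr, hrv⟩ := exists_valley_eq W s.val t.val
  obtain ⟨u, hu, huh, hle⟩ := exists_first_level W (s := s.val) (r := r) (h := W s.val - a)
    (by linarith) (by linarith)
  have hust : u ∈ uIcc s.val t.val := uIcc_subset_uIcc left_mem_uIcc hr hu
  have hmem : u ∈ unitInterval := by
    have h1 : uIcc s.val t.val ⊆ Icc 0 1 := uIcc_subset_Icc s.2 t.2
    exact h1 hust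
  have hrut : r ∈ uIcc u t.val := by
    rcases le_total s.val t.val with h | h
    · rw [uIcc_of_le h] at hr hust
      rw [uIcc_of_le hr.1] at hu
      exact uIcc_of_le hust.2 ▸ ⟨hu.2, hr.2⟩
    · rw [uIcc_of_ge h] at hr hust
      rw [uIcc_of_ge hr.2] at hu
      exact uIcc_of_ge hust.1 ▸ ⟨hr.1, hu.1⟩
  have e1 : valley W s.val u = W u :=
    valley_eq_of_forall_le W right_mem_uIcc (fun v hv => huh ▸ hle v hv)
  have e2 : valley W u t.val = valley W s.val t.val := by
    rw [← hrv]
    exact valley_eq_of_forall_le W hrut fun v hv =>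
      hrv ▸ valley_le W (uIcc_subset_uIcc hust right_mem_uIcc hv)
  refine ⟨(⟨u, hmem⟩ : unitInterval), ?_, ?_⟩
  · change W s.val + W u - 2 * valley W s.val u = a
    rw [e1, huh]; ring
  · change W u + W t.val - 2 * valley W u t.val = W s.val + W t.val - 2 * valley W s.val t.val - a
    rw [e2, huh]; ring

theorem ContourSpace.hasBetween (W : C(ℝ, ℝ)) : HasBetween (ContourSpace W) := by
  rintro s t a ⟨h0, h1⟩
  rcases le_total a (W s.val - valley W s.val t.val) with h | h
  · exact exists_between_of_le s t h0 h
  · have hd := dist_def s t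
    obtain ⟨u, hu1, hu2⟩ := exists_between_of_le t s (a := dist s t - a) (by linarith)
      (by rw [valley_comm]; linarith)
    refine ⟨u, ?_, ?_⟩
    · rw [dist_comm, hu2, dist_comm t s]; ring
    · rw [dist_comm, hu1]

/-- The identification of `[0,1]` with the contour space. -/
def ContourSpace.mk (W : C(ℝ, ℝ)) (s : unitInterval) : ContourSpace W := s

theorem ContourSpace.continuous_mk (W : C(ℝ, ℝ)) : Continuous (ContourSpace.mk W) := by
  rw [continuous_iff_continuousAt]
  intro s
  rw [ContinuousAt, Metric.tendsto_nhds]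
  intro ε hε
  obtain ⟨δ, hδ, h⟩ := Metric.continuousAt_iff.1 (W.continuous.continuousAt (x := (s : ℝ)))
    (ε / 3) (by positivity)
  filter_upwards [Metric.ball_mem_nhds s hδ] with t ht
  change W (t : ℝ) + W (s : ℝ) - 2 * valley W t s < ε
  obtain ⟨r, hr, hrv⟩ := exists_valley_eq W t s
  have hrs : dist r (s : ℝ) < δ := by
    rw [Real.dist_eq, abs_sub_comm]
    exact (abs_sub_right_of_mem_uIcc hr).trans_lt (by rw [abs_sub_comm]; exact ht)
  have h1 := abs_lt.1 (h (show dist (t : ℝ) s < δ from ht))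
  have h2 := abs_lt.1 (h hrs)
  rw [← hrv]
  linarith [h1.1, h1.2, h2.1, h2.2]

/-- The real tree coded by `W`. -/
abbrev ContourTree (W : C(ℝ, ℝ)) : Type := SeparationQuotient (ContourSpace W)

theorem ContourTree.isRTree (W : C(ℝ, ℝ)) : IsRTree (ContourTree W) := by
  refine FourPoint.isRTree ?_ ?_
  · intro w x y z
    obtain ⟨w, rfl⟩ := SeparationQuotient.surjective_mk w
    obtain ⟨x, rfl⟩ := SeparationQuotient.surjective_mk x
    obtain ⟨y, rfl⟩ := SeparationQuotient.surjective_mk y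
    obtain ⟨z, rfl⟩ := SeparationQuotient.surjective_mk z
    simp only [SeparationQuotient.dist_mk]
    exact ContourSpace.fourPoint W _ _ _ _
  · intro x y a
    obtain ⟨x, rfl⟩ := SeparationQuotient.surjective_mk x
    obtain ⟨y, rfl⟩ := SeparationQuotient.surjective_mk y
    rw [SeparationQuotient.dist_mk]
    intro ha
    obtain ⟨z, hz⟩ := ContourSpace.hasBetween W x y a ha
    exact ⟨SeparationQuotient.mk z, hz⟩

/-- A map on `[0,1]` that identifies the points identified by the contour function `W` factors
through the real tree coded by `W`. -/
theorem exists_isRTree_factor (W : C(ℝ, ℝ)) {X : Type*} [TopologicalSpace X]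
    {q : unitInterval → X} (hq : Continuous q)
    (hrel : ∀ s t : unitInterval, s ≤ t → W s = W t →
      (∀ r ∈ Icc (s : ℝ) t, W s ≤ W r) → q s = q t)
    (h01 : W 0 = W 1) (hmin : ∀ r ∈ Icc (0 : ℝ) 1, W 0 ≤ W r) :
    ∃ (T : Type) (_ : MetricSpace T), IsRTree T ∧
    ∃ (f : T → X) (ℓ : unitInterval → T),
      Continuous f ∧ Continuous ℓ ∧ ℓ 0 = ℓ 1 ∧ f ∘ ℓ = q := by
  let ℓ : unitInterval → ContourTree W := fun s =>
    SeparationQuotient.mk (ContourSpace.mk W s)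
  have hℓ : Continuous ℓ :=
    SeparationQuotient.continuous_mk.comp (ContourSpace.continuous_mk W)
  have hsurj : Function.Surjective ℓ := fun x =>
    SeparationQuotient.surjective_mk (X := ContourSpace W) x
  have hquot : IsQuotientMap ℓ := hℓ.isClosedMap.isQuotientMap hℓ hsurj
  have heq : ∀ s t : unitInterval, ℓ s = ℓ t → q s = q t := by
    have main : ∀ s t : unitInterval, s ≤ t → ℓ s = ℓ t → q s = q t := by
      intro s t hst h
      have hd : W (s : ℝ) + W (t : ℝ) - 2 * valley W s t = 0 := by
        have h0 : dist (ℓ s) (ℓ t) = 0 := by rw [h, dist_self]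
        exact h0
      have h1 := valley_le W (left_mem_uIcc : (s : ℝ) ∈ uIcc (s : ℝ) t)
      have h2 := valley_le W (right_mem_uIcc : (t : ℝ) ∈ uIcc (s : ℝ) t)
      refine hrel s t hst (by linarith) fun r hr => ?_
      have h3 := valley_le W (Icc_subset_uIcc hr)
      linarith
    intro s t h
    rcases le_total s t with hst | hst
    · exact main s t hst h
    · exact (main t s hst h.symm).symm
  refine ⟨ContourTree W, inferInstance, ContourTree.isRTree W,
    fun x => q (Function.surjInv hsurj x), ℓ, ?_, hℓ, ?_, ?_⟩
  · refine hquot.continuous_iff.2 (hq.congr fun s => ?_)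
    exact (heq _ _ (Function.surjInv_eq hsurj (ℓ s))).symm
  · refine dist_eq_zero.1 ?_
    change W 0 + W 1 - 2 * valley W 0 1 = 0
    rw [valley_eq_of_forall_le W left_mem_uIcc (by rwa [uIcc_of_le zero_le_one]), ← h01]
    ring
  · funext s
    exact heq _ _ (Function.surjInv_eq hsurj (ℓ s))

end Contour

section Peano

open Complex ComplexConjugate BoundedContinuousFunction

/-- `γ` is a plane curve from `0` to `1`, constant outside `[0,1]`, invariant under reflection in
the line `re = 1/2`, and `1`-Lipschitz for the tree metric coded by the height function `U`, with
the main branch of the tree carried isometrically to the segment `[0,1]`. -/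
structure IsCoded (γ : ℝ → ℂ) (U : ℝ → ℝ) : Prop where
  curve_left : ∀ t ≤ 0, γ t = 0
  curve_right : ∀ t, 1 ≤ t → γ t = 1
  height_left : ∀ t ≤ 0, U t = 0
  height_right : ∀ t, 1 ≤ t → U t = 1
  nonneg : ∀ t, 0 ≤ U t
  le_one : ∀ t, U t ≤ 1
  symm : ∀ t, γ (1 - t) = 1 - conj (γ t)
  branch : ∀ s c, (∀ r, s ≤ r → c ≤ U r) → ‖γ s - c‖ ≤ U s - c
  lip : ∀ s t c, s ≤ t → (∀ r ∈ Icc s t, c ≤ U r) → ‖γ s - γ t‖ ≤ U s + U t - 2 * c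

/-- Replace a curve in a right isosceles triangle by four half-size copies of it. -/
noncomputable def refineCurve (γ : ℝ → ℂ) (t : ℝ) : ℂ :=
  (1 / 2) * γ (4 * t) + (I / 2) * γ (4 * t - 1) - (I / 2) * γ (4 * t - 2)
    + (1 / 2) * γ (4 * t - 3)

/-- The height function of the refined curve. -/
noncomputable def refineHeight (U : ℝ → ℝ) (t : ℝ) : ℝ :=
  (1 / 2) * U (4 * t) + (1 / 2) * U (4 * t - 1) + (1 / 2) * (U (3 - 4 * t) - 1)
    + (1 / 2) * U (4 * t - 3)

section Pieces

variable {γ : ℝ → ℂ} {U : ℝ → ℝ} {t : ℝ}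

theorem refineCurve_first (h0 : ∀ t ≤ 0, γ t = 0) (ht : t ≤ 1 / 4) :
    refineCurve γ t = (1 / 2) * γ (4 * t) := by
  rw [refineCurve, h0 (4 * t - 1) (by linarith), h0 (4 * t - 2) (by linarith),
    h0 (4 * t - 3) (by linarith)]
  ring

theorem refineCurve_second (h0 : ∀ t ≤ 0, γ t = 0) (h1 : ∀ t, 1 ≤ t → γ t = 1)
    (ht : 1 / 4 ≤ t) (ht' : t ≤ 1 / 2) :
    refineCurve γ t = 1 / 2 + (I / 2) * γ (4 * t - 1) := by
  rw [refineCurve, h1 (4 * t) (by linarith), h0 (4 * t - 2) (by linarith),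
    h0 (4 * t - 3) (by linarith)]
  ring

theorem refineCurve_third (h0 : ∀ t ≤ 0, γ t = 0) (h1 : ∀ t, 1 ≤ t → γ t = 1)
    (ht : 1 / 2 ≤ t) (ht' : t ≤ 3 / 4) :
    refineCurve γ t = 1 / 2 + (I / 2) * (1 - γ (4 * t - 2)) := by
  rw [refineCurve, h1 (4 * t) (by linarith), h1 (4 * t - 1) (by linarith),
    h0 (4 * t - 3) (by linarith)]
  ring

theorem refineCurve_fourth (h1 : ∀ t, 1 ≤ t → γ t = 1) (ht : 3 / 4 ≤ t) :
    refineCurve γ t = 1 / 2 + (1 / 2) * γ (4 * t - 3) := by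
  rw [refineCurve, h1 (4 * t) (by linarith), h1 (4 * t - 1) (by linarith),
    h1 (4 * t - 2) (by linarith)]
  ring

theorem refineHeight_first (h0 : ∀ t ≤ 0, U t = 0) (h1 : ∀ t, 1 ≤ t → U t = 1)
    (ht : t ≤ 1 / 4) : refineHeight U t = (1 / 2) * U (4 * t) := by
  rw [refineHeight, h0 (4 * t - 1) (by linarith), h1 (3 - 4 * t) (by linarith),
    h0 (4 * t - 3) (by linarith)]
  ring

theorem refineHeight_second (h0 : ∀ t ≤ 0, U t = 0) (h1 : ∀ t, 1 ≤ t → U t = 1)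
    (ht : 1 / 4 ≤ t) (ht' : t ≤ 1 / 2) :
    refineHeight U t = 1 / 2 + (1 / 2) * U (4 * t - 1) := by
  rw [refineHeight, h1 (4 * t) (by linarith), h1 (3 - 4 * t) (by linarith),
    h0 (4 * t - 3) (by linarith)]
  ring

theorem refineHeight_third (h0 : ∀ t ≤ 0, U t = 0) (h1 : ∀ t, 1 ≤ t → U t = 1)
    (ht : 1 / 2 ≤ t) (ht' : t ≤ 3 / 4) :
    refineHeight U t = 1 / 2 + (1 / 2) * U (3 - 4 * t) := by
  rw [refineHeight, h1 (4 * t) (by linarith), h1 (4 * t - 1) (by linarith),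
    h0 (4 * t - 3) (by linarith)]
  ring

theorem refineHeight_fourth (h0 : ∀ t ≤ 0, U t = 0) (h1 : ∀ t, 1 ≤ t → U t = 1)
    (ht : 3 / 4 ≤ t) : refineHeight U t = 1 / 2 + (1 / 2) * U (4 * t - 3) := by
  rw [refineHeight, h1 (4 * t) (by linarith), h1 (4 * t - 1) (by linarith),
    h0 (3 - 4 * t) (by linarith)]
  ring

end Pieces

namespace IsCoded

variable {γ : ℝ → ℂ} {U : ℝ → ℝ}

theorem refineCurve_third (h : IsCoded γ U) {t : ℝ} (ht : 1 / 2 ≤ t) (ht' : t ≤ 3 / 4) :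
    refineCurve γ t = 1 / 2 + (I / 2) * conj (γ (3 - 4 * t)) := by
  rw [_root_.refineCurve_third h.curve_left h.curve_right ht ht']
  have := h.symm (4 * t - 2)
  rw [show 1 - (4 * t - 2) = 3 - 4 * t by ring] at this
  rw [this]
  simp

theorem norm_le (h : IsCoded γ U) (t : ℝ) : ‖γ t‖ ≤ U t := by
  simpa using h.branch t 0 (fun r _ => h.nonneg r)

theorem refineHeight_quarter (h : IsCoded γ U) : refineHeight U (1 / 4) = 1 / 2 := by
  rw [refineHeight_first h.height_left h.height_right le_rfl, h.height_right _ (by norm_num)]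
  ring

theorem refineHeight_half (h : IsCoded γ U) : refineHeight U (1 / 2) = 1 := by
  rw [refineHeight_second h.height_left h.height_right (by norm_num) le_rfl,
    h.height_right _ (by norm_num)]
  ring

theorem refineHeight_three_quarters (h : IsCoded γ U) : refineHeight U (3 / 4) = 1 / 2 := by
  rw [refineHeight_fourth h.height_left h.height_right le_rfl, h.height_left _ (by norm_num)]
  ring

theorem refineCurve_quarter (h : IsCoded γ U) : refineCurve γ (1 / 4) = 1 / 2 := by
  rw [refineCurve_first h.curve_left le_rfl, h.curve_right _ (by norm_num)]
  ring

theorem norm_refineCurve_sub_half_le (h : IsCoded γ U) {t : ℝ} (ht : 1 / 4 ≤ t) :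
    ‖refineCurve γ t - 1 / 2‖ ≤ refineHeight U t - 1 / 2 := by
  rcases le_total t (1 / 2) with h1 | h1
  · rw [refineCurve_second h.curve_left h.curve_right ht h1,
      refineHeight_second h.height_left h.height_right ht h1]
    simp only [add_sub_cancel_left, norm_mul, norm_div, norm_I, RCLike.norm_ofNat]
    linarith [h.norm_le (4 * t - 1)]
  rcases le_total t (3 / 4) with h2 | h2
  · rw [h.refineCurve_third h1 h2, refineHeight_third h.height_left h.height_right h1 h2]
    simp only [add_sub_cancel_left, norm_mul, norm_div, norm_I, RCLike.norm_ofNat,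
      RCLike.norm_conj]
    linarith [h.norm_le (3 - 4 * t)]
  · rw [refineCurve_fourth h.curve_right h2,
      refineHeight_fourth h.height_left h.height_right h2]
    simp only [add_sub_cancel_left, norm_mul, norm_div, norm_one, RCLike.norm_ofNat]
    linarith [h.norm_le (4 * t - 3)]

theorem half_le_refineHeight (h : IsCoded γ U) {t : ℝ} (ht : 1 / 4 ≤ t) :
    1 / 2 ≤ refineHeight U t := by
  linarith [h.norm_refineCurve_sub_half_le ht, norm_nonneg (refineCurve γ t - 1 / 2)]

theorem refine_branch (h : IsCoded γ U) (s c : ℝ) (hc : ∀ r, s ≤ r → c ≤ refineHeight U r) :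
    ‖refineCurve γ s - c‖ ≤ refineHeight U s - c := by
  have far : 1 / 4 ≤ s → c ≤ 1 / 2 → ‖refineCurve γ s - c‖ ≤ refineHeight U s - c := by
    intro hs hc'
    have h1 : refineCurve γ s - c = (refineCurve γ s - 1 / 2) + ((1 / 2 - c : ℝ) : ℂ) := by
      push_cast; ring
    have h2 := norm_add_le (refineCurve γ s - 1 / 2) ((1 / 2 - c : ℝ) : ℂ)
    rw [← h1, Complex.norm_of_nonneg (by linarith)] at h2
    linarith [h.norm_refineCurve_sub_half_le hs]
  rcases le_total s (1 / 4) with h1 | h1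
  · have hb := h.branch (4 * s) (2 * c) fun r hr => by
      rcases le_total r 1 with hr1 | hr1
      · have := hc (r / 4) (by linarith)
        rw [refineHeight_first h.height_left h.height_right (by linarith)] at this
        rw [show 4 * (r / 4) = r by ring] at this
        linarith
      · have := hc (1 / 4) h1
        rw [h.refineHeight_quarter] at this
        rw [h.height_right r hr1]
        linarith
    rw [refineCurve_first h.curve_left h1, refineHeight_first h.height_left h.height_right h1]
    have e : (1 / 2) * γ (4 * s) - c = (1 / 2) * (γ (4 * s) - ((2 * c : ℝ) : ℂ)) := by
      push_cast; ring
    rw [e, norm_mul]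
    norm_num at hb ⊢
    linarith
  rcases le_total s (3 / 4) with h2 | h2
  · exact far h1 (h.refineHeight_three_quarters ▸ hc _ h2)
  · have hb := h.branch (4 * s - 3) (2 * c - 1) fun r hr => by
      have := hc ((r + 3) / 4) (by linarith)
      rcases le_total 0 r with hr1 | hr1
      · rw [refineHeight_fourth h.height_left h.height_right (by linarith)] at this
        rw [show 4 * ((r + 3) / 4) - 3 = r by ring] at this
        linarith
      · have := hc (3 / 4) (by linarith)
        rw [h.refineHeight_three_quarters] at this
        linarith [h.nonneg r]
    rw [refineCurve_fourth h.curve_right h2,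
      refineHeight_fourth h.height_left h.height_right h2]
    have e : 1 / 2 + (1 / 2) * γ (4 * s - 3) - c
        = (1 / 2) * (γ (4 * s - 3) - ((2 * c - 1 : ℝ) : ℂ)) := by
      push_cast; ring
    rw [e, norm_mul]
    norm_num at hb ⊢
    linarith

theorem refine_lip_first (h : IsCoded γ U) {s t c : ℝ} (hst : s ≤ t) (ht : t ≤ 1 / 4)
    (hc : ∀ r ∈ Icc s t, c ≤ refineHeight U r) :
    ‖refineCurve γ s - refineCurve γ t‖ ≤ refineHeight U s + refineHeight U t - 2 * c := by
  have hl := h.lip (4 * s) (4 * t) (2 * c) (by linarith) fun r hr => by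
    have := hc (r / 4) ⟨by linarith [hr.1], by linarith [hr.2]⟩
    rw [refineHeight_first h.height_left h.height_right (by linarith [hr.2]),
      show 4 * (r / 4) = r by ring] at this
    linarith
  rw [refineCurve_first h.curve_left ht, refineCurve_first h.curve_left (hst.trans ht),
    refineHeight_first h.height_left h.height_right ht,
    refineHeight_first h.height_left h.height_right (hst.trans ht), ← mul_sub, norm_mul]
  norm_num at hl ⊢
  linarith

theorem refine_lip_second (h : IsCoded γ U) {s t c : ℝ} (hs : 1 / 4 ≤ s) (hst : s ≤ t)
    (ht : t ≤ 1 / 2) (hc : ∀ r ∈ Icc s t, c ≤ refineHeight U r) :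
    ‖refineCurve γ s - refineCurve γ t‖ ≤ refineHeight U s + refineHeight U t - 2 * c := by
  have hl := h.lip (4 * s - 1) (4 * t - 1) (2 * c - 1) (by linarith) fun r hr => by
    have := hc ((r + 1) / 4) ⟨by linarith [hr.1], by linarith [hr.2]⟩
    rw [refineHeight_second h.height_left h.height_right (by linarith [hr.1])
      (by linarith [hr.2]), show 4 * ((r + 1) / 4) - 1 = r by ring] at this
    linarith
  rw [refineCurve_second h.curve_left h.curve_right (hs.trans hst) ht,
    refineCurve_second h.curve_left h.curve_right hs (hst.trans ht),
    refineHeight_second h.height_left h.height_right (hs.trans hst) ht,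
    refineHeight_second h.height_left h.height_right hs (hst.trans ht),
    add_sub_add_left_eq_sub, ← mul_sub, norm_mul]
  norm_num at hl ⊢
  linarith

theorem refine_lip_third (h : IsCoded γ U) {s t c : ℝ} (hs : 1 / 2 ≤ s) (hst : s ≤ t)
    (ht : t ≤ 3 / 4) (hc : ∀ r ∈ Icc s t, c ≤ refineHeight U r) :
    ‖refineCurve γ s - refineCurve γ t‖ ≤ refineHeight U s + refineHeight U t - 2 * c := by
  have hl := h.lip (3 - 4 * t) (3 - 4 * s) (2 * c - 1) (by linarith) fun r hr => by
    have := hc ((3 - r) / 4) ⟨by linarith [hr.2], by linarith [hr.1]⟩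
    rw [refineHeight_third h.height_left h.height_right (by linarith [hr.2])
      (by linarith [hr.1]), show 3 - 4 * ((3 - r) / 4) = r by ring] at this
    linarith
  rw [h.refineCurve_third (hs.trans hst) ht, h.refineCurve_third hs (hst.trans ht),
    refineHeight_third h.height_left h.height_right (hs.trans hst) ht,
    refineHeight_third h.height_left h.height_right hs (hst.trans ht),
    add_sub_add_left_eq_sub, ← mul_sub, ← map_sub, norm_mul, RCLike.norm_conj, norm_sub_rev]
  norm_num at hl ⊢
  linarith

theorem refine_lip_fourth (h : IsCoded γ U) {s t c : ℝ} (hs : 3 / 4 ≤ s) (hst : s ≤ t)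
    (hc : ∀ r ∈ Icc s t, c ≤ refineHeight U r) :
    ‖refineCurve γ s - refineCurve γ t‖ ≤ refineHeight U s + refineHeight U t - 2 * c := by
  have hl := h.lip (4 * s - 3) (4 * t - 3) (2 * c - 1) (by linarith) fun r hr => by
    have := hc ((r + 3) / 4) ⟨by linarith [hr.1], by linarith [hr.2]⟩
    rw [refineHeight_fourth h.height_left h.height_right (by linarith [hr.1]),
      show 4 * ((r + 3) / 4) - 3 = r by ring] at this
    linarith
  rw [refineCurve_fourth h.curve_right (hs.trans hst), refineCurve_fourth h.curve_right hs,
    refineHeight_fourth h.height_left h.height_right (hs.trans hst),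
    refineHeight_fourth h.height_left h.height_right hs,
    add_sub_add_left_eq_sub, ← mul_sub, norm_mul]
  norm_num at hl ⊢
  linarith

theorem refine_lip_second_third (h : IsCoded γ U) {s t c : ℝ} (hs : 1 / 4 ≤ s)
    (hs' : s ≤ 1 / 2) (ht : 1 / 2 ≤ t) (ht' : t ≤ 3 / 4)
    (hc : ∀ r ∈ Icc s t, c ≤ refineHeight U r) :
    ‖refineCurve γ s - refineCurve γ t‖ ≤ refineHeight U s + refineHeight U t - 2 * c := by
  have hc1 : c ≤ 1 := h.refineHeight_half ▸ hc (1 / 2) ⟨hs', ht⟩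
  have b1 := h.branch (4 * s - 1) (2 * c - 1) fun r hr => by
    rcases le_total r 1 with hr1 | hr1
    · have := hc ((r + 1) / 4) ⟨by linarith, by linarith⟩
      rw [refineHeight_second h.height_left h.height_right (by linarith) (by linarith),
        show 4 * ((r + 1) / 4) - 1 = r by ring] at this
      linarith
    · rw [h.height_right r hr1]
      linarith
  have b2 := h.branch (3 - 4 * t) (2 * c - 1) fun r hr => by
    rcases le_total r 1 with hr1 | hr1
    · have := hc ((3 - r) / 4) ⟨by linarith, by linarith⟩
      rw [refineHeight_third h.height_left h.height_right (by linarith) (by linarith),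
        show 3 - 4 * ((3 - r) / 4) = r by ring] at this
      linarith
    · rw [h.height_right r hr1]
      linarith
  rw [refineCurve_second h.curve_left h.curve_right hs hs', h.refineCurve_third ht ht',
    refineHeight_second h.height_left h.height_right hs hs',
    refineHeight_third h.height_left h.height_right ht ht',
    add_sub_add_left_eq_sub, ← mul_sub, norm_mul]
  rw [← RCLike.norm_conj, map_sub, conj_ofReal] at b2
  have e := norm_sub_le (γ (4 * s - 1) - ((2 * c - 1 : ℝ) : ℂ))
    (conj (γ (3 - 4 * t)) - ((2 * c - 1 : ℝ) : ℂ))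
  rw [sub_sub_sub_cancel_right] at e
  rw [norm_div, norm_I, RCLike.norm_ofNat]
  linarith

theorem refine_lip (h : IsCoded γ U) (s t c : ℝ) (hst : s ≤ t)
    (hc : ∀ r ∈ Icc s t, c ≤ refineHeight U r) :
    ‖refineCurve γ s - refineCurve γ t‖ ≤ refineHeight U s + refineHeight U t - 2 * c := by
  rcases le_total t (1 / 4) with ht | ht
  · exact h.refine_lip_first hst ht hc
  have b2 := h.norm_refineCurve_sub_half_le ht
  rw [norm_sub_rev] at b2
  have tri := norm_sub_le_norm_sub_add_norm_sub (refineCurve γ s) (1 / 2) (refineCurve γ t)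
  rcases le_total s (1 / 4) with hs | hs
  · have b1 := h.refine_lip_first hs le_rfl fun r hr => hc r ⟨hr.1, hr.2.trans ht⟩
    rw [h.refineCurve_quarter, h.refineHeight_quarter] at b1
    linarith
  have b1 := h.norm_refineCurve_sub_half_le hs
  rcases le_total (3 / 4) s with hs3 | hs3
  · exact h.refine_lip_fourth hs3 hst hc
  rcases le_total (3 / 4) t with ht3 | ht3
  · have := hc (3 / 4) ⟨hs3, ht3⟩
    rw [h.refineHeight_three_quarters] at this
    linarith
  rcases le_total t (1 / 2) with ht2 | ht2
  · exact h.refine_lip_second hs hst ht2 hc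
  rcases le_total (1 / 2) s with hs2 | hs2
  · exact h.refine_lip_third hs2 hst ht3 hc
  · exact h.refine_lip_second_third hs hs2 ht2 ht3 hc

theorem refine (h : IsCoded γ U) : IsCoded (refineCurve γ) (refineHeight U) where
  curve_left t ht := by
    rw [refineCurve_first h.curve_left (by linarith), h.curve_left _ (by linarith), mul_zero]
  curve_right t ht := by
    rw [refineCurve_fourth h.curve_right (by linarith), h.curve_right _ (by linarith)]
    norm_num
  height_left t ht := by
    rw [refineHeight_first h.height_left h.height_right (by linarith),
      h.height_left _ (by linarith), mul_zero]
  height_right t ht := by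
    rw [refineHeight_fourth h.height_left h.height_right (by linarith),
      h.height_right _ (by linarith)]
    norm_num
  nonneg t := by
    rcases le_total t (1 / 4) with ht | ht
    · rw [refineHeight_first h.height_left h.height_right ht]
      linarith [h.nonneg (4 * t)]
    · linarith [h.half_le_refineHeight ht]
  le_one t := by
    rcases le_total t (1 / 4) with h1 | h1
    · rw [refineHeight_first h.height_left h.height_right h1]
      linarith [h.le_one (4 * t)]
    rcases le_total t (1 / 2) with h2 | h2
    · rw [refineHeight_second h.height_left h.height_right h1 h2]
      linarith [h.le_one (4 * t - 1)]
    rcases le_total t (3 / 4) with h3 | h3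
    · rw [refineHeight_third h.height_left h.height_right h2 h3]
      linarith [h.le_one (3 - 4 * t)]
    · rw [refineHeight_fourth h.height_left h.height_right h3]
      linarith [h.le_one (4 * t - 3)]
  symm t := by
    have e1 := h.symm (4 * t)
    have e2 := h.symm (4 * t - 1)
    have e3 := h.symm (4 * t - 2)
    have e4 := h.symm (4 * t - 3)
    rw [refineCurve, refineCurve, show 4 * (1 - t) = 1 - (4 * t - 3) by ring, e4,
      show 1 - (4 * t - 3) - 1 = 1 - (4 * t - 2) by ring, e3,
      show 1 - (4 * t - 3) - 2 = 1 - (4 * t - 1) by ring, e2,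
      show 1 - (4 * t - 3) - 3 = 1 - 4 * t by ring, e1]
    simp only [map_add, map_sub, map_mul, map_div₀, map_one, conj_I, map_ofNat]
    ring
  branch := h.refine_branch
  lip := h.refine_lip

end IsCoded

end Peano

section FixedPoint

open Complex ComplexConjugate BoundedContinuousFunction

theorem exists_norm_refineCurve_sub {γ γ' : ℝ → ℂ} (h0 : ∀ t ≤ 0, γ t = 0)
    (h1 : ∀ t, 1 ≤ t → γ t = 1) (h0' : ∀ t ≤ 0, γ' t = 0) (h1' : ∀ t, 1 ≤ t → γ' t = 1)
    (t : ℝ) : ∃ s, ‖refineCurve γ t - refineCurve γ' t‖ = (1 / 2) * ‖γ s - γ' s‖ := by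
  rcases le_total t (1 / 4) with ht | ht
  · refine ⟨4 * t, ?_⟩
    rw [refineCurve_first h0 ht, refineCurve_first h0' ht, ← mul_sub, norm_mul]
    norm_num
  rcases le_total t (1 / 2) with ht' | ht'
  · refine ⟨4 * t - 1, ?_⟩
    rw [refineCurve_second h0 h1 ht ht', refineCurve_second h0' h1' ht ht',
      add_sub_add_left_eq_sub, ← mul_sub, norm_mul]
    norm_num
  rcases le_total t (3 / 4) with ht'' | ht''
  · refine ⟨4 * t - 2, ?_⟩
    rw [refineCurve_third h0 h1 ht' ht'', refineCurve_third h0' h1' ht' ht'',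
      add_sub_add_left_eq_sub, ← mul_sub, norm_mul, sub_sub_sub_cancel_left, norm_sub_rev]
    norm_num
  · refine ⟨4 * t - 3, ?_⟩
    rw [refineCurve_fourth h1 ht'', refineCurve_fourth h1' ht'',
      add_sub_add_left_eq_sub, ← mul_sub, norm_mul]
    norm_num

theorem exists_abs_refineHeight_sub {U U' : ℝ → ℝ} (h0 : ∀ t ≤ 0, U t = 0)
    (h1 : ∀ t, 1 ≤ t → U t = 1) (h0' : ∀ t ≤ 0, U' t = 0) (h1' : ∀ t, 1 ≤ t → U' t = 1)
    (t : ℝ) : ∃ s, |refineHeight U t - refineHeight U' t| = (1 / 2) * |U s - U' s| := by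
  rcases le_total t (1 / 4) with ht | ht
  · refine ⟨4 * t, ?_⟩
    rw [refineHeight_first h0 h1 ht, refineHeight_first h0' h1' ht, ← mul_sub, abs_mul]
    norm_num
  rcases le_total t (1 / 2) with ht' | ht'
  · refine ⟨4 * t - 1, ?_⟩
    rw [refineHeight_second h0 h1 ht ht', refineHeight_second h0' h1' ht ht',
      add_sub_add_left_eq_sub, ← mul_sub, abs_mul]
    norm_num
  rcases le_total t (3 / 4) with ht'' | ht''
  · refine ⟨3 - 4 * t, ?_⟩
    rw [refineHeight_third h0 h1 ht' ht'', refineHeight_third h0' h1' ht' ht'',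
      add_sub_add_left_eq_sub, ← mul_sub, abs_mul]
    norm_num
  · refine ⟨4 * t - 3, ?_⟩
    rw [refineHeight_fourth h0 h1 ht'', refineHeight_fourth h0' h1' ht'',
      add_sub_add_left_eq_sub, ← mul_sub, abs_mul]
    norm_num

theorem norm_refineCurve_le {γ : ℝ → ℂ} {M : ℝ} (hM : ∀ t, ‖γ t‖ ≤ M) (t : ℝ) :
    ‖refineCurve γ t‖ ≤ 2 * M := by
  refine (norm_add_le _ _).trans ?_
  refine (add_le_add_left ((norm_sub_le _ _).trans
    (add_le_add_left (norm_add_le _ _) _)) _).trans ?_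
  simp only [norm_mul, norm_div, norm_I, norm_one, RCLike.norm_ofNat]
  linarith [hM (4 * t), hM (4 * t - 1), hM (4 * t - 2), hM (4 * t - 3)]

theorem norm_refineHeight_le {U : ℝ → ℝ} {M : ℝ} (hM : ∀ t, ‖U t‖ ≤ M) (t : ℝ) :
    ‖refineHeight U t‖ ≤ 2 * M + 1 / 2 := by
  have h1 := abs_le.1 (hM (4 * t))
  have h2 := abs_le.1 (hM (4 * t - 1))
  have h3 := abs_le.1 (hM (3 - 4 * t))
  have h4 := abs_le.1 (hM (4 * t - 3))
  rw [Real.norm_eq_abs, refineHeight, abs_le]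
  constructor <;> linarith [h1.1, h1.2, h2.1, h2.2, h3.1, h3.2, h4.1, h4.2]

theorem Continuous.refineCurve {γ : ℝ → ℂ} (hγ : Continuous γ) : Continuous (refineCurve γ) := by
  unfold _root_.refineCurve
  fun_prop

theorem Continuous.refineHeight {U : ℝ → ℝ} (hU : Continuous U) :
    Continuous (refineHeight U) := by
  unfold _root_.refineHeight
  fun_prop

/-- `refineCurve` and `refineHeight` as a self-map of a Banach space. -/
noncomputable def refineMap (p : (ℝ →ᵇ ℂ) × (ℝ →ᵇ ℝ)) : (ℝ →ᵇ ℂ) × (ℝ →ᵇ ℝ) :=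
  (.ofNormedAddCommGroup (refineCurve p.1) p.1.continuous.refineCurve _
      (norm_refineCurve_le p.1.norm_coe_le_norm),
    .ofNormedAddCommGroup (refineHeight p.2) p.2.continuous.refineHeight _
      (norm_refineHeight_le p.2.norm_coe_le_norm))

theorem dist_refineMap_le {p q : (ℝ →ᵇ ℂ) × (ℝ →ᵇ ℝ)} (hp : IsCoded p.1 p.2)
    (hq : IsCoded q.1 q.2) : dist (refineMap p) (refineMap q) ≤ (1 / 2) * dist p q := by
  refine max_le ((dist_le (by positivity)).2 fun t => ?_)
    ((dist_le (by positivity)).2 fun t => ?_)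
  · obtain ⟨s, hs⟩ := exists_norm_refineCurve_sub hp.curve_left hp.curve_right
      hq.curve_left hq.curve_right t
    rw [dist_eq_norm]
    refine hs.le.trans ?_
    rw [← dist_eq_norm]
    have : dist (p.1 s) (q.1 s) ≤ dist p q := (dist_coe_le_dist s).trans (le_max_left _ _)
    linarith
  · obtain ⟨s, hs⟩ := exists_abs_refineHeight_sub hp.height_left hp.height_right
      hq.height_left hq.height_right t
    rw [Real.dist_eq]
    refine hs.le.trans ?_
    rw [← Real.dist_eq]
    have : dist (p.2 s) (q.2 s) ≤ dist p q := (dist_coe_le_dist s).trans (le_max_right _ _)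
    linarith

theorem isCoded_clamp :
    IsCoded (fun t => ((max 0 (min t 1) : ℝ) : ℂ)) (fun t => max 0 (min t 1)) where
  curve_left t ht := by simp [ht]
  curve_right t ht := by simp [ht]
  height_left t ht := by simp [ht]
  height_right t ht := by simp [ht]
  nonneg t := le_max_left _ _
  le_one t := max_le zero_le_one (min_le_right _ _)
  symm t := by
    rw [conj_ofReal, ← ofReal_one, ← ofReal_sub, ofReal_inj]
    rcases le_total t 0 with h | h
    · rw [min_eq_right (by linarith), min_eq_left (by linarith), max_eq_left h,
        max_eq_right zero_le_one]
      ring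
    rcases le_total t 1 with h' | h'
    · rw [min_eq_left (by linarith), min_eq_left h', max_eq_right h, max_eq_right (by linarith)]
    · rw [min_eq_left (by linarith), min_eq_right h', max_eq_left (by linarith),
        max_eq_right zero_le_one]
      ring
  branch s c hc := by
    rw [← ofReal_sub, Complex.norm_of_nonneg (sub_nonneg.2 (hc s le_rfl))]
  lip s t c hst hc := by
    have h1 := hc s (left_mem_Icc.2 hst)
    have h2 := hc t (right_mem_Icc.2 hst)
    rw [← ofReal_sub, norm_real, Real.norm_eq_abs, abs_le]
    constructor <;> linarith

theorem isClosed_isCoded : IsClosed {p : (ℝ →ᵇ ℂ) × (ℝ →ᵇ ℝ) | IsCoded p.1 p.2} := by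
  refine isClosed_of_closure_subset fun p hp => ?_
  have near : ∀ ε > 0, ∃ q : (ℝ →ᵇ ℂ) × (ℝ →ᵇ ℝ), IsCoded q.1 q.2 ∧
      (∀ t, dist (p.1 t) (q.1 t) ≤ ε) ∧ ∀ t, |p.2 t - q.2 t| ≤ ε := by
    intro ε hε
    obtain ⟨q, hq, hd⟩ := Metric.mem_closure_iff.1 hp ε hε
    exact ⟨q, hq, fun t => (dist_coe_le_dist t).trans ((le_max_left _ _).trans hd.le),
      fun t => (dist_coe_le_dist t).trans ((le_max_right _ _).trans hd.le)⟩
  have c1 : ∀ t, Continuous fun q : (ℝ →ᵇ ℂ) × (ℝ →ᵇ ℝ) => q.1 t := fun t => by fun_prop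
  have c2 : ∀ t, Continuous fun q : (ℝ →ᵇ ℂ) × (ℝ →ᵇ ℝ) => q.2 t := fun t => by fun_prop
  refine ⟨fun t ht => ?_, fun t ht => ?_, fun t ht => ?_, fun t ht => ?_, fun t => ?_, fun t => ?_,
    fun t => ?_, fun s c hc => ?_, fun s t c hst hc => ?_⟩
  · exact closure_minimal (fun q hq => IsCoded.curve_left hq t ht)
      (isClosed_eq (c1 t) continuous_const) hp
  · exact closure_minimal (fun q hq => IsCoded.curve_right hq t ht)
      (isClosed_eq (c1 t) continuous_const) hp
  · exact closure_minimal (fun q hq => IsCoded.height_left hq t ht)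
      (isClosed_eq (c2 t) continuous_const) hp
  · exact closure_minimal (fun q hq => IsCoded.height_right hq t ht)
      (isClosed_eq (c2 t) continuous_const) hp
  · exact closure_minimal (fun q hq => IsCoded.nonneg hq t)
      (isClosed_le continuous_const (c2 t)) hp
  · exact closure_minimal (fun q hq => IsCoded.le_one hq t)
      (isClosed_le (c2 t) continuous_const) hp
  · exact closure_minimal (fun q hq => IsCoded.symm hq t)
      (isClosed_eq (c1 _) (continuous_const.sub (continuous_conj.comp (c1 t)))) hp
  · refine le_of_forall_pos_le_add fun ε hε => ?_
    obtain ⟨q, hq, h1, h2⟩ := near (ε / 4) (by linarith)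
    have hb := hq.branch s (c - ε / 4) fun r hr => by
      linarith [hc r hr, (abs_le.1 (h2 r)).2]
    have e : p.1 s - c = (p.1 s - q.1 s) + ((q.1 s - ((c - ε / 4 : ℝ) : ℂ))
        + ((-(ε / 4) : ℝ) : ℂ)) := by push_cast; ring
    have n1 := norm_add_le (p.1 s - q.1 s) ((q.1 s - ((c - ε / 4 : ℝ) : ℂ))
        + ((-(ε / 4) : ℝ) : ℂ))
    have n2 := norm_add_le (q.1 s - ((c - ε / 4 : ℝ) : ℂ)) ((-(ε / 4) : ℝ) : ℂ)
    rw [← e, ← dist_eq_norm (p.1 s) (q.1 s)] at n1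
    rw [norm_real, norm_neg, Real.norm_of_nonneg (by linarith : 0 ≤ ε / 4)] at n2
    linarith [h1 s, (abs_le.1 (h2 s)).1]
  · refine le_of_forall_pos_le_add fun ε hε => ?_
    obtain ⟨q, hq, h1, h2⟩ := near (ε / 6) (by linarith)
    have hl := hq.lip s t (c - ε / 6) hst fun r hr => by
      linarith [hc r hr, (abs_le.1 (h2 r)).2]
    have n := dist_triangle4 (p.1 s) (q.1 s) (q.1 t) (p.1 t)
    rw [dist_comm (q.1 t), dist_eq_norm (q.1 s), dist_eq_norm (p.1 s) (p.1 t)] at n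
    linarith [h1 s, h1 t, (abs_le.1 (h2 s)).1, (abs_le.1 (h2 t)).1]

theorem exists_isCoded_refineCurve_eq : ∃ (γ : ℝ → ℂ) (U : ℝ → ℝ), Continuous γ ∧ Continuous U ∧
    IsCoded γ U ∧ refineCurve γ = γ := by
  have hmaps : MapsTo refineMap {p | IsCoded p.1 p.2} {p | IsCoded p.1 p.2} :=
    fun p hp => IsCoded.refine hp
  have hcontr : ContractingWith (1 / 2) (hmaps.restrict refineMap _ _) := by
    refine ⟨by rw [← NNReal.coe_lt_coe]; norm_num, LipschitzWith.of_dist_le_mul fun p q => ?_⟩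
    simpa using! dist_refineMap_le p.2 q.2
  let x : (ℝ →ᵇ ℂ) × (ℝ →ᵇ ℝ) :=
    (.ofNormedAddCommGroup (fun t => ((max 0 (min t 1) : ℝ) : ℂ)) (by fun_prop) 1
      fun t => isCoded_clamp.norm_le t |>.trans (isCoded_clamp.le_one t),
     .ofNormedAddCommGroup (fun t => max 0 (min t 1)) (by fun_prop) 1 fun t => by
      rw [Real.norm_of_nonneg (isCoded_clamp.nonneg t)]
      exact isCoded_clamp.le_one t)
  obtain ⟨y, hy, hfix, -⟩ := ContractingWith.exists_fixedPoint' (x := x)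
    isClosed_isCoded.isComplete hmaps hcontr isCoded_clamp (edist_ne_top _ _)
  exact ⟨y.1, y.2, y.1.continuous, y.2.continuous, hy,
    congrArg (fun p : (ℝ →ᵇ ℂ) × (ℝ →ᵇ ℝ) => (p.1 : ℝ → ℂ)) hfix⟩

theorem eq_of_refineCurve_eq {γ γ' : ℝ → ℂ} (h0 : ∀ t ≤ 0, γ t = 0)
    (h1 : ∀ t, 1 ≤ t → γ t = 1) (h0' : ∀ t ≤ 0, γ' t = 0) (h1' : ∀ t, 1 ≤ t → γ' t = 1)
    (h : refineCurve γ = γ) (h' : refineCurve γ' = γ') {M : ℝ} (hM : ∀ t, ‖γ t - γ' t‖ ≤ M) :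
    γ = γ' := by
  have key : ∀ n : ℕ, ∀ t, ‖γ t - γ' t‖ ≤ (1 / 2) ^ n * M := by
    intro n
    induction n with
    | zero => simpa using hM
    | succ n ih =>
      intro t
      obtain ⟨s, hs⟩ := exists_norm_refineCurve_sub h0 h1 h0' h1' t
      rw [h, h'] at hs
      rw [hs, pow_succ']
      linarith [ih s]
  funext t
  have hlim : Tendsto (fun n : ℕ => (1 / 2 : ℝ) ^ n * M) atTop (𝓝 0) := by
    simpa using (tendsto_pow_atTop_nhds_zero_of_lt_one (by norm_num : (0 : ℝ) ≤ 1 / 2)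
      (by norm_num)).mul_const M
  exact sub_eq_zero.1 (norm_le_zero_iff.1 (ge_of_tendsto' hlim fun n => key n t))

/-- The two half-size copies, joined at the apex of the triangle. -/
noncomputable def halve (γ : ℝ → ℂ) (t : ℝ) : ℂ :=
  (1 + I) / 2 * conj (γ (2 * t)) + (1 - I) / 2 * conj (γ (2 * t - 1))

theorem halve_halve (γ : ℝ → ℂ) : halve (halve γ) = refineCurve γ := by
  funext t
  simp only [halve, refineCurve, map_add, map_mul, map_div₀, map_sub, conj_I, map_one, conj_conj,
    map_ofNat]
  rw [show 2 * (2 * t) = 4 * t by ring, show 2 * (2 * t - 1) = 4 * t - 2 by ring,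
    show 4 * t - 2 - 1 = 4 * t - 3 by ring]
  linear_combination (-(1 / 4) * γ (4 * t) + (1 / 4) * γ (4 * t - 1) + (1 / 4) * γ (4 * t - 2)
    - (1 / 4) * γ (4 * t - 3)) * I_sq

theorem halve_eq {γ : ℝ → ℂ} {U : ℝ → ℝ} (h : IsCoded γ U) (hγ : refineCurve γ = γ) :
    halve γ = γ := by
  have hle : ∀ t, ‖γ t‖ ≤ 1 := fun t => (h.norm_le t).trans (h.le_one t)
  have n1 : ‖(1 + I) / 2‖ ≤ 1 := by
    rw [norm_div]
    have := norm_add_le 1 I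
    norm_num at this ⊢
    linarith
  have n2 : ‖(1 - I) / 2‖ ≤ 1 := by
    rw [norm_div]
    have := norm_sub_le 1 I
    norm_num at this ⊢
    linarith
  refine eq_of_refineCurve_eq (M := 3) (fun t ht => ?_) (fun t ht => ?_) h.curve_left h.curve_right
    ?_ hγ fun t => ?_
  · simp [halve, h.curve_left (2 * t) (by linarith), h.curve_left (2 * t - 1) (by linarith)]
  · rw [halve, h.curve_right (2 * t) (by linarith), h.curve_right (2 * t - 1) (by linarith)]
    simp only [map_one]
    ring
  · rw [← halve_halve, halve_halve γ, hγ]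
  · refine (norm_sub_le _ _).trans ?_
    have n3 := norm_add_le ((1 + I) / 2 * conj (γ (2 * t))) ((1 - I) / 2 * conj (γ (2 * t - 1)))
    rw [norm_mul, norm_mul, RCLike.norm_conj, RCLike.norm_conj] at n3
    have n4 := mul_le_one₀ n1 (norm_nonneg _) (hle (2 * t))
    have n5 := mul_le_one₀ n2 (norm_nonneg _) (hle (2 * t - 1))
    rw [halve]
    linarith [hle t]

end FixedPoint

section CommonPath

open Complex ComplexConjugate

/-- `V` codes a dendrite through which the path `g` factors, and whose main branch is the path
`a`. -/
structure CodesPath {X : Type*} (V : ℝ → ℝ) (a g : ℝ → X) : Prop where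
  left : ∀ t ≤ 0, V t = 0
  right : ∀ t, 1 ≤ t → V t = 1
  nonneg : ∀ t, 0 ≤ V t
  le_one : ∀ t, V t ≤ 1
  factor : ∀ s t, s ≤ t → V s = V t → (∀ r ∈ Icc s t, V s ≤ V r) → g s = g t
  branch : ∀ s, (∀ r, s ≤ r → V s ≤ V r) → g s = a (V s)

theorem CodesPath.comp {X Y : Type*} {V : ℝ → ℝ} {a g : ℝ → X} (h : CodesPath V a g)
    (F : X → Y) : CodesPath V (F ∘ a) (F ∘ g) where
  left := h.left
  right := h.right
  nonneg := h.nonneg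
  le_one := h.le_one
  factor s t hst hV hr := congrArg F (h.factor s t hst hV hr)
  branch s hr := congrArg F (h.branch s hr)

/-- The point at height `v` on the two legs of the right isosceles triangle over `[0,1]`. -/
noncomputable def leg (v : ℝ) : ℂ := v + (min v (1 - v) : ℝ) * I

namespace IsCoded

variable {γ : ℝ → ℂ} {U : ℝ → ℝ}

theorem codesPath (h : IsCoded γ U) : CodesPath U (fun v => (v : ℂ)) γ where
  left := h.height_left
  right := h.height_right
  nonneg := h.nonneg
  le_one := h.le_one
  factor s t hst hU hr := by
    have := h.lip s t (U s) hst hr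
    exact sub_eq_zero.1 (norm_le_zero_iff.1 (by linarith))
  branch s hr := by
    have := h.branch s (U s) hr
    exact sub_eq_zero.1 (norm_le_zero_iff.1 (by linarith))

theorem codesPath_leg (h : IsCoded γ U) (hγ : halve γ = γ) :
    CodesPath (fun t => (U (2 * t) + U (2 * t - 1)) / 2) leg γ := by
  have lowU : ∀ t ≤ 1 / 2, U (2 * t - 1) = 0 := fun t ht => h.height_left _ (by linarith)
  have highU : ∀ t, 1 / 2 ≤ t → U (2 * t) = 1 := fun t ht => h.height_right _ (by linarith)
  have low : ∀ t, t ≤ 1 / 2 → γ t = (1 + I) / 2 * conj (γ (2 * t)) := fun t ht => by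
    rw [← congrFun hγ t, halve, h.curve_left (2 * t - 1) (by linarith)]
    simp
  have high : ∀ t, 1 / 2 ≤ t →
      γ t = (1 + I) / 2 + (1 - I) / 2 * conj (γ (2 * t - 1)) := fun t ht => by
    rw [← congrFun hγ t, halve, h.curve_right (2 * t) (by linarith)]
    simp
  refine ⟨fun t ht => ?_, fun t ht => ?_, fun t => ?_, fun t => ?_, fun s t hst hV hr => ?_,
    fun s hr => ?_⟩
  · rw [h.height_left _ (by linarith), h.height_left _ (by linarith)]
    norm_num
  · rw [h.height_right _ (by linarith), h.height_right _ (by linarith)]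
    norm_num
  · linarith [h.nonneg (2 * t), h.nonneg (2 * t - 1)]
  · linarith [h.le_one (2 * t), h.le_one (2 * t - 1)]
  · rcases le_total t (1 / 2) with ht | ht
    · have hs : s ≤ 1 / 2 := hst.trans ht
      rw [low s hs, low t ht, h.codesPath.factor (2 * s) (2 * t) (by linarith) ?_ fun r hr' => ?_]
      · rw [lowU s hs, lowU t ht] at hV
        linarith
      · have := hr (r / 2) ⟨by linarith [hr'.1], by linarith [hr'.2]⟩
        rw [lowU s hs, lowU (r / 2) (by linarith [hr'.2]), mul_div_cancel₀ r two_ne_zero] at this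
        linarith
    rcases le_total (1 / 2) s with hs | hs
    · rw [high s hs, high t ht,
        h.codesPath.factor (2 * s - 1) (2 * t - 1) (by linarith) ?_ fun r hr' => ?_]
      · rw [highU s hs, highU t ht] at hV
        linarith
      · have := hr ((r + 1) / 2) ⟨by linarith [hr'.1], by linarith [hr'.2]⟩
        rw [highU s hs, highU ((r + 1) / 2) (by linarith [hr'.1]),
          mul_div_cancel₀ (r + 1) two_ne_zero, add_sub_cancel_right] at this
        linarith
    · rw [lowU s hs, highU t ht] at hV
      have h1 : U (2 * s) = 1 := by linarith [h.le_one (2 * s), h.nonneg (2 * t - 1)]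
      have h2 : U (2 * t - 1) = 0 := by linarith
      have h3 : γ (2 * t - 1) = 0 := norm_le_zero_iff.1 (h2 ▸ h.norm_le (2 * t - 1))
      have h4 : γ (2 * s) = 1 := by
        rw [← h.curve_right 1 le_rfl]
        have hmin : ∀ r ∈ Icc (2 * s) 1, 1 ≤ U r := fun r hr' => by
          have := hr (r / 2) ⟨by linarith [hr'.1], by linarith [hr'.2]⟩
          rw [lowU s hs, lowU (r / 2) (by linarith [hr'.2]),
            mul_div_cancel₀ r two_ne_zero] at this
          linarith
        refine h.codesPath.factor _ _ (by linarith) (h1.trans (h.height_right 1 le_rfl).symm) ?_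
        rwa [h1]
      rw [low s hs, high t ht, h3, h4]
      simp
  · rcases le_total s (1 / 2) with hs | hs
    · have hb := h.codesPath.branch (2 * s) fun r hr' => by
        rcases le_total r 1 with hr1 | hr1
        · have := hr (r / 2) (by linarith)
          rw [lowU s hs, lowU (r / 2) (by linarith), mul_div_cancel₀ r two_ne_zero] at this
          linarith
        · rw [h.height_right r hr1]
          exact h.le_one _
      have h1 := h.le_one (2 * s)
      rw [low s hs, hb, leg, lowU s hs, min_eq_left (by linarith), conj_ofReal]
      push_cast
      ring
    · have hb := h.codesPath.branch (2 * s - 1) fun r hr' => by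
        have := hr ((r + 1) / 2) (by linarith)
        rw [highU s hs, highU ((r + 1) / 2) (by linarith),
          mul_div_cancel₀ (r + 1) two_ne_zero, add_sub_cancel_right] at this
        linarith
      have h1 := h.nonneg (2 * s - 1)
      rw [high s hs, hb, leg, highU s hs, min_eq_right (by linarith), conj_ofReal]
      push_cast
      ring

end IsCoded

theorem CodesPath.rTreeHomotopic {X : Type*} [TopologicalSpace X] {V : ℝ → ℝ} {a g : ℝ → X}
    (h : CodesPath V a g) (hV : Continuous V) (ha : Continuous a) (hg : Continuous g) :
    RTreeHomotopic (fun t : unitInterval => a t) (fun t : unitInterval => g t) := by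
  have g0 : g 0 = a 0 := by
    have := h.branch 0 fun r _ => (h.left 0 le_rfl).symm ▸ h.nonneg r
    rwa [h.left 0 le_rfl] at this
  have g1 : g 1 = a 1 := by
    have := h.branch 1 fun r hr => ((h.right 1 le_rfl).trans (h.right r hr).symm).le
    rwa [h.right 1 le_rfl] at this
  have hW : Continuous fun t : ℝ => min (2 * t) 1 * V (2 - 2 * t) := by fun_prop
  have low : ∀ t ≤ 1 / 2, min (2 * t) 1 * V (2 - 2 * t) = 2 * t := fun t ht => by
    rw [h.right _ (by linarith), min_eq_left (by linarith), mul_one]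
  have high : ∀ t, 1 / 2 ≤ t → min (2 * t) 1 * V (2 - 2 * t) = V (2 - 2 * t) := fun t ht => by
    rw [min_eq_right (by linarith), one_mul]
  have qlow : ∀ t : unitInterval, (t : ℝ) ≤ 1 / 2 →
      ConcatReverse (fun t : unitInterval => a t) (fun t : unitInterval => g t) t
        = a (2 * t) := fun t ht => by
    rw [ConcatReverse, if_pos ht, projIcc_of_mem zero_le_one ⟨by linarith [t.2.1], by linarith⟩]
  have qhigh : ∀ t : unitInterval, 1 / 2 ≤ (t : ℝ) →
      ConcatReverse (fun t : unitInterval => a t) (fun t : unitInterval => g t) t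
        = g (2 - 2 * t) := fun t ht => by
    rcases ht.eq_or_lt with ht' | ht'
    · rw [qlow t ht'.symm.le, ← ht']
      norm_num
      exact g1.symm
    · rw [ConcatReverse, if_neg ht'.not_ge,
        projIcc_of_mem zero_le_one ⟨by linarith [t.2.2], by linarith⟩]
  refine ⟨by simpa using g0.symm, by simpa using g1.symm,
    exists_isRTree_factor ⟨_, hW⟩ (q := ConcatReverse _ _) ?_ ?_ ?_ ?_⟩
  · refine Continuous.if_le (by fun_prop) (by fun_prop) (by fun_prop) continuous_const ?_
    intro t ht
    rw [ht]
    norm_num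
    simpa using g1.symm
  · intro s t hst hVst hr
    simp only [ContinuousMap.coe_mk] at hVst hr
    have hst' : (s : ℝ) ≤ t := hst
    rcases le_total (t : ℝ) (1 / 2) with ht | ht
    · rw [low t ht, low s (hst'.trans ht)] at hVst
      rw [Subtype.ext (by linarith : (s : ℝ) = t)]
    rw [high t ht] at hVst
    rcases le_total (1 / 2) (s : ℝ) with hs | hs
    · rw [high s hs] at hVst
      rw [qhigh s hs, qhigh t ht, h.factor (2 - 2 * t) (2 - 2 * s) (by linarith) hVst.symm]
      intro r hr'
      have := hr ((2 - r) / 2) ⟨by linarith [hr'.2], by linarith [hr'.1]⟩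
      rw [high s hs, high _ (by linarith [hr'.2]), mul_div_cancel₀ _ two_ne_zero,
        sub_sub_cancel] at this
      exact hVst.ge.trans this
    · rw [low s hs] at hVst
      rw [qlow s hs, qhigh t ht, hVst]
      refine (h.branch _ fun r hr' => ?_).symm
      rcases le_total r 1 with hr1 | hr1
      · have := hr ((2 - r) / 2) ⟨by linarith, by linarith⟩
        rw [low s hs, high _ (by linarith), mul_div_cancel₀ _ two_ne_zero,
          sub_sub_cancel] at this
        exact hVst.ge.trans this
      · rw [h.right r hr1]
        exact h.le_one _
  · simp only [ContinuousMap.coe_mk]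
    rw [h.left (2 - 2 * 1) (by norm_num)]
    simp
  · intro r hr
    simp only [ContinuousMap.coe_mk, mul_zero, min_eq_left zero_le_one, zero_mul]
    exact mul_nonneg (le_min (by linarith [hr.1]) zero_le_one) (h.nonneg _)

theorem exists_extend_two_paths {X : Type*} [TopologicalSpace X] [TietzeExtension.{0} X]
    {α β : unitInterval → X} (hα : Continuous α) (hβ : Continuous β) (h0 : α 0 = β 0)
    (h1 : α 1 = β 1) : ∃ F : C(ℂ, X), (∀ v : unitInterval, F ((v : ℝ) : ℂ) = α v) ∧
      ∀ v : unitInterval, F (leg v) = β v := by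
  let K₁ : Set ℂ := {z | z.im = 0 ∧ 0 ≤ z.re ∧ z.re ≤ 1}
  let K₂ : Set ℂ := {z | z.im = min z.re (1 - z.re) ∧ 0 ≤ z.re ∧ z.re ≤ 1}
  have hK₁ : IsClosed K₁ := (isClosed_eq continuous_im continuous_const).inter
    ((isClosed_le continuous_const continuous_re).inter
      (isClosed_le continuous_re continuous_const))
  have hK₂ : IsClosed K₂ := (isClosed_eq continuous_im
    (continuous_re.min (continuous_const.sub continuous_re))).inter
    ((isClosed_le continuous_const continuous_re).inter
      (isClosed_le continuous_re continuous_const))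
  let f : ℂ → X := fun z => if z.im = 0 then α (projIcc 0 1 zero_le_one z.re)
    else β (projIcc 0 1 zero_le_one z.re)
  have f1 : ∀ z ∈ K₁, f z = α (projIcc 0 1 zero_le_one z.re) := fun z hz => if_pos hz.1
  have f2 : ∀ z ∈ K₂, f z = β (projIcc 0 1 zero_le_one z.re) := fun z hz => by
    by_cases h : z.im = 0
    · rw [show f z = _ from if_pos h]
      have hz' := hz.1
      rw [h] at hz'
      rcases min_choice z.re (1 - z.re) with hm | hm
      · rw [hm] at hz'
        rw [← hz', projIcc_left]
        exact h0
      · rw [hm] at hz'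
        rw [show z.re = 1 by linarith, projIcc_right]
        exact h1
    · exact if_neg h
  have hf : ContinuousOn f (K₁ ∪ K₂) := by
    refine ContinuousOn.union_of_isClosed (ContinuousOn.congr ?_ f1) (ContinuousOn.congr ?_ f2)
      hK₁ hK₂
    · exact (hα.comp (continuous_projIcc.comp continuous_re)).continuousOn
    · exact (hβ.comp (continuous_projIcc.comp continuous_re)).continuousOn
  obtain ⟨F, hF⟩ := ContinuousMap.exists_restrict_eq (hK₁.union hK₂)
    ⟨(K₁ ∪ K₂).domRestrict f, hf.domRestrict⟩
  have hF' : ∀ z ∈ K₁ ∪ K₂, F z = f z := fun z hz =>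
    congrArg (fun φ : C(↥(K₁ ∪ K₂), X) => φ ⟨z, hz⟩) hF
  refine ⟨F, fun v => ?_, fun v => ?_⟩
  · have hv : ((v : ℝ) : ℂ) ∈ K₁ := ⟨ofReal_im _, by rw [ofReal_re]; exact v.2⟩
    rw [hF' _ (.inl hv), f1 _ hv, ofReal_re, projIcc_val]
  · have hre : (leg v).re = v := by simp [leg]
    have him : (leg v).im = min (v : ℝ) (1 - v) := by simp [leg]
    have hv : leg v ∈ K₂ := ⟨by rw [him, hre], by rw [hre]; exact v.2⟩
    rw [hF' _ (.inr hv), f2 _ hv, hre, projIcc_val]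

/-- In a space with the Tietze extension property, any two paths with common endpoints are
ℝ-tree homotopic to a common path. -/
theorem exists_common_rTreeHomotopic {X : Type*} [TopologicalSpace X] [TietzeExtension.{0} X]
    {α β : unitInterval → X} (hα : Continuous α) (hβ : Continuous β) (h0 : α 0 = β 0)
    (h1 : α 1 = β 1) :
    ∃ γ : unitInterval → X, Continuous γ ∧ RTreeHomotopic α γ ∧ RTreeHomotopic β γ := by
  obtain ⟨γ, U, hγ, hU, hc, hfix⟩ := exists_isCoded_refineCurve_eq
  obtain ⟨F, hF, hF'⟩ := exists_extend_two_paths hα hβ h0 h1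
  have hleg : Continuous leg := by
    unfold leg
    fun_prop
  refine ⟨fun t => F (γ t), by fun_prop, ?_, ?_⟩
  · rw [show α = fun t : unitInterval => F ((t : ℝ) : ℂ) from funext fun v => (hF v).symm]
    exact (hc.codesPath.comp F).rTreeHomotopic hU (F.continuous.comp continuous_ofReal)
      (F.continuous.comp hγ)
  · rw [show β = fun t : unitInterval => F (leg t) from funext fun v => (hF' v).symm]
    exact ((hc.codesPath_leg (halve_eq hc hfix)).comp F).rTreeHomotopic (by fun_prop)
      (F.continuous.comp hleg) (F.continuous.comp hγ)

end CommonPath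

/-- Staggered Cantor paths in the closed unit disk with common endpoints are both ℝ-tree
homotopic to a single common path. -/
theorem staggered_cantor_paths_common (α β : unitInterval → Disk2)
    (hα : IsCantorPath α) (hβ : IsCantorPath β) (hstag : StaggeredPaths α β)
    (h0 : α 0 = β 0) (h1 : α 1 = β 1) :
    ∃ γ : unitInterval → Disk2, Continuous γ ∧
      RTreeHomotopic α γ ∧ RTreeHomotopic β γ := by
  have : TietzeExtension.{0} Disk2 := Metric.instTietzeExtensionClosedBall ℝ _ one_pos
  exact exists_common_rTreeHomotopic hα.1 hβ.1 h0 h1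
end

section
/- Let X be a Hausdorff topological space. The equivalence relation on the set of paths in X generated by the relation ≥ᵣ (geodesic ℝ-tree reduction) coincides with path-homotopy: two paths α, β : [0,1] → X are related by the equivalence relation generated by ≥ᵣ if and only if they are homotopic relative to endpoints. -/
open Set Filter Topology

/-- `γ` restricted to `[0, dist x y]` is a unit-speed geodesic from `x` to `y`. -/
structure IsGeodesic {T : Type} [MetricSpace T] (γ : ℝ → T) (x y : T) : Prop where
  continuous : Continuous γ
  map_zero : γ 0 = x
  map_dist : γ (dist x y) = y
  dist_eq : ∀ s ∈ Icc (0 : ℝ) (dist x y), ∀ t ∈ Icc (0 : ℝ) (dist x y), dist (γ s) (γ t) = |s - t|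

namespace IsGeodesic

variable {T : Type} [MetricSpace T] {γ : ℝ → T} {x y : T}

/-- An isometric embedding of `[0, dist x y]` extends to a continuous map on the real line. -/
theorem exists_of_isometry
    (h : ∃ γ : ℝ → T, γ 0 = x ∧ γ (dist x y) = y ∧
      ∀ s ∈ Icc (0 : ℝ) (dist x y), ∀ t ∈ Icc (0 : ℝ) (dist x y), dist (γ s) (γ t) = |s - t|) :
    ∃ γ, IsGeodesic γ x y := by
  obtain ⟨γ, h0, h1, h⟩ := h
  have hp : ∀ s ∈ Icc (0 : ℝ) (dist x y), (projIcc 0 (dist x y) dist_nonneg s : ℝ) = s :=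
    fun s hs => by rw [projIcc_of_mem _ hs]
  have hl : (0 : ℝ) ∈ Icc (0 : ℝ) (dist x y) := ⟨le_rfl, dist_nonneg⟩
  have hr : dist x y ∈ Icc (0 : ℝ) (dist x y) := ⟨dist_nonneg, le_rfl⟩
  refine ⟨fun s => γ (projIcc 0 (dist x y) dist_nonneg s), ?_, ?_, ?_, ?_⟩
  · have : Isometry (fun s : Icc (0 : ℝ) (dist x y) => γ s) :=
      Isometry.of_dist_eq fun s t => by
        rw [h _ s.2 _ t.2, Subtype.dist_eq, Real.dist_eq]
    exact this.continuous.comp continuous_projIcc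
  · simp only [hp _ hl, h0]
  · simp only [hp _ hr, h1]
  · intro s hs t ht
    simp only [hp _ hs, hp _ ht, h s hs t ht]

theorem dist_left (h : IsGeodesic γ x y) {s : ℝ} (hs : s ∈ Icc (0 : ℝ) (dist x y)) :
    dist x (γ s) = s := by
  have := h.dist_eq 0 ⟨le_rfl, dist_nonneg⟩ s hs
  rwa [h.map_zero, zero_sub, abs_neg, abs_of_nonneg hs.1] at this

theorem dist_right (h : IsGeodesic γ x y) {s : ℝ} (hs : s ∈ Icc (0 : ℝ) (dist x y)) :
    dist (γ s) y = dist x y - s := by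
  have := h.dist_eq s hs _ ⟨dist_nonneg, le_rfl⟩
  rwa [h.map_dist, abs_sub_comm, abs_of_nonneg (sub_nonneg.2 hs.2)] at this

theorem injOn (h : IsGeodesic γ x y) : InjOn γ (Icc 0 (dist x y)) := fun s hs t ht hst => by
  have := h.dist_eq s hs t ht
  rw [hst, dist_self] at this
  linarith [abs_eq_zero.1 this.symm]

end IsGeodesic

namespace IsRTree

variable {T : Type} [MetricSpace T]

theorem exists_isGeodesic (hT : IsRTree T) (x y : T) : ∃ γ, IsGeodesic γ x y :=
  IsGeodesic.exists_of_isometry (hT.geodesic x y)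

/-- An arc between two points of an ℝ-tree has the same image as a geodesic. -/
theorem image_arc_eq (hT : IsRTree T) {x y : T} {γ c : ℝ → T} (hγ : IsGeodesic γ x y) {L : ℝ}
    (hL : 0 ≤ L) (hc : Continuous c) (hinj : InjOn c (Icc 0 L)) (h0 : c 0 = x) (h1 : c L = y) :
    c '' Icc 0 L = γ '' Icc 0 (dist x y) := by
  rcases hL.eq_or_lt with rfl | hL'
  · obtain rfl : x = y := h0.symm.trans h1
    simp [h0, hγ.map_zero]
  · have hxy : x ≠ y := by
      rintro rfl
      exact hL'.ne (hinj ⟨le_rfl, hL⟩ ⟨hL, le_rfl⟩ (h0.trans h1.symm))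
    have hd : 0 < dist x y := dist_pos.2 hxy
    have key : ∀ (e : ℝ → T) (M : ℝ), 0 < M → InjOn e (Icc 0 M) →
        Function.Injective (fun t : unitInterval => e (M * t)) ∧
        range (fun t : unitInterval => e (M * t)) = e '' Icc 0 M := by
      intro e M hM he
      have hm : ∀ t : unitInterval, M * (t : ℝ) ∈ Icc 0 M := fun t =>
        ⟨mul_nonneg hM.le t.2.1, mul_le_of_le_one_right hM.le t.2.2⟩
      refine ⟨fun s t hst => Subtype.ext (mul_left_cancel₀ hM.ne' (he (hm s) (hm t) hst)), ?_⟩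
      ext z
      constructor
      · rintro ⟨t, rfl⟩
        exact ⟨_, hm t, rfl⟩
      · rintro ⟨s, hs, rfl⟩
        refine ⟨⟨s / M, div_nonneg hs.1 hM.le, (div_le_one hM).2 hs.2⟩, ?_⟩
        simp only [mul_div_cancel₀ _ hM.ne']
    obtain ⟨i1, r1⟩ := key c L hL' hinj
    obtain ⟨i2, r2⟩ := key γ _ hd hγ.injOn
    rw [← r1, ← r2]
    refine hT.uniquelyArcwise _ _ ?_ ?_ i1 i2 ?_ ?_
    · exact hc.comp (by fun_prop)
    · exact hγ.continuous.comp (by fun_prop)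
    · simp [h0, hγ.map_zero]
    · simp [h1, hγ.map_dist]

/-- Two geodesics from `o` agree up to a time `c` at which they have reached the geodesic
between their endpoints. -/
theorem exists_branch_point (hT : IsRTree T) {o x y : T} {γ δ : ℝ → T} (hγ : IsGeodesic γ o x)
    (hδ : IsGeodesic δ o y) :
    ∃ c, 0 ≤ c ∧ c ≤ dist o x ∧ c ≤ dist o y ∧ (∀ u ∈ Icc 0 c, γ u = δ u) ∧
      dist o x - c ≤ dist x y ∧ dist o y - c ≤ dist x y := by
  obtain ⟨σ, hσ⟩ := hT.exists_isGeodesic y x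
  have hcl : IsCompact (Icc 0 (dist y x) ∩ σ ⁻¹' (γ '' Icc 0 (dist o x))) :=
    isCompact_Icc.inter_right
      ((isCompact_Icc.image hγ.continuous).isClosed.preimage hσ.continuous)
  obtain ⟨s, ⟨hs, c, hc, hcs⟩, hmin⟩ := hcl.exists_isLeast
    ⟨dist y x, ⟨dist_nonneg, le_rfl⟩, dist o x, ⟨dist_nonneg, le_rfl⟩,
      by rw [hσ.map_dist, hγ.map_dist]⟩
  let e : ℝ → T := fun u => if u ≤ c then γ u else σ (s - (u - c))
  have he1 : ∀ u ≤ c, e u = γ u := fun u hu => if_pos hu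
  have he2 : ∀ u, c ≤ u → e u = σ (s - (u - c)) := fun u hu => by
    rcases hu.eq_or_lt with rfl | h
    · rw [he1 _ le_rfl, hcs]; simp
    · exact if_neg h.not_ge
  have hec : Continuous e := Continuous.if_le hγ.continuous (hσ.continuous.comp (by fun_prop))
    continuous_id continuous_const (by rintro u rfl; simp [hcs])
  have hmix : ∀ u ∈ Icc 0 (c + s), ∀ v ∈ Icc 0 (c + s), u ≤ c → c < v → e u ≠ e v := by
    intro u hu v hv huc hcv h
    rw [he1 u huc, he2 v hcv.le] at h
    have := hmin (show s - (v - c) ∈ _ from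
      ⟨⟨by linarith [hv.2], by linarith [hs.2]⟩, u, ⟨hu.1, huc.trans hc.2⟩, h⟩)
    linarith
  have heinj : InjOn e (Icc 0 (c + s)) := by
    intro u hu v hv h
    rcases le_or_gt u c with huc | huc <;> rcases le_or_gt v c with hvc | hvc
    · rw [he1 u huc, he1 v hvc] at h
      exact hγ.injOn ⟨hu.1, huc.trans hc.2⟩ ⟨hv.1, hvc.trans hc.2⟩ h
    · exact absurd h (hmix u hu v hv huc hvc)
    · exact absurd h.symm (hmix v hv u hu hvc huc)
    · rw [he2 u huc.le, he2 v hvc.le] at h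
      have := hσ.injOn ⟨by linarith [hu.2], by linarith [hs.2]⟩
        ⟨by linarith [hv.2], by linarith [hs.2]⟩ h
      linarith
  have him := hT.image_arc_eq hδ (add_nonneg hc.1 hs.1) hec heinj
    ((he1 0 hc.1).trans hγ.map_zero)
    (by rw [he2 _ (by linarith [hs.1])]; simp [hσ.map_zero])
  have hagree : ∀ u ∈ Icc 0 c, u ≤ dist o y ∧ γ u = δ u := by
    intro u hu
    have : γ u ∈ δ '' Icc 0 (dist o y) := by
      rw [← him, ← he1 u hu.2]
      exact ⟨u, ⟨hu.1, by linarith [hu.2, hs.1]⟩, rfl⟩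
    obtain ⟨v, hv, hvu⟩ := this
    have h1 := hδ.dist_left hv
    rw [hvu, hγ.dist_left ⟨hu.1, hu.2.trans hc.2⟩] at h1
    subst h1
    exact ⟨hv.2, hvu.symm⟩
  have hcy := (hagree c ⟨hc.1, le_rfl⟩).1
  have h2 := hγ.dist_right hc
  have h3 := hδ.dist_right ⟨hc.1, hcy⟩
  rw [← (hagree c ⟨hc.1, le_rfl⟩).2, hcs, dist_comm, hσ.dist_left hs] at h3
  rw [hcs, hσ.dist_right hs] at h2
  rw [dist_comm x y]
  exact ⟨c, hc.1, hc.2, hcy, fun u hu => (hagree u hu).2, by linarith [hs.1], by linarith [hs.2]⟩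

theorem dist_geodesic_le (hT : IsRTree T) {o x y : T} {γ δ : ℝ → T} (hγ : IsGeodesic γ o x)
    (hδ : IsGeodesic δ o y) {u v : ℝ} (hu : u ∈ Icc 0 (dist o x)) (hv : v ∈ Icc 0 (dist o y)) :
    dist (γ u) (δ v) ≤ |u - v| + 2 * dist x y := by
  obtain ⟨c, hc0, hcx, hcy, hag, hx, hy⟩ := hT.exists_branch_point hγ hδ
  have hxy : 0 ≤ dist x y := dist_nonneg
  rcases le_total u c with h | h
  · rw [hag u ⟨hu.1, h⟩, hδ.dist_eq u ⟨hu.1, h.trans hcy⟩ v hv]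
    linarith
  rcases le_total v c with h' | h'
  · rw [← hag v ⟨hv.1, h'⟩, hγ.dist_eq u hu v ⟨hv.1, h'.trans hcx⟩]
    linarith
  · have h1 := hγ.dist_eq u hu c ⟨hc0, hcx⟩
    have h2 := hδ.dist_eq c ⟨hc0, hcy⟩ v hv
    rw [abs_of_nonneg (by linarith)] at h1
    rw [abs_of_nonpos (by linarith), ← hag c ⟨hc0, le_rfl⟩] at h2
    have := dist_triangle (γ u) (γ c) (δ v)
    linarith [hu.2, hv.2, abs_nonneg (u - v)]

theorem contractibleSpace (hT : IsRTree T) : ContractibleSpace T := by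
  obtain ⟨o⟩ := hT.nonempty
  choose γ hγ using fun x => hT.exists_isGeodesic o x
  have hm : ∀ q : unitInterval × T,
      (1 - (q.1 : ℝ)) * dist o q.2 ∈ Icc 0 (dist o q.2) := fun q =>
    ⟨mul_nonneg (sub_nonneg.2 q.1.2.2) dist_nonneg,
      mul_le_of_le_one_left dist_nonneg (by linarith [q.1.2.1])⟩
  have hcont : Continuous fun q : unitInterval × T => γ q.2 ((1 - (q.1 : ℝ)) * dist o q.2) := by
    rw [continuous_iff_continuousAt]
    intro q
    rw [ContinuousAt, tendsto_iff_dist_tendsto_zero]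
    have hb : Tendsto (fun q' : unitInterval × T =>
        |(1 - (q'.1 : ℝ)) * dist o q'.2 - (1 - (q.1 : ℝ)) * dist o q.2| + 2 * dist q'.2 q.2)
        (𝓝 q) (𝓝 0) := by
      have : Continuous (fun q' : unitInterval × T =>
        |(1 - (q'.1 : ℝ)) * dist o q'.2 - (1 - (q.1 : ℝ)) * dist o q.2| + 2 * dist q'.2 q.2) := by
        fun_prop
      simpa using this.tendsto q
    exact squeeze_zero (fun _ => dist_nonneg)
      (fun q' => hT.dist_geodesic_le (hγ _) (hγ _) (hm q') (hm q)) hb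
  rw [contractible_iff_id_nullhomotopic]
  refine ⟨o, ⟨⟨⟨_, hcont⟩, fun x => ?_, fun x => ?_⟩⟩⟩
  · simp [(hγ x).map_dist]
  · simp [(hγ x).map_zero]

end IsRTree

/-- A geodesic ℝ-tree reduction of a path is homotopic to it relative to endpoints. -/
theorem GeodesicReduction.homotopicRel {X : Type*} [TopologicalSpace X]
    {α β : C(unitInterval, X)} (h : GeodesicReduction ⇑α ⇑β) : α.HomotopicRel β {0, 1} := by
  obtain ⟨T, _, hT, f, p, r, hf, hp, hr, -, h0, h1, rfl', rfl''⟩ := h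
  have := hT.contractibleSpace
  let P : Path (p 0) (p 1) := ⟨⟨p, hp⟩, rfl, rfl⟩
  let R : Path (p 0) (p 1) := ⟨⟨r, hr⟩, h0, h1⟩
  have hPR : P.toContinuousMap.HomotopicRel R.toContinuousMap {0, 1} :=
    SimplyConnectedSpace.paths_homotopic P R
  have hα : (⟨f, hf⟩ : C(T, X)).comp P.toContinuousMap = α := DFunLike.coe_injective rfl'
  have hβ : (⟨f, hf⟩ : C(T, X)).comp R.toContinuousMap = β := DFunLike.coe_injective rfl''
  rw [← hα, ← hβ]
  exact hPR.comp_continuousMap _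

section FourPoint

variable {T : Type} [MetricSpace T]

/-- In a metric space satisfying the four-point condition, a path from `x` to `y` visits every
point of the geodesic segment between `x` and `y`. -/
theorem mem_image_of_fourPoint
    (fp : ∀ x y z w : T, dist x y + dist z w ≤ max (dist x z + dist y w) (dist x w + dist y z))
    {A : Set T} (hA : IsPreconnected A) {x y w : T} (hx : x ∈ A) (hy : y ∈ A)
    (hw : dist x w + dist w y = dist x y) : w ∈ A := by
  by_contra hwA
  have hxw : x ≠ w := fun h => hwA (h ▸ hx)
  have hyw : y ≠ w := fun h => hwA (h ▸ hy)
  let U : Set T := {z | dist x z < dist x w + dist w z}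
  let V : Set T := {z | z ≠ w ∧ dist x w + dist w z ≤ dist x z}
  have hU : IsOpen U := isOpen_lt (by fun_prop) (by fun_prop)
  have hV : IsOpen V := by
    rw [Metric.isOpen_iff]
    rintro z ⟨hzw, hz⟩
    refine ⟨dist z w, dist_pos.2 hzw, fun z' hz' => ?_⟩
    rw [Metric.mem_ball] at hz'
    refine ⟨?_, ?_⟩
    · rintro rfl
      rw [dist_comm] at hz'
      exact hz'.false
    · have h := fp x z w z'
      have h1 := dist_comm z z'
      have h2 := dist_comm z w
      have h3 : 0 ≤ dist w z' := dist_nonneg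
      rcases le_max_iff.1 h with h | h <;> linarith
  obtain ⟨z, -, hzU, hzV⟩ := hA U V hU hV
    (fun z hz => by
      rcases lt_or_ge (dist x z) (dist x w + dist w z) with h | h
      · exact Or.inl h
      · exact Or.inr ⟨fun h' => hwA (h' ▸ hz), h⟩)
    ⟨x, hx, by
      have := dist_pos.2 hxw
      have := dist_comm x w
      simp only [U, mem_ofPred_eq, dist_self]; linarith⟩
    ⟨y, hy, hyw, hw.le⟩
  exact absurd hzU (not_lt.2 hzV.2)

theorem range_eq_segment_of_fourPoint
    (geo : ∀ x y : T, ∃ γ, IsGeodesic γ x y)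
    (fp : ∀ x y z w : T, dist x y + dist z w ≤ max (dist x z + dist y w) (dist x w + dist y z))
    {p : unitInterval → T} (hp : Continuous p) (hinj : Function.Injective p) :
    range p = {w | dist (p 0) w + dist w (p 1) = dist (p 0) (p 1)} := by
  refine Subset.antisymm ?_ fun w hw =>
    mem_image_of_fourPoint fp (isPreconnected_range hp) ⟨0, rfl⟩ ⟨1, rfl⟩ hw
  rintro _ ⟨t, rfl⟩
  obtain ⟨γ, hγ⟩ := geo (p t) (p 0)
  set g := (dist (p t) (p 0) + dist (p t) (p 1) - dist (p 0) (p 1)) / 2 with hg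
  have hg0 : 0 ≤ g := by
    have := dist_triangle (p 0) (p t) (p 1)
    have := dist_comm (p 0) (p t)
    simp only [hg]; linarith
  have hg1 : g ≤ dist (p t) (p 0) := by
    have := dist_triangle (p t) (p 0) (p 1)
    simp only [hg]; linarith
  have h1 := hγ.dist_left ⟨hg0, hg1⟩
  have h2 := hγ.dist_right ⟨hg0, hg1⟩
  have h3 : dist (p t) (γ g) + dist (γ g) (p 1) = dist (p t) (p 1) := by
    have h := fp (γ g) (p 1) (p t) (p 0)
    have h4 := dist_triangle (p t) (γ g) (p 1)
    have := dist_comm (γ g) (p t)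
    have := dist_comm (p 1) (p t)
    have := dist_comm (p 1) (p 0)
    rcases le_max_iff.1 h with h | h <;> linarith
  have m1 : γ g ∈ p '' Icc 0 t := mem_image_of_fourPoint fp
    (isPreconnected_Icc.image p hp.continuousOn) ⟨t, ⟨t.2.1, le_rfl⟩, rfl⟩
    ⟨0, ⟨le_rfl, t.2.1⟩, rfl⟩ (by linarith)
  have m2 : γ g ∈ p '' Icc t 1 := mem_image_of_fourPoint fp
    (isPreconnected_Icc.image p hp.continuousOn) ⟨t, ⟨le_rfl, t.2.2⟩, rfl⟩
    ⟨1, ⟨t.2.2, le_rfl⟩, rfl⟩ h3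
  obtain ⟨a, ha, hag⟩ := m1
  obtain ⟨b, hb, hbg⟩ := m2
  have hab : a = b := hinj (hag.trans hbg.symm)
  have hat : a = t := le_antisymm ha.2 (hab ▸ hb.1)
  rw [hat] at hag
  rw [← hag, dist_self] at h1
  have := dist_comm (p 0) (p t)
  simp only [mem_ofPred_eq]
  linarith

/-- A geodesic metric space satisfying the four-point condition is an ℝ-tree. -/
theorem IsRTree.of_fourPoint [Nonempty T] (geo : ∀ x y : T, ∃ γ, IsGeodesic γ x y)
    (fp : ∀ x y z w : T, dist x y + dist z w ≤ max (dist x z + dist y w) (dist x w + dist y z)) :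
    IsRTree T where
  nonempty := inferInstance
  geodesic x y := (geo x y).imp fun γ h => ⟨h.map_zero, h.map_dist, h.dist_eq⟩
  uniquelyArcwise p q hp hq ip iq h0 h1 := by
    rw [range_eq_segment_of_fourPoint geo fp hp ip, range_eq_segment_of_fourPoint geo fp hq iq,
      h0, h1]
  locallyArcwise := by
    refine LocallyPathConnectedSpace.of_bases (fun x => Metric.nhds_basis_ball) fun x ε hε => ?_
    refine ⟨x, Metric.mem_ball_self hε, fun {y} hy => ?_⟩
    obtain ⟨γ, hγ⟩ := geo x y
    refine JoinedIn.ofLine (f := fun t => γ (t * dist x y)) ?_ ?_ ?_ ?_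
    · exact (hγ.continuous.comp (by fun_prop)).continuousOn
    · simp [hγ.map_zero]
    · simp [hγ.map_dist]
    · rintro _ ⟨t, ht, rfl⟩
      have hle : t * dist x y ≤ dist x y := mul_le_of_le_one_left dist_nonneg ht.2
      rw [Metric.mem_ball, dist_comm] at hy ⊢
      rw [hγ.dist_left ⟨mul_nonneg ht.1 dist_nonneg, hle⟩]
      exact hle.trans_lt hy

end FourPoint

noncomputable section CodedTree

variable (h : C(unitInterval, ℝ))

/-- The minimum of `h` over the interval between `s` and `t`. -/
def minBetween (s t : unitInterval) : ℝ := sInf (h '' uIcc s t)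

variable {h}

theorem exists_eq_minBetween (s t : unitInterval) : ∃ r ∈ uIcc s t, h r = minBetween h s t :=
  (isCompact_uIcc.image h.continuous).sInf_mem (nonempty_uIcc.image h)

theorem minBetween_le {s t r : unitInterval} (hr : r ∈ uIcc s t) : minBetween h s t ≤ h r :=
  csInf_le (isCompact_uIcc.image h.continuous).bddBelow ⟨r, hr, rfl⟩

theorem le_minBetween_iff {s t : unitInterval} {v : ℝ} :
    v ≤ minBetween h s t ↔ ∀ r ∈ uIcc s t, v ≤ h r := by
  refine ⟨fun hv r hr => hv.trans (minBetween_le hr), fun hv => ?_⟩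
  obtain ⟨r, hr, hrm⟩ := exists_eq_minBetween (h := h) s t
  exact hrm ▸ hv r hr

theorem minBetween_comm (s t : unitInterval) : minBetween h s t = minBetween h t s := by
  rw [minBetween, uIcc_comm, minBetween]

@[simp]
theorem minBetween_self (s : unitInterval) : minBetween h s s = h s := by simp [minBetween]

theorem minBetween_le_left (s t : unitInterval) : minBetween h s t ≤ h s :=
  minBetween_le left_mem_uIcc

theorem minBetween_le_right (s t : unitInterval) : minBetween h s t ≤ h t :=
  minBetween_le right_mem_uIcc

theorem minBetween_ultra (s t u : unitInterval) :
    min (minBetween h s t) (minBetween h t u) ≤ minBetween h s u := by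
  rw [le_minBetween_iff]
  intro r hr
  rcases uIcc_subset_uIcc_union_uIcc (b := t) hr with hr | hr
  · exact (min_le_left _ _).trans (minBetween_le hr)
  · exact (min_le_right _ _).trans (minBetween_le hr)

variable (h) in
/-- The unit interval, to be endowed with the pseudometric
`(s, t) ↦ h s + h t - 2 * minBetween h s t`. -/
def PreCodedTree (_ : C(unitInterval, ℝ)) : Type := unitInterval

instance : PseudoMetricSpace (PreCodedTree h) where
  dist (s t : unitInterval) := h s + h t - 2 * minBetween h s t
  dist_self (s : unitInterval) := by rw [minBetween_self]; ring
  dist_comm (s t : unitInterval) := by rw [minBetween_comm]; ring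
  dist_triangle (s t u : unitInterval) := by
    have h1 := minBetween_ultra (h := h) s t u
    have h2 := minBetween_le_right (h := h) s t
    have h3 := minBetween_le_left (h := h) t u
    rcases min_le_iff.1 h1 with h1 | h1 <;> linarith

variable (h) in
/-- The tree coded by `h`. -/
abbrev CodedTree : Type := SeparationQuotient (PreCodedTree h)

variable (h) in
/-- The canonical projection from the unit interval to the tree coded by `h`. -/
def CodedTree.proj (s : unitInterval) : CodedTree h :=
  SeparationQuotient.mk (X := PreCodedTree h) s

namespace CodedTree

theorem proj_surjective : Function.Surjective (proj h) :=
  SeparationQuotient.surjective_mk (X := PreCodedTree h)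

theorem dist_proj (s t : unitInterval) :
    dist (proj h s) (proj h t) = h s + h t - 2 * minBetween h s t := rfl

theorem proj_eq_iff {s t : unitInterval} :
    proj h s = proj h t ↔ h s = minBetween h s t ∧ h t = minBetween h s t := by
  rw [← dist_eq_zero, dist_proj]
  have h1 := minBetween_le_left (h := h) s t
  have h2 := minBetween_le_right (h := h) s t
  constructor
  · intro h3
    constructor <;> linarith
  · rintro ⟨h3, h4⟩
    linarith

theorem continuous_proj : Continuous (proj h) := by
  rw [Metric.continuous_iff]
  intro s ε hε
  obtain ⟨δ, hδ, hs⟩ := Metric.continuous_iff.1 h.continuous s (ε / 4) (by linarith)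
  refine ⟨δ, hδ, fun t ht => ?_⟩
  obtain ⟨r, hr, hrm⟩ := exists_eq_minBetween (h := h) t s
  have hr' : (r : ℝ) ∈ uIcc (t : ℝ) s := by
    rcases mem_uIcc.1 hr with hr | hr
    · exact mem_uIcc.2 (Or.inl hr)
    · exact mem_uIcc.2 (Or.inr hr)
  have h1 := hs r ((Real.dist_right_le_of_mem_uIcc hr').trans_lt ht)
  have h2 := hs t ht
  rw [Real.dist_eq, abs_lt] at h1 h2
  rw [dist_proj, ← hrm]
  linarith [h1.1, h1.2, h2.1, h2.2]

theorem exists_ancestor (s : unitInterval) (v : ℝ) :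
    ∃ a, h 0 ≤ v → v ≤ h s → a ≤ s ∧ h a = v ∧ minBetween h a s = v := by
  by_cases hv : h 0 ≤ v ∧ v ≤ h s
  swap
  · exact ⟨s, fun h1 h2 => absurd ⟨h1, h2⟩ hv⟩
  have hc : IsCompact (Icc 0 s ∩ h ⁻¹' Iic v) :=
    isCompact_Icc.inter_right (isClosed_Iic.preimage h.continuous)
  obtain ⟨a, ⟨has, hav⟩, hmax⟩ := hc.exists_isGreatest ⟨0, ⟨le_rfl, s.2.1⟩, hv.1⟩
  have key : ∀ r ∈ Icc a s, v ≤ h r := by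
    intro r hr
    by_contra! hlt
    obtain ⟨c, hc, hcv⟩ := intermediate_value_Icc hr.2 h.continuous.continuousOn ⟨hlt.le, hv.2⟩
    have hca : c ≤ a := hmax ⟨⟨c.2.1, hc.2⟩, hcv.le⟩
    have : r = c := le_antisymm hc.1 (hca.trans hr.1)
    rw [this, hcv] at hlt
    exact hlt.false
  have ha : h a = v := le_antisymm hav (key a ⟨le_rfl, has.2⟩)
  refine ⟨a, fun _ _ => ⟨has.2, ha, le_antisymm ?_ ?_⟩⟩
  · exact ha ▸ minBetween_le_left a s
  · rw [le_minBetween_iff, uIcc_of_le has.2]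
    exact key

theorem dist_ancestor {s a b : unitInterval} (ha : minBetween h a s = h a)
    (hb : minBetween h b s = h b) : dist (proj h a) (proj h b) = |h a - h b| := by
  have h1 := minBetween_ultra (h := h) a s b
  have h2 := minBetween_le_left (h := h) a b
  have h3 := minBetween_le_right (h := h) a b
  rw [minBetween_comm s b, ha, hb] at h1
  rw [dist_proj]
  rcases le_total (h a) (h b) with hab | hab
  · rw [min_eq_left hab] at h1
    rw [abs_of_nonpos (by linarith)]
    linarith
  · rw [min_eq_right hab] at h1
    rw [abs_of_nonneg (by linarith)]
    linarith

theorem minBetween_ancestors {s t a b : unitInterval} (ha : minBetween h a s = h a)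
    (hb : minBetween h b t = h b) (ha' : minBetween h s t ≤ h a) (hb' : minBetween h s t ≤ h b) :
    minBetween h a b = minBetween h s t := by
  have h1 := minBetween_ultra (h := h) a s b
  have h2 := minBetween_ultra (h := h) s t b
  have h3 := minBetween_ultra (h := h) s a t
  have h4 := minBetween_ultra (h := h) a b t
  have h5 := minBetween_le_left (h := h) a b
  have h6 := minBetween_le_right (h := h) a b
  rw [minBetween_comm t b, hb] at h2
  rw [minBetween_comm s a, ha] at h3
  rw [ha] at h1
  rw [hb] at h4
  refine le_antisymm ?_ ?_
  · exact le_trans (le_min h5 (le_trans (le_min le_rfl h6) h4)) h3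
  · exact le_trans (le_min ha' (le_trans (le_min le_rfl hb') h2)) h1

theorem exists_isGeodesic (h0 : ∀ r, h 0 ≤ h r) (x y : CodedTree h) :
    ∃ γ, IsGeodesic γ x y := by
  obtain ⟨s, rfl⟩ := proj_surjective x
  obtain ⟨t, rfl⟩ := proj_surjective y
  apply IsGeodesic.exists_of_isometry
  choose anc hanc using exists_ancestor (h := h)
  set M := minBetween h s t with hM
  have hMs : M ≤ h s := minBetween_le_left s t
  have hMt : M ≤ h t := minBetween_le_right s t
  have hM0 : h 0 ≤ M := le_minBetween_iff.2 fun r _ => h0 r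
  have hD : dist (proj h s) (proj h t) = h s + h t - 2 * M := dist_proj s t
  have hself : ∀ r, proj h (anc r (h r)) = proj h r := fun r => by
    obtain ⟨-, h2, h3⟩ := hanc r (h r) (h0 r) le_rfl
    rw [proj_eq_iff, h2, h3]
    exact ⟨rfl, rfl⟩
  have hbranch : proj h (anc s M) = proj h (anc t M) := by
    obtain ⟨-, h2, h3⟩ := hanc s M hM0 hMs
    obtain ⟨-, h5, h6⟩ := hanc t M hM0 hMt
    rw [proj_eq_iff, minBetween_ancestors (h3.trans h2.symm) (h6.trans h5.symm) h2.ge h5.ge,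
      h2, h5]
    exact ⟨rfl, rfl⟩
  let γ : ℝ → CodedTree h := fun τ =>
    if τ ≤ h s - M then proj h (anc s (h s - τ)) else proj h (anc t (2 * M - h s + τ))
  have hγ1 : ∀ τ ≤ h s - M, γ τ = proj h (anc s (h s - τ)) := fun τ hτ => if_pos hτ
  have hγ2 : ∀ τ, h s - M ≤ τ → γ τ = proj h (anc t (2 * M - h s + τ)) := fun τ hτ => by
    rcases hτ.eq_or_lt with rfl | hlt
    · rw [hγ1 _ le_rfl]
      convert hbranch using 3 <;> ring
    · exact if_neg hlt.not_ge
  rw [hD]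
  refine ⟨γ, ?_, ?_, ?_⟩
  · rw [hγ1 0 (by linarith), sub_zero, hself]
  · rw [hγ2 _ (by linarith), ← hself t]
    congr 2
    ring
  · have hcross : ∀ σ τ, 0 ≤ σ → σ ≤ h s - M → h s - M ≤ τ → τ ≤ h s + h t - 2 * M →
        dist (γ σ) (γ τ) = τ - σ := by
      intro σ τ hσ0 hσ hτ hτ1
      rw [hγ1 σ hσ, hγ2 τ hτ]
      obtain ⟨-, h2, h3⟩ := hanc s (h s - σ) (by linarith) (by linarith)
      obtain ⟨-, h5, h6⟩ := hanc t (2 * M - h s + τ) (by linarith) (by linarith)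
      rw [dist_proj, minBetween_ancestors (h3.trans h2.symm) (h6.trans h5.symm) (by linarith)
        (by linarith), h2, h5]
      ring
    intro σ hσ τ hτ
    rcases le_total σ (h s - M) with h1 | h1 <;> rcases le_total τ (h s - M) with h2 | h2
    · rw [hγ1 σ h1, hγ1 τ h2]
      obtain ⟨-, h3, h4⟩ := hanc s (h s - σ) (by linarith) (by linarith [hσ.1])
      obtain ⟨-, h5, h6⟩ := hanc s (h s - τ) (by linarith) (by linarith [hτ.1])
      rw [dist_ancestor (h4.trans h3.symm) (h6.trans h5.symm), h3, h5, abs_sub_comm]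
      congr 1
      ring
    · rw [hcross σ τ hσ.1 h1 h2 hτ.2, abs_sub_comm, abs_of_nonneg (by linarith)]
    · rw [dist_comm, hcross τ σ hτ.1 h2 h1 hσ.2, abs_of_nonneg (by linarith)]
    · rw [hγ2 σ h1, hγ2 τ h2]
      obtain ⟨-, h3, h4⟩ := hanc t (2 * M - h s + σ) (by linarith) (by linarith [hσ.2])
      obtain ⟨-, h5, h6⟩ := hanc t (2 * M - h s + τ) (by linarith) (by linarith [hτ.2])
      rw [dist_ancestor (h4.trans h3.symm) (h6.trans h5.symm), h3, h5]
      congr 1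
      ring

theorem fourPoint (x y z w : CodedTree h) :
    dist x y + dist z w ≤ max (dist x z + dist y w) (dist x w + dist y z) := by
  obtain ⟨x, rfl⟩ := proj_surjective x
  obtain ⟨y, rfl⟩ := proj_surjective y
  obtain ⟨z, rfl⟩ := proj_surjective z
  obtain ⟨w, rfl⟩ := proj_surjective w
  simp only [dist_proj]
  have h1 := minBetween_ultra (h := h) x z y
  have h2 := minBetween_ultra (h := h) x w y
  have h3 := minBetween_ultra (h := h) z x w
  have h4 := minBetween_ultra (h := h) z y w
  rw [minBetween_comm z y] at h1 h4
  rw [minBetween_comm w y] at h2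
  rw [minBetween_comm z x] at h3
  by_contra! hlt
  obtain ⟨h5, h6⟩ := max_lt_iff.1 hlt
  rcases min_le_iff.1 h1 with h1 | h1 <;> rcases min_le_iff.1 h2 with h2 | h2 <;>
    rcases min_le_iff.1 h3 with h3 | h3 <;> rcases min_le_iff.1 h4 with h4 | h4 <;> linarith

theorem isRTree (h0 : ∀ r, h 0 ≤ h r) : IsRTree (CodedTree h) :=
  have : Nonempty (CodedTree h) := ⟨proj h 0⟩
  IsRTree.of_fourPoint (exists_isGeodesic h0) fourPoint

end CodedTree

/-- If `α` factors through the tree coded by `h`, and `β` is the value of `α` along the geodesic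
from the image of `0` to the image of `1` in this tree, then `β` is a reduction of `α`. -/
theorem GeodesicReduction.of_code {X : Type*} [TopologicalSpace X] {α β : unitInterval → X}
    (hα : Continuous α) (h0 : h 0 = 0) (h1 : h 1 = 1) (hnn : ∀ r, 0 ≤ h r)
    (hfactor : ∀ s t, s ≤ t → h s = h t → (∀ r ∈ Icc s t, h s ≤ h r) → α s = α t)
    (hβ : ∀ a u : unitInterval, h a = u → (∀ r, a ≤ r → h a ≤ h r) → α a = β u) :
    GeodesicReduction α β := by
  have hmin : ∀ r, h 0 ≤ h r := fun r => h0 ▸ hnn r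
  have hle : ∀ s t, s ≤ t → CodedTree.proj h s = CodedTree.proj h t → α s = α t := by
    intro s t hst hp
    obtain ⟨h2, h3⟩ := CodedTree.proj_eq_iff.1 hp
    refine hfactor s t hst (h2.trans h3.symm) fun r hr => ?_
    rw [h2]
    exact minBetween_le (by rwa [uIcc_of_le hst])
  have hfac : ∀ s t, CodedTree.proj h s = CodedTree.proj h t → α s = α t := fun s t hp =>
    (le_total s t).elim (fun hst => hle s t hst hp) fun hst => (hle t s hst hp.symm).symm
  let f : CodedTree h → X := fun z => α (Function.surjInv CodedTree.proj_surjective z)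
  have hf : f ∘ CodedTree.proj h = α :=
    funext fun s => hfac _ _ (Function.surjInv_eq CodedTree.proj_surjective _)
  have hq : IsQuotientMap (CodedTree.proj h) :=
    CodedTree.continuous_proj.isClosedMap.isQuotientMap CodedTree.continuous_proj
      CodedTree.proj_surjective
  choose anc hanc using CodedTree.exists_ancestor (h := h) 1
  have hu : ∀ u : unitInterval, h (anc u) = u ∧ minBetween h (anc u) 1 = u := fun u =>
    (hanc u (h0.trans_le u.2.1) (h1 ▸ u.2.2)).2
  have hiso : Isometry fun u : unitInterval => CodedTree.proj h (anc u) :=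
    Isometry.of_dist_eq fun u v => by
      rw [CodedTree.dist_ancestor ((hu u).2.trans (hu u).1.symm) ((hu v).2.trans (hu v).1.symm),
        (hu u).1, (hu v).1, Subtype.dist_eq, Real.dist_eq]
  refine ⟨CodedTree h, inferInstance, CodedTree.isRTree hmin, f, CodedTree.proj h,
    fun u => CodedTree.proj h (anc u), ?_, CodedTree.continuous_proj, hiso.continuous,
    hiso.injective, ?_, ?_, hf, ?_⟩
  · rw [hq.continuous_iff, hf]
    exact hα
  · obtain ⟨h2, -⟩ := hu 0
    have h4 : minBetween h (anc (0 : unitInterval)) 0 = 0 :=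
      le_antisymm (h0 ▸ minBetween_le_right _ _) (le_minBetween_iff.2 fun r _ => hnn r)
    rw [CodedTree.proj_eq_iff, h4, h2, h0]
    exact ⟨rfl, rfl⟩
  · obtain ⟨h2, h3⟩ := hu 1
    rw [CodedTree.proj_eq_iff, h3, h2, h1]
    exact ⟨rfl, rfl⟩
  · funext u
    rw [← hβ (anc u) u (hu u).1 fun r hr => ?_]
    · exact congrFun hf (anc u)
    · rw [(hu u).1, ← (hu u).2]
      exact minBetween_le (by rw [uIcc_of_le unitInterval.le_one']; exact ⟨hr, r.2.2⟩)

end CodedTree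

section TriangleCurve

/-- A bounded family of numbers, each at most half of another member or nonpositive, is
nonpositive. -/
theorem nonpos_of_le_half {ι : Type*} {S : Set ι} {E : ι → ℝ} (hE : BddAbove (E '' S))
    (h : ∀ a ∈ S, E a ≤ 0 ∨ ∃ b ∈ S, E a ≤ E b / 2) : ∀ a ∈ S, E a ≤ 0 := by
  intro a ha
  have hle : ∀ b ∈ S, E b ≤ sSup (E '' S) := fun b hb => le_csSup hE ⟨b, hb, rfl⟩
  have hsup : sSup (E '' S) ≤ max 0 (sSup (E '' S) / 2) := by
    refine csSup_le ⟨E a, a, ha, rfl⟩ ?_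
    rintro _ ⟨b, hb, rfl⟩
    rcases h b hb with h | ⟨c, hc, h⟩
    · exact le_max_of_le_left h
    · exact le_max_of_le_right (h.trans (by linarith [hle c hc]))
  have := hle a ha
  rcases le_max_iff.1 hsup with h | h <;> linarith

/-- Existence of fixed points for contractions of the space of paths from `0` to `e`. -/
theorem exists_path_fixedPoint {E : Type*} [NormedAddCommGroup E] [NormedSpace ℝ E]
    [CompleteSpace E] (e : E) {K : NNReal} (hK : K < 1)
    (Φ : C(unitInterval, E) → C(unitInterval, E))
    (hmaps : ∀ f, f 0 = 0 → f 1 = e → Φ f 0 = 0 ∧ Φ f 1 = e)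
    (hcontr : ∀ f g, f 0 = 0 → f 1 = e → g 0 = 0 → g 1 = e →
      ∀ t, dist (Φ f t) (Φ g t) ≤ K * dist f g) :
    ∃ f, f 0 = 0 ∧ f 1 = e ∧ Φ f = f := by
  let S : Set C(unitInterval, E) := {f | f 0 = 0 ∧ f 1 = e}
  have hS : IsClosed S :=
    (isClosed_eq (by fun_prop) (by fun_prop)).inter (isClosed_eq (by fun_prop) (by fun_prop))
  have hΦ : MapsTo Φ S S := fun f hf => hmaps f hf.1 hf.2
  have hc : ContractingWith K (hΦ.restrict Φ S S) :=
    ⟨hK, LipschitzWith.of_dist_le_mul fun f g =>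
      (ContinuousMap.dist_le (by positivity)).2
        (hcontr f g f.2.1 f.2.2 g.2.1 g.2.2)⟩
  let f₀ : C(unitInterval, E) := ⟨fun t => (t : ℝ) • e, by fun_prop⟩
  obtain ⟨f, hf, hfix, -⟩ := hc.exists_fixedPoint' hS.isComplete hΦ
    (show f₀ ∈ S from ⟨by simp [f₀], by simp [f₀]⟩) (edist_ne_top _ _)
  exact ⟨f, hf.1, hf.2, hfix⟩

/-- A path from `0` to `1` that goes up to `1/2`, up to `1`, back to `1/2`, and up to `1` again,
replicating itself at half size each time. -/
structure IsTreeCode (H : ℝ → ℝ) : Prop where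
  continuous : Continuous H
  of_nonpos : ∀ t ≤ 0, H t = 0
  of_one_le : ∀ t, 1 ≤ t → H t = 1
  first : ∀ t ∈ Icc (0 : ℝ) (1 / 4), H t = H (4 * t) / 2
  second : ∀ t ∈ Icc (1 / 4 : ℝ) (1 / 2), H t = 1 / 2 + H (4 * t - 1) / 2
  third : ∀ t ∈ Icc (1 / 2 : ℝ) (3 / 4), H t = 1 / 2 + H (3 - 4 * t) / 2
  fourth : ∀ t ∈ Icc (3 / 4 : ℝ) 1, H t = 1 / 2 + H (4 * t - 3) / 2

theorem exists_isTreeCode : ∃ H, IsTreeCode H := by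
  let P : ℝ → unitInterval := projIcc 0 1 zero_le_one
  have hP : Continuous P := continuous_projIcc
  have P0 : ∀ t ≤ 0, P t = 0 := fun t ht => projIcc_of_le_left _ ht
  have P1 : ∀ t, 1 ≤ t → P t = 1 := fun t ht => projIcc_of_right_le _ ht
  let Φ : C(unitInterval, ℝ) → C(unitInterval, ℝ) := fun f =>
    ⟨fun t => f (P (4 * t)) / 2 + f (P (4 * t - 1)) / 2 + (f (P (3 - 4 * t)) - 1) / 2 +
      f (P (4 * t - 3)) / 2, by fun_prop⟩
  have key : ∀ f : C(unitInterval, ℝ), f 0 = 0 → f 1 = 1 → ∀ t : unitInterval,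
      ((t : ℝ) ≤ 1 / 4 → Φ f t = f (P (4 * t)) / 2) ∧
      ((1 / 4 : ℝ) ≤ t → (t : ℝ) ≤ 1 / 2 → Φ f t = 1 / 2 + f (P (4 * t - 1)) / 2) ∧
      ((1 / 2 : ℝ) ≤ t → (t : ℝ) ≤ 3 / 4 → Φ f t = 1 / 2 + f (P (3 - 4 * t)) / 2) ∧
      ((3 / 4 : ℝ) ≤ t → Φ f t = 1 / 2 + f (P (4 * t - 3)) / 2) := by
    intro f f0 f1 t
    refine ⟨fun h => ?_, fun h h' => ?_, fun h h' => ?_, fun h => ?_⟩ <;>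
      simp only [Φ, ContinuousMap.coe_mk]
    · rw [P0 (4 * t - 1) (by linarith), P1 (3 - 4 * t) (by linarith),
        P0 (4 * t - 3) (by linarith), f0, f1]
      ring
    · rw [P1 (4 * t) (by linarith), P1 (3 - 4 * t) (by linarith),
        P0 (4 * t - 3) (by linarith), f0, f1]
      ring
    · rw [P1 (4 * t) (by linarith), P1 (4 * t - 1) (by linarith),
        P0 (4 * t - 3) (by linarith), f0, f1]
      ring
    · rw [P1 (4 * t) (by linarith), P1 (4 * t - 1) (by linarith),
        P0 (3 - 4 * t) (by linarith), f0, f1]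
      ring
  obtain ⟨f, f0, f1, hf⟩ := exists_path_fixedPoint (1 : ℝ) (K := 1 / 2)
    (by rw [← NNReal.coe_lt_coe]; norm_num) Φ
    (fun f f0 f1 => by
      refine ⟨?_, ?_⟩
      · rw [(key f f0 f1 0).1 (by norm_num), P0 _ (by simp), f0]; norm_num
      · rw [(key f f0 f1 1).2.2.2 (by norm_num), P1 _ (by norm_num), f1]; norm_num)
    (fun f g f0 f1 g0 g1 t => by
      have hd : ∀ s, |f s / 2 - g s / 2| ≤ 1 / 2 * dist f g := fun s => by
        have := ContinuousMap.dist_apply_le_dist (f := f) (g := g) s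
        rw [Real.dist_eq] at this
        rw [← sub_div, abs_div, abs_two]
        linarith
      have hf := key f f0 f1 t
      have hg := key g g0 g1 t
      rw [Real.dist_eq]
      push_cast
      rcases le_total (t : ℝ) (1 / 4) with h1 | h1
      · rw [hf.1 h1, hg.1 h1]
        exact hd _
      rcases le_total (t : ℝ) (1 / 2) with h2 | h2
      · rw [hf.2.1 h1 h2, hg.2.1 h1 h2, add_sub_add_left_eq_sub]
        exact hd _
      rcases le_total (t : ℝ) (3 / 4) with h3 | h3
      · rw [hf.2.2.1 h2 h3, hg.2.2.1 h2 h3, add_sub_add_left_eq_sub]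
        exact hd _
      · rw [hf.2.2.2 h3, hg.2.2.2 h3, add_sub_add_left_eq_sub]
        exact hd _)
  have hPt : ∀ t (h0 : 0 ≤ t) (h1 : t ≤ 1), P t = ⟨t, h0, h1⟩ :=
    fun t h0 h1 => projIcc_of_mem _ ⟨h0, h1⟩
  have key' := key f f0 f1
  rw [hf] at key'
  refine ⟨fun t => f (P t), by fun_prop, fun t ht => ?_, fun t ht => ?_, fun t ht => ?_,
    fun t ht => ?_, fun t ht => ?_, fun t ht => ?_⟩
  · rw [P0 t ht, f0]
  · rw [P1 t ht, f1]
  · have h0 : 0 ≤ t := ht.1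
    have h1 : t ≤ 1 := by linarith [ht.2]
    simpa only [hPt t h0 h1] using (key' ⟨t, h0, h1⟩).1 ht.2
  · have h0 : 0 ≤ t := by linarith [ht.1]
    have h1 : t ≤ 1 := by linarith [ht.2]
    simpa only [hPt t h0 h1] using (key' ⟨t, h0, h1⟩).2.1 ht.1 ht.2
  · have h0 : 0 ≤ t := by linarith [ht.1]
    have h1 : t ≤ 1 := by linarith [ht.2]
    simpa only [hPt t h0 h1] using (key' ⟨t, h0, h1⟩).2.2.1 ht.1 ht.2
  · have h0 : 0 ≤ t := by linarith [ht.1]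
    have h1 : t ≤ 1 := ht.2
    simpa only [hPt t h0 h1] using (key' ⟨t, h0, h1⟩).2.2.2 ht.1

/-- A plane curve `(x, y)` filling the right isosceles triangle with hypotenuse from `(0, 0)` to
`(1, 0)` and apex `(1/2, 1/2)`: both halves of the curve are similar to the whole curve, and fill
the two halves of the triangle. -/
structure IsTriangleCurve (x y : ℝ → ℝ) : Prop where
  continuous_fst : Continuous x
  continuous_snd : Continuous y
  fst_zero : x 0 = 0
  snd_zero : y 0 = 0
  fst_one : x 1 = 1
  snd_one : y 1 = 0
  fst_left : ∀ t ∈ Icc (0 : ℝ) (1 / 2), x t = (x (2 * t) + y (2 * t)) / 2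
  snd_left : ∀ t ∈ Icc (0 : ℝ) (1 / 2), y t = (x (2 * t) - y (2 * t)) / 2
  fst_right : ∀ t ∈ Icc (1 / 2 : ℝ) 1, x t = 1 / 2 + (x (2 * t - 1) - y (2 * t - 1)) / 2
  snd_right : ∀ t ∈ Icc (1 / 2 : ℝ) 1, y t = 1 / 2 - (x (2 * t - 1) + y (2 * t - 1)) / 2

theorem exists_isTriangleCurve : ∃ x y, IsTriangleCurve x y := by
  let P : ℝ → unitInterval := projIcc 0 1 zero_le_one
  have hP : Continuous P := continuous_projIcc
  have P0 : ∀ t ≤ 0, P t = 0 := fun t ht => projIcc_of_le_left _ ht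
  have P1 : ∀ t, 1 ≤ t → P t = 1 := fun t ht => projIcc_of_right_le _ ht
  let c : ℂ := ⟨1 / 2, 1 / 2⟩
  let d : ℂ := ⟨1 / 2, -(1 / 2)⟩
  have hcd : c + d = 1 := by apply Complex.ext <;> simp [c, d]; norm_num
  have hdc : ‖d‖ = ‖c‖ := by
    rw [← sq_eq_sq₀ (norm_nonneg _) (norm_nonneg _), Complex.sq_norm, Complex.sq_norm]
    simp [c, d, Complex.normSq_apply]
  have hc1 : ‖c‖₊ < 1 := by
    rw [← NNReal.coe_lt_coe, coe_nnnorm, NNReal.coe_one, ← sq_lt_one_iff₀ (norm_nonneg _),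
      Complex.sq_norm]
    simp only [c, Complex.normSq_apply]
    norm_num
  let Φ : C(unitInterval, ℂ) → C(unitInterval, ℂ) := fun f =>
    ⟨fun t => c * star (f (P (2 * t))) + d * star (f (P (2 * t - 1))), by fun_prop⟩
  have key : ∀ f : C(unitInterval, ℂ), f 0 = 0 → f 1 = 1 → ∀ t : unitInterval,
      ((t : ℝ) ≤ 1 / 2 → Φ f t = c * star (f (P (2 * t)))) ∧
      ((1 / 2 : ℝ) ≤ t → Φ f t = c + d * star (f (P (2 * t - 1)))) := by
    intro f f0 f1 t
    refine ⟨fun h => ?_, fun h => ?_⟩ <;> simp only [Φ, ContinuousMap.coe_mk]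
    · rw [P0 (2 * t - 1) (by linarith), f0]
      simp
    · rw [P1 (2 * t) (by linarith), f1]
      simp
  obtain ⟨f, f0, f1, hf⟩ := exists_path_fixedPoint (1 : ℂ) hc1 Φ
    (fun f f0 f1 => by
      refine ⟨?_, ?_⟩
      · rw [(key f f0 f1 0).1 (by norm_num), P0 _ (by simp), f0]; simp
      · rw [(key f f0 f1 1).2 (by norm_num), P1 _ (by norm_num), f1]; simpa using hcd)
    (fun f g f0 f1 g0 g1 t => by
      have hd : ∀ s, dist (star (f s)) (star (g s)) ≤ dist f g := fun s => by
        rw [dist_star_star]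
        exact ContinuousMap.dist_apply_le_dist s
      have hf := key f f0 f1 t
      have hg := key g g0 g1 t
      rw [coe_nnnorm]
      rcases le_total (t : ℝ) (1 / 2) with h1 | h1
      · rw [hf.1 h1, hg.1 h1, dist_eq_norm, ← mul_sub, norm_mul, ← dist_eq_norm]
        exact mul_le_mul_of_nonneg_left (hd _) (norm_nonneg _)
      · rw [hf.2 h1, hg.2 h1, dist_add_left, dist_eq_norm, ← mul_sub, norm_mul, ← dist_eq_norm,
          hdc]
        exact mul_le_mul_of_nonneg_left (hd _) (norm_nonneg _))
  have hPt : ∀ t (h0 : 0 ≤ t) (h1 : t ≤ 1), P t = ⟨t, h0, h1⟩ :=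
    fun t h0 h1 => projIcc_of_mem _ ⟨h0, h1⟩
  have key' := key f f0 f1
  rw [hf] at key'
  have hleft : ∀ t ∈ Icc (0 : ℝ) (1 / 2), f (P t) = c * star (f (P (2 * t))) := by
    intro t ht
    have h0 : 0 ≤ t := ht.1
    have h1 : t ≤ 1 := by linarith [ht.2]
    rw [hPt t h0 h1]
    exact (key' ⟨t, h0, h1⟩).1 ht.2
  have hright : ∀ t ∈ Icc (1 / 2 : ℝ) 1, f (P t) = c + d * star (f (P (2 * t - 1))) := by
    intro t ht
    have h0 : 0 ≤ t := by linarith [ht.1]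
    have h1 : t ≤ 1 := ht.2
    rw [hPt t h0 h1]
    exact (key' ⟨t, h0, h1⟩).2 ht.1
  refine ⟨fun t => (f (P t)).re, fun t => (f (P t)).im, by fun_prop, by fun_prop, ?_, ?_, ?_, ?_,
    fun t ht => ?_, fun t ht => ?_, fun t ht => ?_, fun t ht => ?_⟩
  · simp [P0 0 le_rfl, f0]
  · simp [P0 0 le_rfl, f0]
  · simp [P1 1 le_rfl, f1]
  · simp [P1 1 le_rfl, f1]
  · simp only [hleft t ht, c, Complex.mul_re, Complex.star_def, Complex.conj_re, Complex.conj_im]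
    ring
  · simp only [hleft t ht, c, Complex.mul_im, Complex.star_def, Complex.conj_re, Complex.conj_im]
    ring
  · simp only [hright t ht, c, d, Complex.add_re, Complex.mul_re, Complex.star_def,
      Complex.conj_re, Complex.conj_im]
    ring
  · simp only [hright t ht, c, d, Complex.add_im, Complex.mul_im, Complex.star_def,
      Complex.conj_re, Complex.conj_im]
    ring

theorem IsTreeCode.mem_Icc {H : ℝ → ℝ} (hH : IsTreeCode H) (t : ℝ) : H t ∈ Icc (0 : ℝ) 1 := by
  rcases le_total t 0 with h0 | h0
  · simp [hH.of_nonpos t h0]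
  rcases le_total 1 t with h1 | h1
  · simp [hH.of_one_le t h1]
  have key : ∀ t ∈ Icc (0 : ℝ) 1, ∃ b ∈ Icc (0 : ℝ) 1, H t = H b / 2 ∨ H t = 1 / 2 + H b / 2 := by
    intro t ht
    rcases le_total t (1 / 4) with h1 | h1
    · exact ⟨4 * t, ⟨by linarith [ht.1], by linarith⟩, .inl (hH.first t ⟨ht.1, h1⟩)⟩
    rcases le_total t (1 / 2) with h2 | h2
    · exact ⟨4 * t - 1, ⟨by linarith, by linarith⟩, .inr (hH.second t ⟨h1, h2⟩)⟩
    rcases le_total t (3 / 4) with h3 | h3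
    · exact ⟨3 - 4 * t, ⟨by linarith, by linarith⟩, .inr (hH.third t ⟨h2, h3⟩)⟩
    · exact ⟨4 * t - 3, ⟨by linarith, by linarith [ht.2]⟩, .inr (hH.fourth t ⟨h3, ht.2⟩)⟩
  have hc := hH.continuous
  constructor
  · refine neg_nonpos.1 (nonpos_of_le_half (S := Icc (0 : ℝ) 1) (E := fun t => -H t)
      (isCompact_Icc.image (by fun_prop)).bddAbove (fun a ha => .inr ?_) t ⟨h0, h1⟩)
    obtain ⟨b, hb, h | h⟩ := key a ha <;> exact ⟨b, hb, by simp only [h]; linarith⟩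
  · refine sub_nonpos.1 (nonpos_of_le_half (S := Icc (0 : ℝ) 1) (E := fun t => H t - 1)
      (isCompact_Icc.image (by fun_prop)).bddAbove (fun a ha => .inr ?_) t ⟨h0, h1⟩)
    obtain ⟨b, hb, h | h⟩ := key a ha <;> exact ⟨b, hb, by simp only [h]; linarith⟩

theorem IsTreeCode.half_le {H : ℝ → ℝ} (hH : IsTreeCode H) {t : ℝ} (ht : 1 / 4 ≤ t) :
    1 / 2 ≤ H t := by
  rcases le_total t (1 / 2) with h2 | h2
  · linarith [hH.second t ⟨ht, h2⟩, (hH.mem_Icc (4 * t - 1)).1]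
  rcases le_total t (3 / 4) with h3 | h3
  · linarith [hH.third t ⟨h2, h3⟩, (hH.mem_Icc (3 - 4 * t)).1]
  rcases le_total t 1 with h4 | h4
  · linarith [hH.fourth t ⟨h3, h4⟩, (hH.mem_Icc (4 * t - 3)).1]
  · linarith [hH.of_one_le t h4]

theorem IsTreeCode.nonpos_of_eq_zero {H : ℝ → ℝ} (hH : IsTreeCode H) {t : ℝ} (ht : H t = 0) :
    t ≤ 0 := by
  have hlt : ∀ t, H t = 0 → t < 1 / 4 := fun t ht => by
    by_contra! h
    linarith [hH.half_le h]
  by_contra! h0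
  refine h0.not_ge (nonpos_of_le_half (S := {t | 0 ≤ t ∧ H t = 0}) (E := id)
    ⟨1 / 4, ?_⟩ (fun a ha => .inr ⟨4 * a, ⟨by linarith [ha.1], ?_⟩, ?_⟩) t ⟨h0.le, ht⟩)
  · rintro _ ⟨a, ha, rfl⟩
    exact (hlt a ha.2).le
  · linarith [hH.first a ⟨ha.1, (hlt a ha.2).le⟩, ha.2]
  · simp only [id]
    linarith [ha.1]

theorem IsTreeCode.apply_three_fourths {H : ℝ → ℝ} (hH : IsTreeCode H) : H (3 / 4) = 1 / 2 := by
  rw [hH.fourth _ (by norm_num), hH.of_nonpos _ (by norm_num)]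
  norm_num

theorem IsTreeCode.apply_one_fourth {H : ℝ → ℝ} (hH : IsTreeCode H) : H (1 / 4) = 1 / 2 := by
  rw [hH.first _ (by norm_num), hH.of_one_le _ (by norm_num)]

/-- The times `a` after which `H` does not go below `H a` until time `1`. -/
def lastPassages (H : ℝ → ℝ) : Set ℝ := {a ∈ Icc 0 1 | ∀ r ∈ Icc a 1, H a ≤ H r}

namespace IsTriangleCurve

variable {x y : ℝ → ℝ}

theorem first (hp : IsTriangleCurve x y) {t : ℝ} (ht : t ∈ Icc (0 : ℝ) (1 / 4)) :
    x t = x (4 * t) / 2 ∧ y t = y (4 * t) / 2 := by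
  have h1 : t ∈ Icc (0 : ℝ) (1 / 2) := ⟨ht.1, by linarith [ht.2]⟩
  have h2 : 2 * t ∈ Icc (0 : ℝ) (1 / 2) := ⟨by linarith [ht.1], by linarith [ht.2]⟩
  have e : 4 * t = 2 * (2 * t) := by ring
  rw [hp.fst_left t h1, hp.snd_left t h1, hp.fst_left _ h2, hp.snd_left _ h2, e]
  constructor <;> ring

theorem second (hp : IsTriangleCurve x y) {t : ℝ} (ht : t ∈ Icc (1 / 4 : ℝ) (1 / 2)) :
    x t = 1 / 2 - y (4 * t - 1) / 2 ∧ y t = x (4 * t - 1) / 2 := by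
  have h1 : t ∈ Icc (0 : ℝ) (1 / 2) := ⟨by linarith [ht.1], ht.2⟩
  have h2 : 2 * t ∈ Icc (1 / 2 : ℝ) 1 := ⟨by linarith [ht.1], by linarith [ht.2]⟩
  have e : 4 * t - 1 = 2 * (2 * t) - 1 := by ring
  rw [hp.fst_left t h1, hp.snd_left t h1, hp.fst_right _ h2, hp.snd_right _ h2, e]
  constructor <;> ring

theorem fourth (hp : IsTriangleCurve x y) {t : ℝ} (ht : t ∈ Icc (3 / 4 : ℝ) 1) :
    x t = 1 / 2 + x (4 * t - 3) / 2 ∧ y t = y (4 * t - 3) / 2 := by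
  have h1 : t ∈ Icc (1 / 2 : ℝ) 1 := ⟨by linarith [ht.1], ht.2⟩
  have h2 : 2 * t - 1 ∈ Icc (1 / 2 : ℝ) 1 := ⟨by linarith [ht.1], by linarith [ht.2]⟩
  have e : 4 * t - 3 = 2 * (2 * t - 1) - 1 := by ring
  rw [hp.fst_right t h1, hp.snd_right t h1, hp.fst_right _ h2, hp.snd_right _ h2, e]
  constructor <;> ring

theorem reflect (hp : IsTriangleCurve x y) {t : ℝ} (ht : t ∈ Icc (0 : ℝ) 1) :
    x (1 - t) = 1 - x t ∧ y (1 - t) = y t := by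
  have hx := hp.continuous_fst
  have hy := hp.continuous_snd
  have h := nonpos_of_le_half (S := Icc (0 : ℝ) 1)
    (E := fun t => (x (1 - t) - 1 + x t) ^ 2 + (y (1 - t) - y t) ^ 2)
    (isCompact_Icc.image (by fun_prop)).bddAbove (fun a ha => .inr ?_) t ht
  · have h1 : (x (1 - t) - 1 + x t) ^ 2 = 0 := by
      nlinarith [sq_nonneg (x (1 - t) - 1 + x t), sq_nonneg (y (1 - t) - y t)]
    have h2 : (y (1 - t) - y t) ^ 2 = 0 := by
      nlinarith [sq_nonneg (x (1 - t) - 1 + x t), sq_nonneg (y (1 - t) - y t)]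
    rw [sq_eq_zero_iff] at h1 h2
    constructor <;> linarith
  · rcases le_total a (1 / 2) with h | h
    · have h1 : a ∈ Icc (0 : ℝ) (1 / 2) := ⟨ha.1, h⟩
      have h2 : 1 - a ∈ Icc (1 / 2 : ℝ) 1 := ⟨by linarith, by linarith [ha.1]⟩
      have e : 2 * (1 - a) - 1 = 1 - 2 * a := by ring
      refine ⟨2 * a, ⟨by linarith [ha.1], by linarith⟩, le_of_eq ?_⟩
      simp only [hp.fst_left a h1, hp.snd_left a h1, hp.fst_right _ h2, hp.snd_right _ h2, e]
      ring
    · have h1 : a ∈ Icc (1 / 2 : ℝ) 1 := ⟨h, ha.2⟩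
      have h2 : 1 - a ∈ Icc (0 : ℝ) (1 / 2) := ⟨by linarith [ha.2], by linarith⟩
      have e : 2 * (1 - a) = 1 - (2 * a - 1) := by ring
      refine ⟨2 * a - 1, ⟨by linarith, by linarith [ha.2]⟩, le_of_eq ?_⟩
      simp only [hp.fst_right a h1, hp.snd_right a h1, hp.fst_left _ h2, hp.snd_left _ h2, e]
      ring

theorem third (hp : IsTriangleCurve x y) {t : ℝ} (ht : t ∈ Icc (1 / 2 : ℝ) (3 / 4)) :
    x t = 1 / 2 + y (3 - 4 * t) / 2 ∧ y t = x (3 - 4 * t) / 2 := by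
  have h1 : 1 - t ∈ Icc (1 / 4 : ℝ) (1 / 2) := ⟨by linarith [ht.2], by linarith [ht.1]⟩
  have h2 := hp.reflect (t := t) ⟨by linarith [ht.1], by linarith [ht.2]⟩
  have h3 := hp.second h1
  have e : 4 * (1 - t) - 1 = 3 - 4 * t := by ring
  rw [e] at h3
  constructor
  · linarith [h2.1, h3.1]
  · linarith [h2.2, h3.2]

theorem apply_one_fourth (hp : IsTriangleCurve x y) : x (1 / 4) = 1 / 2 ∧ y (1 / 4) = 0 := by
  have h := hp.first (t := 1 / 4) (by norm_num)
  norm_num [hp.fst_one, hp.snd_one] at h ⊢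
  exact h

theorem apply_three_fourths (hp : IsTriangleCurve x y) : x (3 / 4) = 1 / 2 ∧ y (3 / 4) = 0 := by
  have h := hp.fourth (t := 3 / 4) (by norm_num)
  norm_num [hp.fst_zero, hp.snd_zero] at h ⊢
  exact h

theorem apply_half (hp : IsTriangleCurve x y) : x (1 / 2) = 1 / 2 ∧ y (1 / 2) = 1 / 2 := by
  have h := hp.fst_left (1 / 2) (by norm_num)
  have h' := hp.snd_left (1 / 2) (by norm_num)
  norm_num [hp.fst_one, hp.snd_one] at h h' ⊢
  exact ⟨h, h'⟩

variable {H : ℝ → ℝ}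

theorem of_eq_half (hp : IsTriangleCurve x y) (hH : IsTreeCode H) {t : ℝ}
    (ht : t ∈ Icc (1 / 4 : ℝ) 1) (h : H t = 1 / 2) : x t = 1 / 2 ∧ y t = 0 := by
  rcases le_total t (1 / 2) with h2 | h2
  · have := hH.nonpos_of_eq_zero (t := 4 * t - 1) (by linarith [hH.second t ⟨ht.1, h2⟩])
    rw [show t = 1 / 4 by linarith [ht.1]]
    exact hp.apply_one_fourth
  rcases le_total t (3 / 4) with h3 | h3
  · have := hH.nonpos_of_eq_zero (t := 3 - 4 * t) (by linarith [hH.third t ⟨h2, h3⟩])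
    rw [show t = 3 / 4 by linarith]
    exact hp.apply_three_fourths
  · have := hH.nonpos_of_eq_zero (t := 4 * t - 3) (by linarith [hH.fourth t ⟨h3, ht.2⟩])
    rw [show t = 3 / 4 by linarith]
    exact hp.apply_three_fourths

/-- At a last passage time the curve is on the hypotenuse of the triangle. -/
theorem of_mem_lastPassages (hp : IsTriangleCurve x y) (hH : IsTreeCode H) {a : ℝ}
    (ha : a ∈ lastPassages H) : x a = H a ∧ y a = 0 := by
  have hx := hp.continuous_fst
  have hy := hp.continuous_snd
  have hc := hH.continuous
  have h := nonpos_of_le_half (S := lastPassages H) (E := fun t => |x t - H t| + |y t|)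
    ((isCompact_Icc.image (by fun_prop : Continuous fun t => |x t - H t| + |y t|)).bddAbove.mono
      (image_mono fun _ h => h.1)) (fun a ha => ?_) a ha
  · have h1 : |x a - H a| = 0 := by linarith [abs_nonneg (x a - H a), abs_nonneg (y a)]
    have h2 : |y a| = 0 := by linarith [abs_nonneg (x a - H a), abs_nonneg (y a)]
    exact ⟨sub_eq_zero.1 (abs_eq_zero.1 h1), abs_eq_zero.1 h2⟩
  · obtain ⟨⟨ha0, ha1⟩, hl⟩ := ha
    rcases le_total a (1 / 4) with h1 | h1
    · refine .inr ⟨4 * a, ⟨⟨by linarith, by linarith⟩, fun r hr => ?_⟩, le_of_eq ?_⟩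
      · have hr' : r / 4 ∈ Icc (0 : ℝ) (1 / 4) := ⟨by linarith [hr.1], by linarith [hr.2]⟩
        have h2 := hl (r / 4) ⟨by linarith [hr.1], by linarith [hr.2]⟩
        rw [hH.first a ⟨ha0, h1⟩, hH.first _ hr', mul_div_cancel₀ r four_ne_zero] at h2
        linarith
      · simp only [hp.first ⟨ha0, h1⟩, hH.first a ⟨ha0, h1⟩]
        rw [← sub_div, abs_div, abs_div, abs_two]
        ring
    rcases le_total a (3 / 4) with h2 | h2
    · have h3 : H a = 1 / 2 :=
        le_antisymm (hH.apply_three_fourths ▸ hl _ ⟨h2, by norm_num⟩) (hH.half_le h1)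
      obtain ⟨h4, h5⟩ := hp.of_eq_half hH ⟨h1, ha1⟩ h3
      left
      simp [h3, h4, h5]
    · refine .inr ⟨4 * a - 3, ⟨⟨by linarith, by linarith⟩, fun r hr => ?_⟩, le_of_eq ?_⟩
      · have hr' : (r + 3) / 4 ∈ Icc (3 / 4 : ℝ) 1 := ⟨by linarith [hr.1], by linarith [hr.2]⟩
        have h3 := hl ((r + 3) / 4) ⟨by linarith [hr.1], by linarith [hr.2]⟩
        rw [hH.fourth a ⟨h2, ha1⟩, hH.fourth _ hr', mul_div_cancel₀ _ four_ne_zero,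
          add_sub_cancel_right] at h3
        linarith
      · simp only [hp.fourth ⟨h2, ha1⟩, hH.fourth a ⟨h2, ha1⟩, add_sub_add_left_eq_sub]
        rw [← sub_div, abs_div, abs_div, abs_two]
        ring

/-- The curve takes the same value at two times which are identified in the tree coded by `H`. -/
theorem eq_of_code_eq (hp : IsTriangleCurve x y) (hH : IsTreeCode H) {s t : ℝ} (hs : 0 ≤ s)
    (hst : s ≤ t) (ht : t ≤ 1) (h : H s = H t) (hr : ∀ r ∈ Icc s t, H s ≤ H r) :
    x s = x t ∧ y s = y t := by
  have hx := hp.continuous_fst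
  have hy := hp.continuous_snd
  let S : Set (ℝ × ℝ) := {q | 0 ≤ q.1 ∧ q.1 ≤ q.2 ∧ q.2 ≤ 1 ∧ H q.1 = H q.2 ∧
    ∀ r ∈ Icc q.1 q.2, H q.1 ≤ H r}
  let E : ℝ × ℝ → ℝ := fun q => |x q.1 - x q.2| + |y q.1 - y q.2|
  have hE : Continuous E := by fun_prop
  have h := nonpos_of_le_half (S := S) (E := E)
    (((isCompact_Icc.prod isCompact_Icc).image hE).bddAbove.mono (image_mono fun q hq =>
      show q ∈ Icc (0 : ℝ) 1 ×ˢ Icc (0 : ℝ) 1 from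
        ⟨⟨hq.1, hq.2.1.trans hq.2.2.1⟩, ⟨hq.1.trans hq.2.1, hq.2.2.1⟩⟩)) ?_ (s, t)
    ⟨hs, hst, ht, h, hr⟩
  · have h1 : |x s - x t| = 0 := by
      linarith [abs_nonneg (x s - x t), abs_nonneg (y s - y t), show E (s, t) = _ from rfl]
    have h2 : |y s - y t| = 0 := by
      linarith [abs_nonneg (x s - x t), abs_nonneg (y s - y t), show E (s, t) = _ from rfl]
    exact ⟨sub_eq_zero.1 (abs_eq_zero.1 h1), sub_eq_zero.1 (abs_eq_zero.1 h2)⟩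
  clear! s t
  rintro ⟨s, t⟩ ⟨hs, hst, ht, h, hr⟩
  dsimp only at hs hst ht h hr
  have hz : x s = x t → y s = y t → E (s, t) ≤ 0 := fun h1 h2 => by simp [E, h1, h2]
  rcases le_total s (1 / 4) with s1 | s1
  · rcases le_total t (1 / 4) with t1 | t1
    · refine .inr ⟨(4 * s, 4 * t), ⟨by linarith, by linarith, by linarith, ?_,
        fun r hr' => ?_⟩, le_of_eq ?_⟩
      · dsimp only
        linarith [hH.first s ⟨hs, s1⟩, hH.first t ⟨by linarith, t1⟩]
      · dsimp only at hr' ⊢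
        have h2 := hr (r / 4) ⟨by linarith [hr'.1], by linarith [hr'.2]⟩
        rw [hH.first s ⟨hs, s1⟩, hH.first (r / 4) ⟨by linarith [hr'.1], by linarith [hr'.2]⟩,
          mul_div_cancel₀ r four_ne_zero] at h2
        linarith
      · simp only [E, hp.first ⟨hs, s1⟩, hp.first ⟨hs.trans hst, t1⟩]
        rw [← sub_div, ← sub_div, abs_div, abs_div, abs_two]
        ring
    · left
      have h1 : H s = 1 / 2 := le_antisymm (hH.apply_one_fourth ▸ hr _ ⟨s1, t1⟩)
        (h ▸ hH.half_le t1)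
      have h2 : H (4 * s) = 1 := by linarith [hH.first s ⟨hs, s1⟩]
      have h3 : 4 * s ∈ lastPassages H := by
        refine ⟨⟨by linarith, by linarith⟩, fun r hr' => ?_⟩
        have h4 := hr (r / 4) ⟨by linarith [hr'.1], by linarith [hr'.2]⟩
        rw [hH.first (r / 4) ⟨by linarith [hr'.1], by linarith [hr'.2]⟩,
          mul_div_cancel₀ r four_ne_zero] at h4
        linarith
      have h4 := hp.of_mem_lastPassages hH h3
      have h5 := hp.first ⟨hs, s1⟩
      have h6 := hp.of_eq_half hH ⟨t1, ht⟩ (h ▸ h1)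
      apply hz <;> linarith [h4.1, h4.2, h5.1, h5.2, h6.1, h6.2]
  rcases le_total (3 / 4) s with s3 | s3
  · have t3 : 3 / 4 ≤ t := s3.trans hst
    refine .inr ⟨(4 * s - 3, 4 * t - 3), ⟨by linarith, by linarith, by linarith, ?_,
      fun r hr' => ?_⟩, le_of_eq ?_⟩
    · dsimp only
      linarith [hH.fourth s ⟨s3, by linarith⟩, hH.fourth t ⟨t3, ht⟩]
    · dsimp only at hr' ⊢
      have h2 := hr ((r + 3) / 4) ⟨by linarith [hr'.1], by linarith [hr'.2]⟩
      rw [hH.fourth s ⟨s3, by linarith⟩,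
        hH.fourth ((r + 3) / 4) ⟨by linarith [hr'.1], by linarith [hr'.2]⟩,
        mul_div_cancel₀ _ four_ne_zero, add_sub_cancel_right] at h2
      linarith
    · simp only [E, hp.fourth ⟨s3, hst.trans ht⟩, hp.fourth ⟨t3, ht⟩, add_sub_add_left_eq_sub]
      rw [← sub_div, ← sub_div, abs_div, abs_div, abs_two]
      ring
  rcases le_total (3 / 4) t with t3 | t3
  · left
    have h1 : H s = 1 / 2 := le_antisymm (hH.apply_three_fourths ▸ hr _ ⟨s3, t3⟩) (hH.half_le s1)
    have h2 := hp.of_eq_half hH ⟨s1, hst.trans ht⟩ h1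
    have h3 := hp.of_eq_half hH ⟨s1.trans hst, ht⟩ (h ▸ h1)
    exact hz (h2.1.trans h3.1.symm) (h2.2.trans h3.2.symm)
  have hsec : ∀ r, 0 ≤ r → r ≤ 1 → H ((r + 1) / 4) = 1 / 2 + H r / 2 := fun r h0 h1 => by
    rw [hH.second _ ⟨by linarith, by linarith⟩, mul_div_cancel₀ _ four_ne_zero,
      add_sub_cancel_right]
  have hthi : ∀ r, 0 ≤ r → r ≤ 1 → H ((3 - r) / 4) = 1 / 2 + H r / 2 := fun r h0 h1 => by
    rw [hH.third _ ⟨by linarith, by linarith⟩, mul_div_cancel₀ _ four_ne_zero, sub_sub_cancel]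
  rcases le_total s (1 / 2) with s2 | s2
  · have hs2 := hH.second s ⟨s1, s2⟩
    have ps2 := hp.second ⟨s1, s2⟩
    rcases le_total t (1 / 2) with t2 | t2
    · have ht2 := hH.second t ⟨by linarith, t2⟩
      have pt2 := hp.second ⟨s1.trans hst, t2⟩
      refine .inr ⟨(4 * s - 1, 4 * t - 1), ⟨by linarith, by linarith, by linarith, ?_,
        fun r hr' => ?_⟩, le_of_eq ?_⟩
      · dsimp only
        linarith
      · dsimp only at hr' ⊢
        have h2 := hr ((r + 1) / 4) ⟨by linarith [hr'.1], by linarith [hr'.2]⟩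
        rw [hsec r (by linarith [hr'.1]) (by linarith [hr'.2])] at h2
        linarith
      · simp only [E, ps2, pt2, sub_sub_sub_cancel_left]
        rw [← sub_div, ← sub_div, abs_div, abs_div, abs_two, abs_sub_comm (y _)]
        ring
    · have ht2 := hH.third t ⟨t2, t3⟩
      have pt2 := hp.third ⟨t2, t3⟩
      have h1 : 4 * s - 1 ∈ lastPassages H := by
        refine ⟨⟨by linarith, by linarith⟩, fun r hr' => ?_⟩
        have h2 := hr ((r + 1) / 4) ⟨by linarith [hr'.1], by linarith [hr'.2]⟩
        rw [hsec r (by linarith [hr'.1]) (by linarith [hr'.2])] at h2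
        linarith
      have h2 : 3 - 4 * t ∈ lastPassages H := by
        refine ⟨⟨by linarith, by linarith⟩, fun r hr' => ?_⟩
        have h2 := hr ((3 - r) / 4) ⟨by linarith [hr'.2], by linarith [hr'.1]⟩
        rw [hthi r (by linarith [hr'.1]) (by linarith [hr'.2])] at h2
        linarith
      have h3 := hp.of_mem_lastPassages hH h1
      have h4 := hp.of_mem_lastPassages hH h2
      left
      apply hz <;> linarith [h3.1, h3.2, h4.1, h4.2, ps2.1, ps2.2, pt2.1, pt2.2]
  · have hs2 := hH.third s ⟨s2, s3⟩
    have ps2 := hp.third ⟨s2, s3⟩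
    have ht2 := hH.third t ⟨s2.trans hst, t3⟩
    have pt2 := hp.third ⟨s2.trans hst, t3⟩
    refine .inr ⟨(3 - 4 * t, 3 - 4 * s), ⟨by linarith, by linarith, by linarith, ?_,
      fun r hr' => ?_⟩, le_of_eq ?_⟩
    · dsimp only
      linarith
    · dsimp only at hr' ⊢
      have h2 := hr ((3 - r) / 4) ⟨by linarith [hr'.2], by linarith [hr'.1]⟩
      rw [hthi r (by linarith [hr'.1]) (by linarith [hr'.2])] at h2
      linarith
    · simp only [E, ps2, pt2, add_sub_add_left_eq_sub]
      rw [← sub_div, ← sub_div, abs_div, abs_div, abs_two, abs_sub_comm (y _), abs_sub_comm (x _)]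
      ring

end IsTriangleCurve

/-- Composing a path with a self-map of the interval fixing the endpoints is the inverse of a
reduction. -/
theorem GeodesicReduction.comp_left {X : Type*} [TopologicalSpace X] {α : unitInterval → X}
    (hα : Continuous α) {φ : unitInterval → unitInterval} (hφ : Continuous φ) (h0 : φ 0 = 0)
    (h1 : φ 1 = 1) : GeodesicReduction (α ∘ φ) α :=
  GeodesicReduction.of_code (h := ⟨fun t => (φ t : ℝ), by fun_prop⟩) (hα.comp hφ) (by simp [h0])
    (by simp [h1]) (fun r => (φ r).2.1)
    (fun s t _ h _ => congrArg α (Subtype.ext h)) (fun a u h _ => congrArg α (Subtype.ext h))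

namespace IsTriangleCurve

variable {x y H : ℝ → ℝ} {X : Type*} [TopologicalSpace X] {G : ℝ × ℝ → X}

theorem geodesicReduction_hypotenuse (hp : IsTriangleCurve x y) (hH : IsTreeCode H)
    (hG : Continuous G) :
    GeodesicReduction (fun t : unitInterval => G (x t, y t)) (fun u => G (u, 0)) := by
  have hx := hp.continuous_fst
  have hy := hp.continuous_snd
  have hc := hH.continuous
  refine GeodesicReduction.of_code (h := ⟨fun t => H t, by fun_prop⟩) (by fun_prop)
    (hH.of_nonpos _ le_rfl) (hH.of_one_le _ le_rfl) (fun r => (hH.mem_Icc r).1) ?_ ?_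
  · intro s t hst h hr
    obtain ⟨h1, h2⟩ := hp.eq_of_code_eq hH s.2.1 hst t.2.2 h fun r hr' =>
      hr ⟨r, s.2.1.trans hr'.1, hr'.2.trans t.2.2⟩ hr'
    simp only [h1, h2]
  · intro a u h hr
    obtain ⟨h1, h2⟩ := hp.of_mem_lastPassages hH (a := a) ⟨a.2, fun r hr' =>
      hr ⟨r, a.2.1.trans hr'.1, hr'.2⟩ hr'.1⟩
    simp only [h1, h2]
    exact congrArg (fun v => G (v, 0)) h

theorem geodesicReduction_legs (hp : IsTriangleCurve x y) (hH : IsTreeCode H)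
    (hG : Continuous G) :
    GeodesicReduction (fun t : unitInterval => G (x t, y t))
      (fun u => G (u, min (u : ℝ) (1 - u))) := by
  have hx := hp.continuous_fst
  have hy := hp.continuous_snd
  have hc := hH.continuous
  let k : ℝ → ℝ := fun t => (H (2 * t) + H (2 * t - 1)) / 2
  have hkl : ∀ t ≤ 1 / 2, k t = H (2 * t) / 2 := fun t ht => by
    simp only [k, hH.of_nonpos (2 * t - 1) (by linarith), add_zero]
  have hkr : ∀ t, 1 / 2 ≤ t → k t = 1 / 2 + H (2 * t - 1) / 2 := fun t ht => by
    simp only [k, hH.of_one_le (2 * t) (by linarith)]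
    ring
  have hkl' : ∀ t ≤ 1, k (t / 2) = H t / 2 := fun t ht => by
    rw [hkl _ (by linarith), mul_div_cancel₀ t two_ne_zero]
  have hkr' : ∀ t, 0 ≤ t → k ((t + 1) / 2) = 1 / 2 + H t / 2 := fun t ht => by
    rw [hkr _ (by linarith), mul_div_cancel₀ _ two_ne_zero, add_sub_cancel_right]
  have hle : ∀ t ≤ 1 / 2, k t ≤ 1 / 2 := fun t ht => by
    linarith [hkl t ht, (hH.mem_Icc (2 * t)).2]
  have hge : ∀ t, 1 / 2 ≤ t → 1 / 2 ≤ k t := fun t ht => by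
    linarith [hkr t ht, (hH.mem_Icc (2 * t - 1)).1]
  refine GeodesicReduction.of_code (h := ⟨fun t => k t, by fun_prop⟩) (by fun_prop) ?_ ?_ ?_ ?_ ?_
  · simp [k, hH.of_nonpos]
  · norm_num [k, hH.of_one_le]
  · intro r
    have h1 := (hH.mem_Icc (2 * r)).1
    have h2 := (hH.mem_Icc (2 * r - 1)).1
    simp only [ContinuousMap.coe_mk, k]
    positivity
  · rintro ⟨s, hs0, hs1⟩ ⟨t, ht0, ht1⟩ hst h hr
    simp only [ContinuousMap.coe_mk] at h
    replace hst : s ≤ t := hst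
    replace hr : ∀ r ∈ Icc s t, k s ≤ k r := fun r hr' =>
      hr ⟨r, hs0.trans hr'.1, hr'.2.trans ht1⟩ hr'
    suffices x s = x t ∧ y s = y t by simp only [this]
    rcases le_total t (1 / 2) with t1 | t1
    · have s1 := hst.trans t1
      have h1 := hp.eq_of_code_eq hH (s := 2 * s) (t := 2 * t) (by linarith) (by linarith)
        (by linarith) (by linarith [hkl s s1, hkl t t1]) fun r hr' => by
          have := hr (r / 2) ⟨by linarith [hr'.1], by linarith [hr'.2]⟩
          rw [hkl s s1, hkl' r (by linarith [hr'.2])] at this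
          linarith
      rw [hp.fst_left s ⟨hs0, s1⟩, hp.snd_left s ⟨hs0, s1⟩, hp.fst_left t ⟨ht0, t1⟩,
        hp.snd_left t ⟨ht0, t1⟩, h1.1, h1.2]
      exact ⟨rfl, rfl⟩
    rcases le_total (1 / 2) s with s1 | s1
    · have h1 := hp.eq_of_code_eq hH (s := 2 * s - 1) (t := 2 * t - 1) (by linarith)
        (by linarith) (by linarith) (by linarith [hkr s s1, hkr t t1]) fun r hr' => by
          have := hr ((r + 1) / 2) ⟨by linarith [hr'.1], by linarith [hr'.2]⟩
          rw [hkr s s1, hkr' r (by linarith [hr'.1])] at this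
          linarith
      rw [hp.fst_right s ⟨s1, hs1⟩, hp.snd_right s ⟨s1, hs1⟩, hp.fst_right t ⟨t1, ht1⟩,
        hp.snd_right t ⟨t1, ht1⟩, h1.1, h1.2]
      exact ⟨rfl, rfl⟩
    · have hks : k s = 1 / 2 := le_antisymm (hle s s1) (h ▸ hge t t1)
      have h1 := hp.of_mem_lastPassages hH (a := 2 * s)
        ⟨⟨by linarith, by linarith⟩, fun r hr' => by
          have := hr (r / 2) ⟨by linarith [hr'.1], by linarith [hr'.2]⟩
          rw [hkl s s1, hkl' r hr'.2] at this
          linarith⟩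
      have h2 : t = 1 / 2 := by
        linarith [hH.nonpos_of_eq_zero (t := 2 * t - 1) (by linarith [hkr t t1])]
      rw [h2, hp.apply_half.1, hp.apply_half.2, hp.fst_left s ⟨hs0, s1⟩, hp.snd_left s ⟨hs0, s1⟩]
      constructor <;> linarith [h1.1, h1.2, hkl s s1]
  · rintro ⟨a, ha0, ha1⟩ ⟨u, hu⟩ h hr
    simp only [ContinuousMap.coe_mk] at h
    replace hr : ∀ r ∈ Icc a 1, k a ≤ k r := fun r hr' => hr ⟨r, ha0.trans hr'.1, hr'.2⟩ hr'.1
    suffices x a = u ∧ y a = min u (1 - u) by simp only [this]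
    rcases le_total a (1 / 2) with a1 | a1
    · have h1 := hp.of_mem_lastPassages hH (a := 2 * a)
        ⟨⟨by linarith, by linarith⟩, fun r hr' => by
          have := hr (r / 2) ⟨by linarith [hr'.1], by linarith [hr'.2]⟩
          rw [hkl a a1, hkl' r hr'.2] at this
          linarith⟩
      rw [min_eq_left (by linarith [hle a a1]), hp.fst_left a ⟨ha0, a1⟩,
        hp.snd_left a ⟨ha0, a1⟩]
      constructor <;> linarith [h1.1, h1.2, hkl a a1]
    · have h1 := hp.of_mem_lastPassages hH (a := 2 * a - 1)
        ⟨⟨by linarith, by linarith⟩, fun r hr' => by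
          have := hr ((r + 1) / 2) ⟨by linarith [hr'.1], by linarith [hr'.2]⟩
          rw [hkr a a1, hkr' r (by linarith [hr'.1])] at this
          linarith⟩
      rw [min_eq_right (by linarith [hge a a1]), hp.fst_right a ⟨a1, ha1⟩,
        hp.snd_right a ⟨a1, ha1⟩]
      constructor <;> linarith [h1.1, h1.2, hkr a a1]

end IsTriangleCurve

end TriangleCurve

/-- The restrictions of a map of the plane to the legs and to the hypotenuse of the standard right
isosceles triangle are related by the equivalence relation generated by reduction. -/
theorem eqvGen_hypotenuse_legs {X : Type*} [TopologicalSpace X] {G : ℝ × ℝ → X}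
    (hG : Continuous G) {δ γ : C(unitInterval, X)} (hδ : ∀ u : unitInterval, δ u = G (u, 0))
    (hγ : ∀ u : unitInterval, γ u = G (u, min (u : ℝ) (1 - u))) :
    Relation.EqvGen (fun a b : C(unitInterval, X) => GeodesicReduction ⇑a ⇑b) γ δ := by
  obtain ⟨x, y, hp⟩ := exists_isTriangleCurve
  obtain ⟨H, hH⟩ := exists_isTreeCode
  have hx := hp.continuous_fst
  have hy := hp.continuous_snd
  let π : C(unitInterval, X) := ⟨fun t => G (x t, y t), by fun_prop⟩
  have h1 : GeodesicReduction π δ := by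
    rw [show ⇑δ = _ from funext hδ]
    exact hp.geodesicReduction_hypotenuse hH hG
  have h2 : GeodesicReduction π γ := by
    rw [show ⇑γ = _ from funext hγ]
    exact hp.geodesicReduction_legs hH hG
  exact .trans _ π _ (.symm _ _ (.rel _ _ h2)) (.rel _ _ h1)

/-- The equivalence relation generated by geodesic ℝ-tree reduction coincides with
path-homotopy rel endpoints. -/
theorem eqvGen_geodesicReduction_iff_homotopic {X : Type*} [TopologicalSpace X] [T2Space X]
    (α β : C(unitInterval, X)) :
    Relation.EqvGen (fun a b : C(unitInterval, X) => GeodesicReduction ⇑a ⇑b) α β ↔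
      α.HomotopicRel β {0, 1} := by
  constructor
  · intro h
    induction h with
    | rel a b h => exact h.homotopicRel
    | refl a => exact .refl a
    | symm a b _ h => exact h.symm
    | trans a b c _ _ h1 h2 => exact h1.trans h2
  · rintro ⟨F⟩
    let P : ℝ → unitInterval := projIcc 0 1 zero_le_one
    have hP : Continuous P := continuous_projIcc
    have P0 : ∀ t ≤ 0, P t = 0 := fun t ht => projIcc_of_le_left _ ht
    have P1 : ∀ t, 1 ≤ t → P t = 1 := fun t ht => projIcc_of_right_le _ ht
    have hPu : ∀ u : unitInterval, P u = u := fun u => projIcc_val _ u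
    have F0 : ∀ t, F (t, 0) = α 0 := fun t => F.eq_fst t (by simp)
    have F1 : ∀ t, F (t, 1) = β 1 := fun t => F.eq_snd t (by simp)
    let l : C(unitInterval, unitInterval) := ⟨fun u => P (2 * u), by fun_prop⟩
    let r : C(unitInterval, unitInterval) := ⟨fun u => P (2 * u - 1), by fun_prop⟩
    let δ : C(unitInterval, X) := ⟨fun u => F (u, u), by fun_prop⟩
    have hl : GeodesicReduction (α.comp l) α := GeodesicReduction.comp_left α.continuous
      l.continuous (P0 _ (by simp)) (P1 _ (by norm_num))
    have hr : GeodesicReduction (β.comp r) β := GeodesicReduction.comp_left β.continuous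
      r.continuous (P0 _ (by simp)) (P1 _ (by norm_num))
    have h1 := eqvGen_hypotenuse_legs (G := fun q => F (P (q.1 - q.2), P (q.1 + q.2)))
      (by fun_prop) (δ := δ) (γ := α.comp l) (fun u => by simp [δ, hPu]) fun u => by
        rcases le_total (u : ℝ) (1 / 2) with h | h
        · simp only [min_eq_left (show (u : ℝ) ≤ 1 - u by linarith), sub_self,
            P0 0 le_rfl, ← two_mul]
          exact (F.apply_zero _).symm
        · have h2 : α (P (2 * u)) = β 1 := by
            rw [P1 _ (by linarith), ← F.apply_zero, F1]
          simp only [min_eq_right (show 1 - (u : ℝ) ≤ u by linarith), add_sub_cancel,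
            P1 1 le_rfl, F1]
          exact h2
    have h2 := eqvGen_hypotenuse_legs (G := fun q => F (P (q.1 + q.2), P (q.1 - q.2)))
      (by fun_prop) (δ := δ) (γ := β.comp r) (fun u => by simp [δ, hPu]) fun u => by
        rcases le_total (u : ℝ) (1 / 2) with h | h
        · have h2 : β (P (2 * u - 1)) = α 0 := by
            rw [P0 _ (by linarith), ← F.apply_one, F0]
          simp only [min_eq_left (show (u : ℝ) ≤ 1 - u by linarith), sub_self, P0 0 le_rfl, F0]
          exact h2
        · simp only [min_eq_right (show 1 - (u : ℝ) ≤ u by linarith), add_sub_cancel,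
            P1 1 le_rfl, show (u : ℝ) - (1 - u) = 2 * u - 1 by ring]
          exact (F.apply_one _).symm
    exact .trans _ _ _ (.symm _ _ (.rel _ _ hl))
      (.trans _ _ _ h1 (.trans _ _ _ (.symm _ _ h2) (.rel _ _ hr)))
end

section
/- Let p : E → X be a continuous map of Hausdorff topological spaces with e₀ ∈ E, x₀ = p(e₀), which lifts all paths uniquely rel. starting point, and let T be an ℝ-tree with a point t₀ ∈ T. If f : T → X is a continuous map with f(t₀) = x₀, then there exists a unique continuous map f̃ : T → E with f̃(t₀) = e₀ and p ∘ f̃ = f. -/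
open Set Filter Topology

/-- Lifting of paths parametrized by `[0, d]` along a map lifting all paths uniquely. -/
theorem LiftsPathsUniquely.exists_lift_Icc {E X : Type*} [TopologicalSpace E]
    [TopologicalSpace X] {p : E → X} (hlift : LiftsPathsUniquely p) {d : ℝ} (hd : 0 ≤ d)
    {α : ℝ → X} (hα : ContinuousOn α (Icc 0 d)) {e : E} (he : p e = α 0) :
    ∃ β : ℝ → E, Continuous β ∧ β 0 = e ∧ ∀ x ∈ Icc 0 d, p (β x) = α x := by
  rcases hd.eq_or_lt with rfl | hd'
  · refine ⟨fun _ => e, continuous_const, rfl, fun x hx => ?_⟩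
    rw [Icc_self, mem_singleton_iff] at hx
    rw [hx, he]
  have hmaps : ∀ s : unitInterval, d * (s : ℝ) ∈ Icc 0 d := fun s =>
    ⟨mul_nonneg hd s.2.1, mul_le_of_le_one_right hd s.2.2⟩
  obtain ⟨l, ⟨hl, hl0, hpl⟩, -⟩ := hlift (fun s => α (d * s))
    (hα.comp_continuous (by fun_prop) hmaps) e (by simpa using he)
  refine ⟨fun x => l (projIcc 0 1 zero_le_one (x / d)),
    hl.comp (continuous_projIcc.comp (by fun_prop)), ?_, fun x hx => ?_⟩
  · simp only [zero_div, projIcc_left]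
    exact hl0
  · have hx' : x / d ∈ Icc (0 : ℝ) 1 :=
      ⟨div_nonneg hx.1 hd, div_le_one_of_le₀ hx.2 hd⟩
    have := congrFun hpl (projIcc 0 1 zero_le_one (x / d))
    simp only [Function.comp_apply] at this
    rw [this, projIcc_of_mem _ hx']
    simp only
    rw [mul_div_cancel₀ x hd'.ne']

/-- Two lifts of the same path on `[0, d]` with the same starting point agree. -/
theorem LiftsPathsUniquely.eqOn_Icc {E X : Type*} [TopologicalSpace E]
    [TopologicalSpace X] {p : E → X} (hlift : LiftsPathsUniquely p) (hp : Continuous p)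
    {d : ℝ} {β β' : ℝ → E} (hβ : ContinuousOn β (Icc 0 d)) (hβ' : ContinuousOn β' (Icc 0 d))
    (h0 : β 0 = β' 0) (h : ∀ x ∈ Icc 0 d, p (β x) = p (β' x)) : EqOn β β' (Icc 0 d) := by
  intro x hx
  have hd : 0 ≤ d := hx.1.trans hx.2
  rcases hd.eq_or_lt with rfl | hd'
  · rw [Icc_self, mem_singleton_iff] at hx
    rw [hx, h0]
  have hmaps : ∀ s : unitInterval, d * (s : ℝ) ∈ Icc 0 d := fun s =>
    ⟨mul_nonneg hd s.2.1, mul_le_of_le_one_right hd s.2.2⟩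
  have hc := hβ.comp_continuous (f := fun s : unitInterval => d * (s : ℝ)) (by fun_prop) hmaps
  have hc' := hβ'.comp_continuous (f := fun s : unitInterval => d * (s : ℝ)) (by fun_prop) hmaps
  have key := (hlift (fun s => p (β (d * s))) (hp.comp hc) (β 0) (by simp)).unique
    (y₁ := fun s => β (d * s)) (y₂ := fun s => β' (d * s))
    ⟨hc, by simp, rfl⟩ ⟨hc', by simp [h0], funext fun s => (h _ (hmaps s)).symm⟩
  have := congrFun key ⟨x / d, div_nonneg hx.1 hd, div_le_one_of_le₀ hx.2 hd⟩
  simpa only [mul_div_cancel₀ x hd'.ne'] using this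

/-- `g` is a geodesic from `x` to `y`, parametrized by arc length on `[0, dist x y]`. -/
structure IsGeodesicFrom {T : Type*} [MetricSpace T] (g : ℝ → T) (x y : T) : Prop where
  continuous : Continuous g
  map_zero : g 0 = x
  map_dist : g (dist x y) = y
  dist_eq : ∀ s ∈ Icc (0 : ℝ) (dist x y), ∀ t ∈ Icc (0 : ℝ) (dist x y),
    dist (g s) (g t) = |s - t|

namespace IsGeodesicFrom

variable {T : Type*} [MetricSpace T] {g : ℝ → T} {x y : T}

theorem dist_left (hg : IsGeodesicFrom g x y) {s : ℝ} (hs : s ∈ Icc 0 (dist x y)) :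
    dist x (g s) = s := by
  have := hg.dist_eq 0 (left_mem_Icc.2 dist_nonneg) s hs
  rwa [hg.map_zero, zero_sub, abs_neg, abs_of_nonneg hs.1] at this

theorem injOn (hg : IsGeodesicFrom g x y) : InjOn g (Icc 0 (dist x y)) := by
  intro s hs t ht h
  rw [← hg.dist_left hs, h, hg.dist_left ht]

theorem restrict (hg : IsGeodesicFrom g x y) {s : ℝ} (hs : s ∈ Icc 0 (dist x y)) :
    IsGeodesicFrom g x (g s) where
  continuous := hg.continuous
  map_zero := hg.map_zero
  map_dist := by rw [hg.dist_left hs]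
  dist_eq a ha b hb := by
    rw [hg.dist_left hs] at ha hb
    exact hg.dist_eq a ⟨ha.1, ha.2.trans hs.2⟩ b ⟨hb.1, hb.2.trans hs.2⟩

end IsGeodesicFrom

namespace IsRTree

variable {T : Type} [MetricSpace T]

theorem exists_isGeodesicFrom (hT : IsRTree T) (x y : T) : ∃ g, IsGeodesicFrom g x y := by
  obtain ⟨γ, h0, h1, h⟩ := hT.geodesic x y
  have hγ : ContinuousOn γ (Icc 0 (dist x y)) := by
    refine (LipschitzOnWith.of_dist_le_mul (K := 1) fun s hs t ht => ?_).continuousOn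
    rw [h s hs t ht, NNReal.coe_one, one_mul, Real.dist_eq]
  have hproj : ∀ s ∈ Icc 0 (dist x y), IccExtend dist_nonneg ((Icc 0 (dist x y)).domRestrict γ) s
      = γ s := fun s hs => IccExtend_of_mem _ _ hs
  refine ⟨IccExtend dist_nonneg ((Icc 0 (dist x y)).domRestrict γ),
    hγ.domRestrict.Icc_extend', ?_, ?_,
    fun s hs t ht => ?_⟩
  · rw [hproj _ (left_mem_Icc.2 dist_nonneg), h0]
  · rw [hproj _ (right_mem_Icc.2 dist_nonneg), h1]
  · rw [hproj s hs, hproj t ht, h s hs t ht]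

/-- Arcs in an ℝ-tree with the same endpoints have the same image. -/
theorem image_Icc_eq (hT : IsRTree T) {a b : ℝ} (ha : 0 ≤ a) (hb : 0 ≤ b) {h k : ℝ → T}
    (hh : ContinuousOn h (Icc 0 a)) (hk : ContinuousOn k (Icc 0 b)) (ih : InjOn h (Icc 0 a))
    (ik : InjOn k (Icc 0 b)) (h0 : h 0 = k 0) (h1 : h a = k b) :
    h '' Icc 0 a = k '' Icc 0 b := by
  rcases ha.eq_or_lt with rfl | ha'
  · obtain rfl : (0 : ℝ) = b := ik (left_mem_Icc.2 hb) (right_mem_Icc.2 hb) (h0.symm.trans h1)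
    simp [h0]
  rcases hb.eq_or_lt with rfl | hb'
  · exact absurd (ih (left_mem_Icc.2 ha) (right_mem_Icc.2 ha) (h0.trans h1.symm)) ha'.ne
  have maps : ∀ c : ℝ, 0 ≤ c → ∀ s : unitInterval, c * (s : ℝ) ∈ Icc 0 c := fun c hc s =>
    ⟨mul_nonneg hc s.2.1, mul_le_of_le_one_right hc s.2.2⟩
  have inj : ∀ c : ℝ, 0 < c → ∀ m : ℝ → T, InjOn m (Icc 0 c) →
      Function.Injective fun s : unitInterval => m (c * s) := fun c hc m hm s t hst =>
    Subtype.ext (mul_left_cancel₀ hc.ne' (hm (maps c hc.le s) (maps c hc.le t) hst))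
  have rng : ∀ c : ℝ, 0 < c → ∀ m : ℝ → T,
      range (fun s : unitInterval => m (c * s)) = m '' Icc 0 c := by
    intro c hc m
    ext z
    constructor
    · rintro ⟨s, rfl⟩
      exact ⟨_, maps c hc.le s, rfl⟩
    · rintro ⟨s, hs, rfl⟩
      exact ⟨⟨s / c, div_nonneg hs.1 hc.le, div_le_one_of_le₀ hs.2 hc.le⟩,
        congrArg m (mul_div_cancel₀ s hc.ne')⟩
  have := hT.uniquelyArcwise (fun s => h (a * s)) (fun s => k (b * s))
    (hh.comp_continuous (by fun_prop) (maps a ha)) (hk.comp_continuous (by fun_prop) (maps b hb))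
    (inj a ha' h ih) (inj b hb' k ik) (by simpa using h0) (by simpa using h1)
  rwa [rng a ha' h, rng b hb' k] at this

theorem eqOn_of_isGeodesicFrom (hT : IsRTree T) {x y : T} {g g' : ℝ → T}
    (hg : IsGeodesicFrom g x y) (hg' : IsGeodesicFrom g' x y) :
    EqOn g g' (Icc 0 (dist x y)) := by
  intro s hs
  have him := hT.image_Icc_eq dist_nonneg dist_nonneg hg.continuous.continuousOn
    hg'.continuous.continuousOn hg.injOn hg'.injOn (hg.map_zero.trans hg'.map_zero.symm)
    (hg.map_dist.trans hg'.map_dist.symm)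
  obtain ⟨t, ht, hst⟩ : g s ∈ g' '' Icc 0 (dist x y) := him ▸ mem_image_of_mem g hs
  have : s = t := by rw [← hg.dist_left hs, ← hst, hg'.dist_left ht]
  rw [← hst, this]

/-- In an ℝ-tree, a map which is continuous along geodesics issuing from `t₀` is continuous
along some path joining any two given points, and this path strays no further from its
starting point than its endpoint does. -/
theorem exists_path_comp_continuous (hT : IsRTree T) {E : Type*} [TopologicalSpace E]
    {F : T → E} {t₀ : T} {g : T → ℝ → T} (hg : ∀ u, IsGeodesicFrom (g u) t₀ u)
    (hF : ∀ u, ContinuousOn (F ∘ g u) (Icc 0 (dist t₀ u))) (u v : T) :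
    ∃ h : ℝ → T, Continuous h ∧ Continuous (F ∘ h) ∧ h 0 = u ∧ h 1 = v ∧
      ∀ x, dist u (h x) ≤ dist u v := by
  obtain ⟨r, ⟨⟨hr0, hr⟩, hguv⟩, hmax⟩ : ∃ r, (r ∈ Icc 0 (min (dist t₀ u) (dist t₀ v)) ∧
      g u r = g v r) ∧ ∀ s ∈ Icc 0 (min (dist t₀ u) (dist t₀ v)), g u s = g v s → s ≤ r := by
    have hc : IsCompact (Icc 0 (min (dist t₀ u) (dist t₀ v)) ∩ {s | g u s = g v s}) :=
      isCompact_Icc.inter_right (isClosed_eq (hg u).continuous (hg v).continuous)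
    obtain ⟨r, hr, h⟩ := hc.exists_isGreatest
      ⟨0, left_mem_Icc.2 (le_min dist_nonneg dist_nonneg),
        (hg u).map_zero.trans (hg v).map_zero.symm⟩
    exact ⟨r, hr, fun s hs hs' => h ⟨hs, hs'⟩⟩
  have hru := hr.trans (min_le_left _ _)
  have hrv := hr.trans (min_le_right _ _)
  set A := dist t₀ u - r with hA
  set L := A + (dist t₀ v - r) with hL
  have hL0 : 0 ≤ L := by linarith
  let k : ℝ → T := fun x => if x ≤ A then g u (dist t₀ u - x) else g v (x - A + r)
  have hk : Continuous k := by
    refine Continuous.if_le ((hg u).continuous.comp (by fun_prop))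
      ((hg v).continuous.comp (by fun_prop)) continuous_id continuous_const ?_
    rintro x rfl
    rw [hA, sub_sub_cancel, sub_self, zero_add, hguv]
  have hFk : ContinuousOn (F ∘ k) (Icc 0 L) := by
    have hu : ContinuousOn (F ∘ k) (Icc 0 A) := by
      refine ((hF u).comp (f := fun x => dist t₀ u - x) (by fun_prop) fun x hx =>
        ⟨by linarith [hx.2], by linarith [hx.1]⟩).congr fun x hx => ?_
      simp [k, hx.2]
    have hv : ContinuousOn (F ∘ k) (Icc A L) := by
      refine ((hF v).comp (f := fun x => x - A + r) (by fun_prop) fun x hx =>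
        ⟨by linarith [hx.1], by linarith [hx.2]⟩).congr fun x hx => ?_
      rcases hx.1.eq_or_lt with rfl | hlt
      · simp [k, hA, hguv]
      · simp [k, hlt.not_ge]
    have := hu.union_of_isClosed hv isClosed_Icc isClosed_Icc
    rwa [Icc_union_Icc_eq_Icc (by linarith) (by linarith)] at this
  have hk0 : k 0 = u := by
    simp only [k]
    rw [if_pos (by linarith), sub_zero, (hg u).map_dist]
  have hkL : k L = v := by
    rcases hrv.eq_or_lt with h | h
    · simp only [k]
      rw [if_pos (by linarith), show dist t₀ u - L = r by linarith, hguv, h, (hg v).map_dist]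
    · simp only [k]
      rw [if_neg (by linarith), show L - A + r = dist t₀ v by linarith, (hg v).map_dist]
  have hmix : ∀ x ∈ Icc 0 L, ∀ y ∈ Icc 0 L, x ≤ A → ¬ y ≤ A → k x ≠ k y := by
    intro x hx y hy hxA hyA h
    simp only [k, if_pos hxA, if_neg hyA] at h
    have hxm : dist t₀ u - x ∈ Icc 0 (dist t₀ u) := ⟨by linarith, by linarith [hx.1]⟩
    have hym : y - A + r ∈ Icc 0 (dist t₀ v) := ⟨by linarith, by linarith [hy.2]⟩
    have he : dist t₀ u - x = y - A + r := by
      rw [← (hg u).dist_left hxm, h, (hg v).dist_left hym]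
    rw [he] at h hxm
    linarith [hmax _ ⟨hym.1, le_min hxm.2 hym.2⟩ h]
  have hkinj : InjOn k (Icc 0 L) := by
    intro x hx y hy h
    by_cases hxA : x ≤ A <;> by_cases hyA : y ≤ A
    · simp only [k, if_pos hxA, if_pos hyA] at h
      linarith [(hg u).injOn ⟨by linarith, by linarith [hx.1]⟩
        ⟨by linarith, by linarith [hy.1]⟩ h]
    · exact absurd h (hmix x hx y hy hxA hyA)
    · exact absurd h.symm (hmix y hy x hx hyA hxA)
    · simp only [k, if_neg hxA, if_neg hyA] at h
      linarith [(hg v).injOn ⟨by linarith, by linarith [hx.2]⟩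
        ⟨by linarith, by linarith [hy.2]⟩ h]
  obtain ⟨σ, hσ⟩ := hT.exists_isGeodesicFrom u v
  have him := hT.image_Icc_eq hL0 dist_nonneg hk.continuousOn hσ.continuous.continuousOn hkinj
    hσ.injOn (hk0.trans hσ.map_zero.symm) (hkL.trans hσ.map_dist.symm)
  have hmem : ∀ x : ℝ, L * (projIcc (0 : ℝ) 1 zero_le_one x : ℝ) ∈ Icc 0 L := fun x =>
    ⟨mul_nonneg hL0 (projIcc _ _ _ x).2.1, mul_le_of_le_one_right hL0 (projIcc _ _ _ x).2.2⟩
  have hcont : Continuous fun x : ℝ => L * (projIcc (0 : ℝ) 1 zero_le_one x : ℝ) := by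
    fun_prop
  refine ⟨fun x => k (L * (projIcc (0 : ℝ) 1 zero_le_one x : ℝ)), hk.comp hcont,
    hFk.comp_continuous hcont hmem, ?_, ?_, fun x => ?_⟩
  · simp [hk0]
  · simp [hkL]
  · obtain ⟨s, hs, h⟩ : k (L * (projIcc (0 : ℝ) 1 zero_le_one x : ℝ)) ∈
        σ '' Icc 0 (dist u v) := him ▸ mem_image_of_mem k (hmem x)
    simp only
    rw [← h, hσ.dist_left hs]
    exact hs.2

end IsRTree

/-- The concatenation of countably many paths, the `n`-th one being traversed on `[n, n+1]`. -/
theorem exists_continuous_concat {Y : Type*} [TopologicalSpace Y] {k : ℕ → ℝ → Y}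
    (hk : ∀ n, Continuous (k n)) (hglue : ∀ n, k n 1 = k (n + 1) 0) :
    ∃ K : ℝ → Y, Continuous K ∧ ∀ (n : ℕ) (x : ℝ), x ∈ Icc (n : ℝ) (n + 1) →
      K x = k n (x - n) := by
  let D : ℕ → ℝ → Y := Nat.rec (k 0) fun n d x =>
    if x ≤ (n : ℝ) + 1 then d x else k (n + 1) (x - (n + 1))
  have hDs : ∀ n x, D (n + 1) x =
      if x ≤ (n : ℝ) + 1 then D n x else k (n + 1) (x - (n + 1)) := fun _ _ => rfl
  have hDk : ∀ (n : ℕ) (x : ℝ), (n : ℝ) ≤ x → D n x = k n (x - n) := by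
    intro n
    induction n with
    | zero => intro x _; simp [D]
    | succ n ih =>
      intro x hx
      push_cast at hx ⊢
      rw [hDs]
      split_ifs with h
      · obtain rfl : x = n + 1 := le_antisymm h hx
        rw [ih _ (by linarith), add_sub_cancel_left, hglue, sub_self]
      · rfl
  have hDc : ∀ n, Continuous (D n) := by
    intro n
    induction n with
    | zero => exact hk 0
    | succ n ih =>
      refine Continuous.if_le ih ((hk (n + 1)).comp (by fun_prop)) continuous_id
        continuous_const ?_
      rintro x rfl
      refine (hDk n _ (by simp)).trans ?_
      rw [add_sub_cancel_left, hglue, sub_self]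
  have hstable : ∀ m n : ℕ, m ≤ n → ∀ x : ℝ, x ≤ (m : ℝ) + 1 → D n x = D m x := by
    intro m n hmn
    induction n, hmn using Nat.le_induction with
    | base => intro x _; rfl
    | succ n hmn ih =>
      intro x hx
      have : (m : ℝ) ≤ n := by exact_mod_cast hmn
      rw [hDs, if_pos (by linarith), ih x hx]
  have hK : ∀ (n : ℕ) (x : ℝ), x ≤ (n : ℝ) + 1 → D ⌈x⌉₊ x = D n x := by
    intro n x hx
    rcases le_total n ⌈x⌉₊ with h | h
    · exact hstable _ _ h x hx
    · exact (hstable _ _ h x (by linarith [Nat.le_ceil x])).symm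
  refine ⟨fun x => D ⌈x⌉₊ x, continuous_iff_continuousAt.2 fun x => ?_, fun n x hx => ?_⟩
  · refine (hDc ⌈x⌉₊).continuousAt.congr ?_
    filter_upwards [Iio_mem_nhds (show x < (⌈x⌉₊ : ℝ) + 1 by linarith [Nat.le_ceil x])] with y hy
    exact (hK _ y hy.le).symm
  · simp only
    rw [hK n x hx.2, hDk n x hx.1]

/-- A lift of `f` which is continuous along small paths joining any two points sends convergent
sequences to convergent sequences. -/
theorem LiftsPathsUniquely.exists_tendsto {E X T : Type*} [TopologicalSpace E]
    [TopologicalSpace X] [MetricSpace T] {p : E → X} (hlift : LiftsPathsUniquely p)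
    (hp : Continuous p) {f : T → X} (hf : Continuous f) {F : T → E} (hpF : ∀ t, p (F t) = f t)
    (hpath : ∀ u v : T, ∃ h : ℝ → T, Continuous h ∧ Continuous (F ∘ h) ∧ h 0 = u ∧ h 1 = v ∧
      ∀ x, dist u (h x) ≤ dist u v)
    {w : ℕ → T} {t : T} (hw : Tendsto w atTop (𝓝 t)) :
    ∃ e, Tendsto (F ∘ w) atTop (𝓝 e) := by
  choose h hc hFc h0 h1 hd using fun n => hpath (w n) (w (n + 1))
  obtain ⟨K, hK, hKh⟩ := exists_continuous_concat (k := fun n x => (h n x, F (h n x)))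
    (fun n => (hc n).prodMk (hFc n)) (fun n => by simp [h0, h1])
  have hKn : ∀ n : ℕ, (K n).1 = w n := fun n => by
    simp [hKh n n ⟨le_rfl, by simp⟩, h0]
  have hKfloor : ∀ x : ℝ, 0 ≤ x → K x = (h ⌊x⌋₊ (x - ⌊x⌋₊), F (h ⌊x⌋₊ (x - ⌊x⌋₊))) :=
    fun x hx => hKh _ x ⟨Nat.floor_le hx, (Nat.lt_floor_add_one x).le⟩
  have hFK : ∀ x : ℝ, 0 ≤ x → F (K x).1 = (K x).2 := fun x hx => by rw [hKfloor x hx]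
  have hKlim : Tendsto (fun x => (K x).1) atTop (𝓝 t) := by
    have hsmall : Tendsto (fun n => dist (w n) (w (n + 1)) + dist (w n) t) atTop (𝓝 0) := by
      have h1 := hw.dist (hw.comp (tendsto_add_atTop_nat 1))
      have h2 := hw.dist (tendsto_const_nhds (x := t))
      simpa using h1.add h2
    rw [tendsto_iff_dist_tendsto_zero]
    refine squeeze_zero' (Eventually.of_forall fun _ => dist_nonneg) ?_
      (hsmall.comp (tendsto_nat_floor_atTop (α := ℝ)))
    filter_upwards [eventually_ge_atTop 0] with x hx
    rw [hKfloor x hx]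
    refine (dist_triangle_left _ _ (w ⌊x⌋₊)).trans ?_
    exact add_le_add_left (hd _ _) _
  let δ : ℝ → T := fun s => if s < 1 then (K (s / (1 - s))).1 else t
  have hcont : ∀ s : ℝ, s < 1 → ContinuousAt (fun s : ℝ => K (s / (1 - s))) s := fun s hs =>
    hK.continuousAt.comp (f := fun s : ℝ => s / (1 - s))
      (continuousAt_id.div (by fun_prop) (by linarith))
  have hδ : ContinuousOn δ (Icc 0 1) := by
    intro s hs
    rcases hs.2.eq_or_lt with rfl | hs1
    · have htop : Tendsto (fun s : ℝ => s / (1 - s)) (𝓝[<] 1) atTop := by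
        simp only [div_eq_mul_inv]
        refine Tendsto.pos_mul_atTop one_pos
          (tendsto_nhdsWithin_of_tendsto_nhds tendsto_id) ?_
        refine tendsto_inv_nhdsGT_zero.comp (tendsto_nhdsWithin_iff.2 ⟨?_, ?_⟩)
        · refine tendsto_nhdsWithin_of_tendsto_nhds ?_
          have : Continuous fun s : ℝ => 1 - s := by fun_prop
          simpa using this.tendsto 1
        · filter_upwards [self_mem_nhdsWithin] with s hs
          exact sub_pos.2 (mem_Iio.1 hs)
      have hlt : ContinuousWithinAt δ (Iio 1) 1 := by
        have : δ 1 = t := by simp [δ]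
        rw [ContinuousWithinAt, this]
        refine (hKlim.comp htop).congr' ?_
        filter_upwards [self_mem_nhdsWithin] with s hs
        simp only [δ, if_pos (show s < 1 from hs), Function.comp_apply]
      exact (continuousWithinAt_insert_self.2 hlt).mono fun s hs => by
        rcases hs.2.eq_or_lt with h | h
        exacts [Or.inl h, Or.inr h]
    · refine ((continuous_fst.continuousAt.comp (hcont s hs1)).congr ?_).continuousWithinAt
      filter_upwards [Iio_mem_nhds hs1] with y hy
      simp only [δ, if_pos (show y < 1 from hy), Function.comp_apply]
  obtain ⟨β, hβ, hβ0, hpβ⟩ := hlift.exists_lift_Icc zero_le_one (hf.comp_continuousOn hδ)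
    (e := F (δ 0)) (hpF _)
  have hβF : ∀ s ∈ Ico (0 : ℝ) 1, β s = F (δ s) := by
    intro s hs
    have hFδ : ContinuousOn (F ∘ δ) (Icc 0 s) := by
      have : ContinuousOn (fun s : ℝ => (K (s / (1 - s))).2) (Icc 0 s) := fun y hy =>
        (continuous_snd.continuousAt.comp
          (hcont y (hy.2.trans_lt hs.2))).continuousWithinAt
      refine this.congr fun y hy => ?_
      have hy1 : y < 1 := hy.2.trans_lt hs.2
      simp only [δ, if_pos hy1, Function.comp_apply]
      exact hFK _ (div_nonneg hy.1 (by linarith))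
    exact hlift.eqOn_Icc hp hβ.continuousOn hFδ hβ0
      (fun y hy => (hpβ y ⟨hy.1, hy.2.trans hs.2.le⟩).trans (hpF _).symm) ⟨hs.1, le_rfl⟩
  refine ⟨β 1, ?_⟩
  have hseq := (hβ.tendsto 1).comp (tendsto_natCast_div_add_atTop (1 : ℝ))
  refine hseq.congr fun n => ?_
  have hn : (n : ℝ) / (n + 1) < 1 := (div_lt_one (by positivity)).2 (by linarith)
  have hdiv : (n : ℝ) / (n + 1) / (1 - n / (n + 1)) = n := by
    field_simp
    simp
  rw [Function.comp_apply, hβF _ ⟨by positivity, hn⟩]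
  simp only [δ, if_pos hn, hdiv, hKn, Function.comp_apply]

/-- A lift of `f` which is continuous along small paths joining any two points is continuous. -/
theorem LiftsPathsUniquely.continuous_of_path {E X T : Type*} [TopologicalSpace E] [T2Space E]
    [TopologicalSpace X] [MetricSpace T] {p : E → X} (hlift : LiftsPathsUniquely p)
    (hp : Continuous p) {f : T → X} (hf : Continuous f) {F : T → E} (hpF : ∀ t, p (F t) = f t)
    (hpath : ∀ u v : T, ∃ h : ℝ → T, Continuous h ∧ Continuous (F ∘ h) ∧ h 0 = u ∧ h 1 = v ∧
      ∀ x, dist u (h x) ≤ dist u v) : Continuous F := by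
  refine SeqContinuous.continuous fun u t hu => ?_
  let w : ℕ → T := fun n => if Even n then t else u (n / 2)
  have hw : Tendsto w atTop (𝓝 t) :=
    tendsto_const_nhds.if' (hu.comp (Nat.tendsto_div_const_atTop two_ne_zero))
  obtain ⟨e, he⟩ := hlift.exists_tendsto hp hf hpF hpath hw
  have heven : Tendsto (fun n : ℕ => 2 * n) atTop atTop :=
    tendsto_id.const_mul_atTop' two_pos
  have hodd : Tendsto (fun n : ℕ => 2 * n + 1) atTop atTop :=
    (tendsto_add_atTop_nat 1).comp heven
  have h1 : Tendsto (fun _ : ℕ => F t) atTop (𝓝 e) :=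
    (he.comp heven).congr fun n => by simp [w]
  have h2 : Tendsto (F ∘ u) atTop (𝓝 e) := (he.comp hodd).congr fun n => by
    have : (2 * n + 1) / 2 = n := by omega
    simp [w, this]
  rwa [tendsto_nhds_unique tendsto_const_nhds h1]

/-- A map with unique lifting of paths rel. starting point uniquely lifts maps from
ℝ-trees. -/
theorem rTree_lifting {E X : Type*} [TopologicalSpace E] [TopologicalSpace X]
    [T2Space E] [T2Space X]
    (p : E → X) (hp : Continuous p) (hlift : LiftsPathsUniquely p) (e₀ : E)
    (T : Type) [MetricSpace T] (hT : IsRTree T) (t₀ : T)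
    (f : T → X) (hf : Continuous f) (hf₀ : f t₀ = p e₀) :
    ∃! ft : T → E, Continuous ft ∧ ft t₀ = e₀ ∧ p ∘ ft = f := by
  have hgeo := fun u => hT.exists_isGeodesicFrom t₀ u
  choose g hg using hgeo
  have hlifts := fun u => hlift.exists_lift_Icc (d := dist t₀ u) dist_nonneg
    (hf.comp (hg u).continuous).continuousOn (e := e₀)
    (by rw [Function.comp_apply, (hg u).map_zero, hf₀])
  choose β hβ hβ0 hpβ using hlifts
  let F : T → E := fun u => β u (dist t₀ u)
  have hpF : ∀ u, p (F u) = f u := fun u => by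
    rw [hpβ u _ (right_mem_Icc.2 dist_nonneg), Function.comp_apply, (hg u).map_dist]
  have hFg : ∀ u, EqOn (F ∘ g u) (β u) (Icc 0 (dist t₀ u)) := by
    intro u s hs
    have hd := (hg u).dist_left hs
    have heq := hT.eqOn_of_isGeodesicFrom (hg (g u s)) ((hg u).restrict hs)
    refine hlift.eqOn_Icc hp (hβ _).continuousOn (hβ u).continuousOn
      ((hβ0 _).trans (hβ0 u).symm) (fun x hx => ?_)
      (show dist t₀ (g u s) ∈ Icc 0 (dist t₀ (g u s)) from right_mem_Icc.2 dist_nonneg)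
      |>.trans (congrArg (β u) hd)
    rw [hpβ _ x hx, hpβ u x ⟨hx.1, hx.2.trans (hd.le.trans hs.2)⟩, Function.comp_apply,
      Function.comp_apply, heq hx]
  have hF0 : F t₀ = e₀ := by simp only [F, dist_self, hβ0]
  refine ⟨F, ⟨hlift.continuous_of_path hp hf hpF (hT.exists_path_comp_continuous hg
    fun u => (hβ u).continuousOn.congr (hFg u)), hF0, funext hpF⟩, ?_⟩
  rintro F' ⟨hF', hF'0, hpF'⟩
  funext u
  have := hlift.eqOn_Icc hp (hF'.comp (hg u).continuous).continuousOn (hβ u).continuousOn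
    (by rw [Function.comp_apply, (hg u).map_zero, hF'0, hβ0])
    (fun x hx => by rw [hpβ u x hx]; exact congrFun hpF' _)
    (right_mem_Icc.2 (dist_nonneg (x := t₀) (y := u)))
  rwa [Function.comp_apply, (hg u).map_dist] at this
end
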